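/- arXiv:1511.05535 — 2 statements merged into one kernel-verified Lean document; each statement's English description precedes it below -/
import Mathlib

section
/- Octahedron recurrence with principal coefficients (Theorem 3.4): Let a seed be reached from the initial seed of the T-system with principal coefficients by a finite sequence of allowed mutations, and let k be its height function (a stepped surface), with cluster variable T(i,j,k(i,j)) at vertex (i,j). If m ∈ ℤ is such that k(i−1,j) = k(i+1,j) = k(i,j−1) = k(i,j+1) = m and k(i,j) = m−1, then the upward mutation at (i,j) produces a new cluster variable T(i,j,m+1) satisfying T(i,j,m−1)·T(i,j,m+1) = J(i,j,m)·T(i−1,j,m)·T(i+1,j,m) + I(i,j,m)·T(i,j−1,m)·T(i,j+1,m), where I and J are interpreted in the ambient field via the monomial embedding of the tropical semifield. -/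
noncomputable section
open Classical

namespace OctahedronTSystem

/-- A stepped surface: a height function on `ℤ × ℤ` changing by exactly `1`
between lattice-adjacent points. -/
def SteppedSurface (k : ℤ × ℤ → ℤ) : Prop :=
  ∀ a b : ℤ × ℤ, |a.1 - b.1| + |a.2 - b.2| = 1 → |k a - k b| = 1

/-- The fundamental stepped surface `fund(i,j) = ((i+j) mod 2) - 1`. -/
def fund : ℤ × ℤ → ℤ := fun v => (v.1 + v.2) % 2 - 1

/-- Index type for the independent variables: `t(i,j)` on the left, `c(i,j)` on the right. -/
abbrev Var : Type := (ℤ × ℤ) ⊕ (ℤ × ℤ)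

/-- The ambient field of rational functions over `ℚ` in the independent variables
`t(i,j)` and `c(i,j)`, `(i,j) ∈ ℤ × ℤ`. -/
abbrev F : Type := FractionRing (MvPolynomial Var ℚ)

/-- The variable `t(i,j)` as an element of the ambient field. -/
def tv (v : ℤ × ℤ) : F := algebraMap (MvPolynomial Var ℚ) F (MvPolynomial.X (Sum.inl v))

/-- The variable `c(i,j)` as an element of the ambient field. -/
def cv (v : ℤ × ℤ) : F := algebraMap (MvPolynomial Var ℚ) F (MvPolynomial.X (Sum.inr v))

/-- `I(i,j,m) = ∏_{a=m+1}^{-m-1} c(i+a,j)` if `m < 0` and `1` otherwise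
(the interval `[m+1, -m-1]` is empty when `m ≥ 0`). -/
def coefI {C : Type*} [CommMonoid C] (c : ℤ × ℤ → C) (i j m : ℤ) : C :=
  ∏ a ∈ Finset.Icc (m + 1) (-m - 1), c (i + a, j)

/-- `J(i,j,m) = ∏_{a=-m}^{m} c(i,j+a)` if `m ≥ 0` and `1` otherwise
(the interval `[-m, m]` is empty when `m < 0`). -/
def coefJ {C : Type*} [CommMonoid C] (c : ℤ × ℤ → C) (i j m : ℤ) : C :=
  ∏ a ∈ Finset.Icc (-m) m, c (i, j + a)

/-- The tropical semifield `Trop(c(i,j) : (i,j) ∈ ℤ×ℤ)`: the free multiplicative abelian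
group on the symbols `c(i,j)`, written additively as finitely supported exponent
functions `(ℤ × ℤ) →₀ ℤ`. -/
abbrev TropP : Type := (ℤ × ℤ) →₀ ℤ

/-- The auxiliary (tropical) addition `⊕`: exponentwise minimum.  The multiplicative
identity `1` of the tropical semifield is `0 : TropP`. -/
def tropAdd (f g : TropP) : TropP := Finsupp.zipWith min (min_self 0) f g

/-- `I(i,j,m)` as an element of the tropical semifield (written additively). -/
def pI (i j m : ℤ) : TropP :=
  ∑ a ∈ Finset.Icc (m + 1) (-m - 1), Finsupp.single ((i + a, j) : ℤ × ℤ) (1 : ℤ)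

/-- `J(i,j,m)` as an element of the tropical semifield (written additively). -/
def pJ (i j m : ℤ) : TropP :=
  ∑ a ∈ Finset.Icc (-m) m, Finsupp.single ((i, j + a) : ℤ × ℤ) (1 : ℤ)

/-- Embedding of the tropical semifield into the ambient field `F`, sending an exponent
function to the corresponding Laurent monomial in the `c(i,j)`. -/
def embP (f : TropP) : F := ∏ v ∈ f.support, cv v ^ f v

/-- A (labelled) seed: cluster variables `x`, coefficients `y` in the tropical semifield,
and an exchange matrix `b`. -/
structure Seed where
  x : ℤ × ℤ → F
  y : ℤ × ℤ → TropP
  b : (ℤ × ℤ) → (ℤ × ℤ) → ℤ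

/-- Seed mutation `μ_v` (coefficients written additively in the tropical semifield;
`ŷ⁺ = y(v)/(y(v) ⊕ 1)` becomes `s.y v - tropAdd (s.y v) 0` and
`ŷ⁻ = 1/(y(v) ⊕ 1)` becomes `-(tropAdd (s.y v) 0)`). -/
def mutate (s : Seed) (v : ℤ × ℤ) : Seed where
  b := fun u w =>
    if u = v ∨ w = v then -s.b u w
    else s.b u w + (s.b u v).sign * max (s.b u v * s.b v w) 0
  y := fun u =>
    if u = v then -s.y v
    else s.y u + max (s.b v u) 0 • (s.y v - tropAdd (s.y v) 0)
           + max (-s.b v u) 0 • tropAdd (s.y v) 0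
  x := fun u =>
    if u = v then
      (s.x v)⁻¹ *
        (embP (s.y v - tropAdd (s.y v) 0) *
            ∏ᶠ u' : ℤ × ℤ, s.x u' ^ (max (s.b u' v) 0).toNat +
         embP (-tropAdd (s.y v) 0) *
            ∏ᶠ u' : ℤ × ℤ, s.x u' ^ (max (-s.b u' v) 0).toNat)
    else s.x u

/-- The initial seed of the T-system with principal coefficients: cluster variables
`t(i,j)`, coefficients `c(i,j)`, and the octahedron-quiver exchange matrix. -/
def initialSeed : Seed where
  x := tv
  y := fun v => Finsupp.single v 1
  b := fun u w =>
    (if (w.1 + w.2) % 2 = 0 then 1 else -1) *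
      ((if u = (w.1 - 1, w.2) then 1 else 0) + (if u = (w.1 + 1, w.2) then 1 else 0)
        - (if u = (w.1, w.2 - 1) then 1 else 0) - (if u = (w.1, w.2 + 1) then 1 else 0))

/-- `Reachable s k` : the seed `s`, with height function (stepped surface) `k`, is
obtained from the initial seed (with height function `fund`) by a finite sequence of
allowed mutations.  A mutation at `(i,j)` is allowed when the four lattice neighbours
have equal height; it is upward or downward according to that common height. -/
inductive Reachable : Seed → (ℤ × ℤ → ℤ) → Prop
  | init : Reachable initialSeed fund
  | up (s : Seed) (h : ℤ × ℤ → ℤ) (i j : ℤ) :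
      Reachable s h →
      h (i - 1, j) = h (i, j) + 1 → h (i + 1, j) = h (i, j) + 1 →
      h (i, j - 1) = h (i, j) + 1 → h (i, j + 1) = h (i, j) + 1 →
      Reachable (mutate s (i, j)) (Function.update h (i, j) (h (i, j) + 2))
  | down (s : Seed) (h : ℤ × ℤ → ℤ) (i j : ℤ) :
      Reachable s h →
      h (i - 1, j) = h (i, j) - 1 → h (i + 1, j) = h (i, j) - 1 →
      h (i, j - 1) = h (i, j) - 1 → h (i, j + 1) = h (i, j) - 1 →
      Reachable (mutate s (i, j)) (Function.update h (i, j) (h (i, j) - 2))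

/-! ### Auxiliary material -/

/-- exchange matrix of a stepped surface -/
def B (k : ℤ × ℤ → ℤ) (u w : ℤ × ℤ) : ℤ :=
  if u.2 = w.2 ∧ (u.1 = w.1 + 1 ∨ u.1 = w.1 - 1) then k u - k w
  else if u.1 = w.1 ∧ (u.2 = w.2 + 1 ∨ u.2 = w.2 - 1) then k w - k u
  else if (u.1 = w.1 + 1 ∨ u.1 = w.1 - 1) ∧ (u.2 = w.2 + 1 ∨ u.2 = w.2 - 1) then
    (k (w.1, u.2) - k (u.1, w.2)) / 2
  else 0

def gA (x y n : ℤ) : ℤ := (max 0 (n - |x| - |y|)) / 2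
def gB (s y : ℤ) : ℤ := (max 0 (s - |y|)) / 2

def gg (c : ℤ × ℤ) (i j m : ℤ) : ℤ :=
  - gA (i - c.1) (j - c.2) (m + 1 - (c.1 + c.2) % 2)
  + gB ((i - c.1) + (m + 1 - (c.1 + c.2) % 2)) (j - c.2)
  - gB ((i - c.1) - (m + 1 - (c.1 + c.2) % 2)) (j - c.2)

def Jc (c : ℤ × ℤ) (i j m : ℤ) : ℤ := if c.1 = i ∧ |j - c.2| ≤ m then 1 else 0
def Ic (c : ℤ × ℤ) (i j m : ℤ) : ℤ := if c.2 = j ∧ |i - c.1| ≤ - m - 1 then 1 else 0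

theorem gA_x (x y n : ℤ) (h : (x + y + n) % 2 = 1) :
    gA (x+1) y n + gA (x-1) y n - gA x y (n+1) - gA x y (n-1)
      = - (if x = 0 ∧ |y| + 1 ≤ n then 1 else 0) := by
  unfold gA
  have : (x + |y| + n) % 2 = 1 := by
    rcases abs_cases y with ⟨h, _⟩ | ⟨h, _⟩ <;> rw [h] <;> omega
  have h0 : 0 ≤ |y| := abs_nonneg y
  generalize |y| = Y at *
  rcases lt_trichotomy x 0 with hx | hx | hx
  · rw [abs_of_nonpos (show x + 1 ≤ 0 by omega), abs_of_nonpos (show x - 1 ≤ 0 by omega),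
      abs_of_nonpos hx.le, if_neg (by omega)]
    omega
  · subst hx
    norm_num
    split_ifs <;> omega
  · rw [abs_of_nonneg (show 0 ≤ x + 1 by omega), abs_of_nonneg (show 0 ≤ x - 1 by omega),
      abs_of_nonneg hx.le, if_neg (by omega)]
    omega

theorem gA_symm (x y n : ℤ) : gA x y n = gA y x n := by
  unfold gA; congr 2; ring

theorem gB_y (s y : ℤ) (h : (s + y) % 2 = 1) :
    gB s (y+1) + gB s (y-1) - gB (s+1) y - gB (s-1) y
      = - (if y = 0 ∧ 1 ≤ s then 1 else 0) := by
  have := gA_x y 0 s (by omega)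
  simpa [gA, gB] using this

theorem gg_x (c : ℤ × ℤ) (i j m : ℤ) (h : (i + j + m) % 2 = 0) :
    gg c (i+1) j m + gg c (i-1) j m - gg c i j (m+1) - gg c i j (m-1) = Jc c i j m := by
  have h1 := gA_x (i - c.1) (j - c.2) (m + 1 - (c.1 + c.2) % 2) (by omega)
  have e : (if i - c.1 = 0 ∧ |j - c.2| + 1 ≤ m + 1 - (c.1 + c.2) % 2 then (1:ℤ) else 0)
      = Jc c i j m := by
    unfold Jc
    rcases abs_cases (j - c.2) with ⟨h, _⟩ | ⟨h, _⟩ <;> rw [h] <;> congr 1 <;> 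
      apply propext <;> omega
  rw [e] at h1
  unfold gg
  rw [← neg_eq_iff_eq_neg] at h1
  rw [← h1]
  have a1 : i + 1 - c.1 = (i - c.1) + 1 := by ring
  have a2 : i - 1 - c.1 = (i - c.1) - 1 := by ring
  rw [a1, a2]
  ring_nf

theorem gg_y (c : ℤ × ℤ) (i j m : ℤ) (h : (i + j + m) % 2 = 0) :
    gg c i (j+1) m + gg c i (j-1) m - gg c i j (m+1) - gg c i j (m-1) = Ic c i j m := by
  have h1 := gA_x (j - c.2) (i - c.1) (m + 1 - (c.1 + c.2) % 2) (by omega)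
  have h2 := gB_y ((i - c.1) + (m + 1 - (c.1 + c.2) % 2)) (j - c.2) (by omega)
  have h3 := gB_y ((i - c.1) - (m + 1 - (c.1 + c.2) % 2)) (j - c.2) (by omega)
  have e : (if j - c.2 = 0 ∧ |i - c.1| + 1 ≤ m + 1 - (c.1 + c.2) % 2 then (1:ℤ) else 0)
     - (if j - c.2 = 0 ∧ 1 ≤ ((i - c.1) + (m + 1 - (c.1 + c.2) % 2)) then (1:ℤ) else 0)
     + (if j - c.2 = 0 ∧ 1 ≤ ((i - c.1) - (m + 1 - (c.1 + c.2) % 2)) then (1:ℤ) else 0)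
      = Ic c i j m := by
    unfold Ic
    by_cases hj : j - c.2 = 0
    · have : c.2 = j := by omega
      simp only [hj, this, true_and]
      rcases abs_cases (i - c.1) with ⟨h, _⟩ | ⟨h, _⟩ <;> rw [h] <;> split_ifs <;> omega
    · have : ¬ c.2 = j := by omega
      simp [hj, this]
  rw [← e]
  rw [gA_symm _ (i - c.1), gA_symm _ (i - c.1), gA_symm _ (i - c.1), gA_symm _ (i - c.1)] at h1
  unfold gg
  have a1 : j + 1 - c.2 = (j - c.2) + 1 := by ring
  have a2 : j - 1 - c.2 = (j - c.2) - 1 := by ring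
  rw [a1, a2]
  have b1 : m + 1 + 1 - (c.1 + c.2) % 2 = m + 1 - (c.1 + c.2) % 2 + 1 := by ring
  have b2 : m - 1 + 1 - (c.1 + c.2) % 2 = m + 1 - (c.1 + c.2) % 2 - 1 := by ring
  rw [b1, b2]
  generalize m + 1 - (c.1 + c.2) % 2 = n at *
  generalize i - c.1 = x at *
  have c1 : x + (n + 1) = x + n + 1 := by ring
  have c2 : x + (n - 1) = x + n - 1 := by ring
  have c3 : x - (n + 1) = x - n - 1 := by ring
  have c4 : x - (n - 1) = x - n + 1 := by ring
  rw [c1, c2, c3, c4]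
  linarith

/-- exponent of `c` in the coefficient at `(p,q)` -/
def Y (k : ℤ × ℤ → ℤ) (c : ℤ × ℤ) (p q : ℤ) : ℤ :=
  (k (p+1,q) - k (p,q)) * gg c (p+1) q (k (p+1,q))
  + (k (p-1,q) - k (p,q)) * gg c (p-1) q (k (p-1,q))
  + (k (p,q) - k (p,q+1)) * gg c p (q+1) (k (p,q+1))
  + (k (p,q) - k (p,q-1)) * gg c p (q-1) (k (p,q-1))
  + (k (p,q+1) - k (p+1,q)) / 2 * gg c (p+1) (q+1) (k (p+1,q+1))
  + (k (p,q+1) - k (p-1,q)) / 2 * gg c (p-1) (q+1) (k (p-1,q+1))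
  + (k (p,q-1) - k (p+1,q)) / 2 * gg c (p+1) (q-1) (k (p+1,q-1))
  + (k (p,q-1) - k (p-1,q)) / 2 * gg c (p-1) (q-1) (k (p-1,q-1))

theorem Y_flat (k : ℤ × ℤ → ℤ) (c : ℤ × ℤ) (i j m e : ℤ) (hp : (i + j + m) % 2 = 0)
    (h1 : k (i - 1, j) = m) (h2 : k (i + 1, j) = m)
    (h3 : k (i, j - 1) = m) (h4 : k (i, j + 1) = m)
    (h5 : k (i, j) = m - e) : Y k c i j = e * (Jc c i j m - Ic c i j m) := by
  unfold Y
  rw [h1, h2, h3, h4, h5, ← gg_x c i j m hp, ← gg_y c i j m hp]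
  simp
  ring

theorem JI (c : ℤ × ℤ) (i j m : ℤ) : (Jc c i j m = 0 ∧ Ic c i j m = 0) ∨
   (Jc c i j m = 1 ∧ Ic c i j m = 0) ∨ (Jc c i j m = 0 ∧ Ic c i j m = 1) := by
  have := abs_nonneg (j - c.2)
  have := abs_nonneg (i - c.1)
  unfold Jc Ic; split_ifs <;> omega

/-- the values of `B` next to a flat vertex -/
theorem B_flat (k : ℤ × ℤ → ℤ) (i j m e : ℤ)
    (h1 : k (i - 1, j) = m) (h2 : k (i + 1, j) = m)
    (h3 : k (i, j - 1) = m) (h4 : k (i, j + 1) = m)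
    (h5 : k (i, j) = m - e) (u : ℤ × ℤ) :
    B k u (i, j) = if u = (i-1,j) ∨ u = (i+1,j) then e
      else if u = (i,j-1) ∨ u = (i,j+1) then -e else 0 := by
  obtain ⟨a, b⟩ := u
  simp only [B, Prod.mk.injEq]
  split_ifs <;> grind

theorem B_flat' (k : ℤ × ℤ → ℤ) (i j m e : ℤ)
    (h1 : k (i - 1, j) = m) (h2 : k (i + 1, j) = m)
    (h3 : k (i, j - 1) = m) (h4 : k (i, j + 1) = m)
    (h5 : k (i, j) = m - e) (u : ℤ × ℤ) :
    B k (i, j) u = if u = (i-1,j) ∨ u = (i+1,j) then -e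
      else if u = (i,j-1) ∨ u = (i,j+1) then e else 0 := by
  obtain ⟨a, b⟩ := u
  simp only [B, Prod.mk.injEq]
  split_ifs <;> grind

theorem Y_far (k k' : ℤ × ℤ → ℤ) (c : ℤ × ℤ) (p q : ℤ)
    (e0 : k' (p, q) = k (p, q)) (e1 : k' (p+1, q) = k (p+1, q)) (e2 : k' (p-1, q) = k (p-1, q))
    (e3 : k' (p, q+1) = k (p, q+1)) (e4 : k' (p, q-1) = k (p, q-1))
    (f1 : k' (p+1, q+1) = k (p+1, q+1) ∨ k (p, q+1) = k (p+1, q))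
    (f2 : k' (p-1, q+1) = k (p-1, q+1) ∨ k (p, q+1) = k (p-1, q))
    (f3 : k' (p+1, q-1) = k (p+1, q-1) ∨ k (p, q-1) = k (p+1, q))
    (f4 : k' (p-1, q-1) = k (p-1, q-1) ∨ k (p, q-1) = k (p-1, q)) :
    Y k' c p q = Y k c p q := by
  unfold Y
  rw [e0, e1, e2, e3, e4]
  congr 1
  · congr 1
    · congr 1
      · congr 1
        rcases f1 with h | h <;> rw [h]
        simp
      · rcases f2 with h | h <;> rw [h]
        simp
    · rcases f3 with h | h <;> rw [h]
      simp
  · rcases f4 with h | h <;> rw [h]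
    simp

/-- effect of a flip on the coefficients -/
theorem Y_mut (k : ℤ × ℤ → ℤ) (hk : ∀ p q, (p + q + k (p, q)) % 2 = 1)
    (c : ℤ × ℤ) (i j m e : ℤ) (he : e = 1 ∨ e = -1) 
    (h1 : k (i - 1, j) = m) (h2 : k (i + 1, j) = m)
    (h3 : k (i, j - 1) = m) (h4 : k (i, j + 1) = m)
    (h5 : k (i, j) = m - e) (p q : ℤ) :
    Y (Function.update k (i,j) (m + e)) c p q =
      if (p, q) = (i, j) then - Y k c i j
      else Y k c p q + max (B k (i,j) (p,q)) 0 * (Y k c i j - min (Y k c i j) 0)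
        + max (- B k (i,j) (p,q)) 0 * min (Y k c i j) 0 := by
  have hp : (i + j + m) % 2 = 0 := by have := hk (i-1) j; rw [h1] at this; omega
  have yf := Y_flat k c i j m e hp h1 h2 h3 h4 h5
  have gx := gg_x c i j m hp
  have gy := gg_y c i j m hp
  have ji := JI c i j m
  rw [B_flat' k i j m e h1 h2 h3 h4 h5]
  by_cases c0 : (p, q) = (i, j)
  · rw [if_pos c0]
    cases c0
    rw [yf, Y_flat _ c i j m (-e) hp]
    · ring
    all_goals simp [Function.update_apply, *]
  rw [if_neg c0]
  rw [yf]
  have s1 : ∀ p q : ℤ, (p + q) % 2 = (i + j) % 2 → 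
      (k (p, q) - (m + e)) / 2 = (k (p, q) - (m - e)) / 2 - e ∧
      (m + e - k (p, q)) / 2 = (m - e - k (p, q)) / 2 + e := by
    intro p q hpq
    have := hk p q
    rcases he with rfl | rfl <;> omega
  have r1 := s1 (i-1) (j+1) (by omega)
  have r2 := s1 (i-1) (j-1) (by omega)
  have r3 := s1 (i+1) (j+1) (by omega)
  have r4 := s1 (i+1) (j-1) (by omega)
  clear s1
  have n1 : ¬ (i - 1 - 1 = i) := by omega
  have n2 : ¬ (i + 1 + 1 = i) := by omega
  have n3 : ¬ (j - 1 - 1 = j) := by omega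
  have n4 : ¬ (j + 1 + 1 = j) := by omega
  have jm : max (-e) 0 * (e * (Jc c i j m - Ic c i j m) - min (e * (Jc c i j m - Ic c i j m)) 0)
        + max (- -e) 0 * min (e * (Jc c i j m - Ic c i j m)) 0 = - e * Ic c i j m  := by
    rcases he with rfl | rfl <;> rcases ji with h | h | h <;> rw [h.1, h.2] <;> norm_num
  have jm2 : max e 0 * (e * (Jc c i j m - Ic c i j m) - min (e * (Jc c i j m - Ic c i j m)) 0)
        + max (- e) 0 * min (e * (Jc c i j m - Ic c i j m)) 0 = e * Jc c i j m  := by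
    rcases he with rfl | rfl <;> rcases ji with h | h | h <;> rw [h.1, h.2] <;> norm_num
  by_cases c1 : (p, q) = (i - 1, j)
  · cases c1
    rw [if_pos (by simp), add_assoc, jm, ← gy]
    unfold Y
    simp [Function.update_apply, h1, h2, h3, h4, h5, r1, r2, r3, r4, n1, n2, n3, n4]
    rcases he with rfl | rfl <;> ring_nf
  by_cases c2 : (p, q) = (i + 1, j)
  · cases c2
    rw [if_pos (by simp), add_assoc, jm, ← gy]
    unfold Y
    simp [Function.update_apply, h1, h2, h3, h4, h5, r1, r2, r3, r4, n1, n2, n3, n4]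
    rcases he with rfl | rfl <;> ring_nf
  by_cases c3 : (p, q) = (i, j - 1)
  · cases c3
    rw [if_neg (by simp), if_pos (by simp), add_assoc, jm2, ← gx]
    unfold Y
    simp [Function.update_apply, h1, h2, h3, h4, h5, r1, r2, r3, r4, n1, n2, n3, n4]
    rcases he with rfl | rfl <;> ring_nf
  by_cases c4 : (p, q) = (i, j + 1)
  · cases c4
    rw [if_neg (by simp), if_pos (by simp), add_assoc, jm2, ← gx]
    unfold Y
    simp [Function.update_apply, h1, h2, h3, h4, h5, r1, r2, r3, r4, n1, n2, n3, n4]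
    rcases he with rfl | rfl <;> ring_nf
  rw [if_neg (by tauto), if_neg (by tauto)]
  simp only [max_self, neg_zero, zero_mul, add_zero]
  simp only [Prod.mk.injEq] at c0 c1 c2 c3 c4
  apply Y_far
  · rw [Function.update_of_ne]; simp only [ne_eq, Prod.mk.injEq]; omega
  · rw [Function.update_of_ne]; simp only [ne_eq, Prod.mk.injEq]; omega
  · rw [Function.update_of_ne]; simp only [ne_eq, Prod.mk.injEq]; omega
  · rw [Function.update_of_ne]; simp only [ne_eq, Prod.mk.injEq]; omega
  · rw [Function.update_of_ne]; simp only [ne_eq, Prod.mk.injEq]; omega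
  all_goals
    rw [Function.update_apply]
    split_ifs with hh
    · right
      simp only [Prod.mk.injEq] at hh
      grind
    · left; rfl

theorem B_key (e : ℤ) (he : e = 1 ∨ e = -1) (Pa Pb Pc Pd : Prop)
    {_ : Decidable Pa} {_ : Decidable Pb} {_ : Decidable Pc} {_ : Decidable Pd} (h : ¬ (Pa ∧ Pd))
    (h' : ¬ (Pb ∧ Pc)) :
    (if Pa then e else if Pb then -e else 0).sign *
      max ((if Pa then e else if Pb then -e else 0) *
        (if Pc then -e else if Pd then e else 0)) 0 = 0 := by
  by_cases a : Pa <;> by_cases b : Pb <;> by_cases c : Pc <;> by_cases d : Pd <;>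
    simp_all <;> rcases he with rfl | rfl <;> simp

set_option maxHeartbeats 1000000 in
theorem B_mut (k : ℤ × ℤ → ℤ) (hk : ∀ p q, (p + q + k (p, q)) % 2 = 1)
    (i j m e : ℤ) (he : e = 1 ∨ e = -1) 
    (h1 : k (i - 1, j) = m) (h2 : k (i + 1, j) = m)
    (h3 : k (i, j - 1) = m) (h4 : k (i, j + 1) = m)
    (h5 : k (i, j) = m - e) (u w : ℤ × ℤ) :
    B (Function.update k (i,j) (m + e)) u w =
      if u = (i, j) ∨ w = (i, j) then - B k u w
      else B k u w + (B k u (i,j)).sign * max (B k u (i,j) * B k (i,j) w) 0 := by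
  rw [B_flat k i j m e h1 h2 h3 h4 h5, B_flat' k i j m e h1 h2 h3 h4 h5]
  by_cases hu : u = (i, j)
  · subst hu
    rw [if_pos (by simp), B_flat' k i j m e h1 h2 h3 h4 h5, B_flat' _ i j m (-e)]
    · split_ifs <;> simp
    all_goals simp [Function.update_apply, *]
  by_cases hw : w = (i, j)
  · subst hw
    rw [if_pos (by simp), B_flat k i j m e h1 h2 h3 h4 h5, B_flat _ i j m (-e)]
    · split_ifs <;> simp
    all_goals simp [Function.update_apply, *]
  rw [if_neg (by tauto)]
  obtain ⟨a, b⟩ := u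
  obtain ⟨c, d⟩ := w
  have hs : (e.sign = e) ∧ (-e).sign = -e ∧ e * e = 1 := by
    rcases he with rfl | rfl <;> decide
  have k1 := hk (i+1) (j+1)
  have k2 := hk (i+1) (j-1)
  have k3 := hk (i-1) (j+1)
  have k4 := hk (i-1) (j-1)
  have k0 := hk i j
  simp only [B, Function.update_of_ne hu, Function.update_of_ne hw]
  simp only [Function.update_apply]
  simp only [Prod.mk.injEq] at *
  by_cases g1 : a = i ∧ (b = j + 1 ∨ b = j - 1) ∧ (c = i + 1 ∨ c = i - 1) ∧ d = j
  · obtain ⟨rfl, rfl | rfl, rfl | rfl, rfl⟩ := g1 <;> simp [hs] <;> rcases he with rfl | rfl <;> (try simp) <;> omega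
  by_cases g2 : c = i ∧ (d = j + 1 ∨ d = j - 1) ∧ (a = i + 1 ∨ a = i - 1) ∧ b = j
  · obtain ⟨rfl, rfl | rfl, rfl | rfl, rfl⟩ := g2 <;> simp [hs] <;> rcases he with rfl | rfl <;> (try simp) <;> omega
  rw [B_key e he _ _ _ _ (by clear * - g2; grind) (by clear * - g1; grind), add_zero]
  by_cases D : (a = c + 1 ∨ a = c - 1) ∧ (b = d + 1 ∨ b = d - 1)
  · have z1 : ¬ (c = i ∧ b = j) := by clear * - g2 D; grind
    have z2 : ¬ (a = i ∧ d = j) := by clear * - g1 D; grind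
    simp only [if_neg z1, if_neg z2]
  · simp only [if_neg D]

def Pos (f : F) : Prop := ∃ p q : MvPolynomial Var ℚ,
  0 < MvPolynomial.eval (fun _ => (1:ℚ)) p ∧ 0 < MvPolynomial.eval (fun _ => (1:ℚ)) q ∧
  f = algebraMap _ F p / algebraMap _ F q

theorem am_ne {p : MvPolynomial Var ℚ} (h : 0 < MvPolynomial.eval (fun _ => (1:ℚ)) p) :
    algebraMap (MvPolynomial Var ℚ) F p ≠ 0 := by
  intro h0
  rw [IsFractionRing.to_map_eq_zero_iff] at h0
  simp [h0] at h

theorem Pos.ne {f : F} (h : Pos f) : f ≠ 0 := by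
  obtain ⟨p, q, hp, hq, rfl⟩ := h
  exact div_ne_zero (am_ne hp) (am_ne hq)

theorem Pos.one : Pos 1 := ⟨1, 1, by simp, by simp, by simp⟩

theorem Pos.mul {f g : F} (hf : Pos f) (hg : Pos g) : Pos (f * g) := by
  obtain ⟨p, q, hp, hq, rfl⟩ := hf
  obtain ⟨p', q', hp', hq', rfl⟩ := hg
  refine ⟨p * p', q * q', by rw [map_mul]; positivity, by rw [map_mul]; positivity, ?_⟩
  rw [map_mul, map_mul, div_mul_div_comm]

theorem Pos.add {f g : F} (hf : Pos f) (hg : Pos g) : Pos (f + g) := by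
  obtain ⟨p, q, hp, hq, rfl⟩ := hf
  obtain ⟨p', q', hp', hq', rfl⟩ := hg
  refine ⟨p * q' + q * p', q * q', by rw [map_add, map_mul, map_mul]; positivity,
    by rw [map_mul]; positivity, ?_⟩
  rw [map_add, map_mul, map_mul, map_mul, div_add_div _ _ (am_ne hq) (am_ne hq')]

theorem Pos.inv {f : F} (hf : Pos f) : Pos f⁻¹ := by
  obtain ⟨p, q, hp, hq, rfl⟩ := hf
  exact ⟨q, p, hq, hp, by rw [inv_div]⟩

theorem Pos.pow {f : F} (hf : Pos f) (n : ℕ) : Pos (f ^ n) := by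
  induction n with
  | zero => simpa using Pos.one
  | succ n ih => rw [pow_succ]; exact ih.mul hf

theorem Pos.zpow {f : F} (hf : Pos f) (n : ℤ) : Pos (f ^ n) := by
  cases n with
  | ofNat n => simpa using hf.pow n
  | negSucc n => rw [zpow_negSucc]; exact (hf.pow _).inv

theorem Pos.tv (v : ℤ × ℤ) : Pos (tv v) :=
  ⟨MvPolynomial.X (Sum.inl v), 1, by simp, by simp, by simp [OctahedronTSystem.tv]⟩

theorem Pos.cv (v : ℤ × ℤ) : Pos (cv v) :=
  ⟨MvPolynomial.X (Sum.inr v), 1, by simp, by simp, by simp [OctahedronTSystem.cv]⟩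

theorem Pos.embP (f : TropP) : Pos (embP f) := by
  unfold OctahedronTSystem.embP
  exact Finset.prod_induction _ Pos (fun _ _ => Pos.mul) Pos.one (fun v _ => (Pos.cv v).zpow _)

theorem Pos.mutate (s : Seed) (h : ∀ u, Pos (s.x u)) (v u : ℤ × ℤ) : Pos ((mutate s v).x u) := by
  unfold OctahedronTSystem.mutate
  dsimp only
  split_ifs
  · refine (h v).inv.mul (((Pos.embP _).mul ?_).add ((Pos.embP _).mul ?_)) <;>
    exact finprod_induction Pos Pos.one (fun _ _ => Pos.mul) (fun u => (h u).pow _)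
  · exact h u

theorem embP_zero : embP 0 = 1 := by simp [embP]

theorem embP_add (f g : TropP) : embP (f + g) = embP f * embP g := by
  have := Finsupp.prod_add_index' (f := f) (g := g) (h := fun v (n : ℤ) => cv v ^ n)
    (by simp) (fun a b c => zpow_add₀ (Pos.cv a).ne b c)
  exact this

theorem embP_single (v : ℤ × ℤ) : embP (Finsupp.single v 1) = cv v := by
  have := Finsupp.prod_single_index (a := v) (b := (1:ℤ)) (h := fun v (n : ℤ) => cv v ^ n)
    (by simp)
  rw [zpow_one] at this
  exact this

theorem embP_sum {α : Type} (t : Finset α) (f : α → ℤ × ℤ) :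
    embP (∑ a ∈ t, Finsupp.single (f a) (1:ℤ)) = ∏ a ∈ t, cv (f a) := by
  classical
  induction t using Finset.induction_on with
  | empty => simp [embP_zero]
  | insert a t ha ih => rw [Finset.sum_insert ha, Finset.prod_insert ha, embP_add, ih, embP_single]

theorem pI_apply (i j m : ℤ) (c : ℤ × ℤ) : pI i j m c = Ic c i j m := by
  unfold pI Ic
  rw [Finsupp.finset_sum_apply]
  have : ∀ a : ℤ, (Finsupp.single ((i + a, j) : ℤ × ℤ) (1 : ℤ)) c =
      if a = c.1 - i then (if c.2 = j then 1 else 0) else 0 := by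
    intro a
    rw [Finsupp.single_apply]
    obtain ⟨x, y⟩ := c
    simp only [Prod.mk.injEq]
    split_ifs <;> omega
  simp only [this]
  rw [Finset.sum_ite_eq']
  simp only [Finset.mem_Icc, abs_le]
  split_ifs <;> omega

theorem pJ_apply (i j m : ℤ) (c : ℤ × ℤ) : pJ i j m c = Jc c i j m := by
  unfold pJ Jc
  rw [Finsupp.finset_sum_apply]
  have : ∀ a : ℤ, (Finsupp.single ((i, j + a) : ℤ × ℤ) (1 : ℤ)) c =
      if a = c.2 - j then (if c.1 = i then 1 else 0) else 0 := by
    intro a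
    rw [Finsupp.single_apply]
    obtain ⟨x, y⟩ := c
    simp only [Prod.mk.injEq]
    split_ifs <;> omega
  simp only [this]
  rw [Finset.sum_ite_eq']
  simp only [Finset.mem_Icc, abs_le]
  split_ifs <;> omega

structure Inv (s : Seed) (k : ℤ × ℤ → ℤ) : Prop where
  par : ∀ p q, (p + q + k (p, q)) % 2 = 1
  hb : ∀ u w, s.b u w = B k u w
  hy : ∀ p q c, s.y (p, q) c = Y k c p q
  hx : ∀ u, Pos (s.x u)

theorem tropAdd_apply (f : TropP) (c : ℤ × ℤ) : tropAdd f 0 c = min (f c) 0 := by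
  simp [tropAdd]

theorem Inv.mut {s : Seed} {k : ℤ × ℤ → ℤ} (H : Inv s k) (i j m e : ℤ) (he : e = 1 ∨ e = -1) 
    (h1 : k (i - 1, j) = m) (h2 : k (i + 1, j) = m)
    (h3 : k (i, j - 1) = m) (h4 : k (i, j + 1) = m)
    (h5 : k (i, j) = m - e) :
    Inv (mutate s (i, j)) (Function.update k (i, j) (m + e)) where
  par p q := by
    have a := H.par p q
    rw [Function.update_apply]
    split_ifs with h
    · cases h; rw [h5] at a; omega
    · exact a
  hb u w := by
    rw [B_mut k H.par i j m e he h1 h2 h3 h4 h5]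
    simp only [mutate, H.hb]
  hy p q c := by
    rw [Y_mut k H.par c i j m e he h1 h2 h3 h4 h5]
    simp only [mutate, H.hb]
    split_ifs with h
    · simp [H.hy]
    · simp [H.hy, tropAdd_apply]
  hx u := Pos.mutate s H.hx _ u

theorem Inv.init : Inv initialSeed fund where
  par p q := by simp only [fund]; omega
  hb u w := by
    obtain ⟨a, b⟩ := u
    obtain ⟨c, d⟩ := w
    simp only [initialSeed, B, fund, Prod.mk.injEq]
    split_ifs <;> omega
  hy p q c := by
    have key : (Finsupp.single ((p, q) : ℤ × ℤ) (1 : ℤ)) c =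
        if c.1 = p ∧ c.2 = q then 1 else 0 := by
      rw [Finsupp.single_apply]
      obtain ⟨x, y⟩ := c
      simp only [Prod.mk.injEq]
      split_ifs <;> omega
    simp only [initialSeed]
    rw [key]
    by_cases hpar : (p + q) % 2 = 0
    · rw [Y_flat fund c p q 0 1 (by omega) (by simp only [fund]; omega) (by simp only [fund]; omega)
        (by simp only [fund]; omega) (by simp only [fund]; omega) (by simp only [fund]; omega)]
      simp only [Jc, Ic, abs_le]
      split_ifs <;> omega
    · rw [Y_flat fund c p q (-1) (-1) (by omega) (by simp only [fund]; omega)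
        (by simp only [fund]; omega)
        (by simp only [fund]; omega) (by simp only [fund]; omega) (by simp only [fund]; omega)]
      simp only [Jc, Ic, abs_le]
      split_ifs <;> omega
  hx u := Pos.tv u

theorem Inv.of_reachable {s : Seed} {k : ℤ × ℤ → ℤ} (h : Reachable s k) : Inv s k := by
  induction h with
  | init => exact Inv.init
  | up s h i j _ h1 h2 h3 h4 ih =>
    have := ih.mut i j (h (i,j) + 1) 1 (by simp) h1 h2 h3 h4 (by ring)
    rwa [show h (i,j) + 1 + 1 = h (i,j) + 2 by ring] at this
  | down s h i j _ h1 h2 h3 h4 ih =>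
    have := ih.mut i j (h (i,j) - 1) (-1) (by simp) h1 h2 h3 h4 (by ring)
    rwa [show h (i,j) - 1 + -1 = h (i,j) - 2 by ring] at this

/-- **Theorem 3.4** (octahedron recurrence with principal coefficients).  If a seed `s`
with height function `k` is reached from the initial seed by allowed mutations, and the
four neighbours of `(i,j)` have height `m` while `k(i,j) = m - 1`, then the upward
mutation at `(i,j)` produces a new cluster variable `T(i,j,m+1)` with
`T(i,j,m-1)·T(i,j,m+1) = J(i,j,m)·T(i-1,j,m)·T(i+1,j,m) + I(i,j,m)·T(i,j-1,m)·T(i,j+1,m)`,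
the coefficients `I`, `J` being interpreted in the ambient field via the monomial
embedding of the tropical semifield. -/
theorem octahedron_recurrence_with_principal_coefficients
    (s : Seed) (k : ℤ × ℤ → ℤ) (hreach : Reachable s k)
    (i j m : ℤ)
    (h1 : k (i - 1, j) = m) (h2 : k (i + 1, j) = m)
    (h3 : k (i, j - 1) = m) (h4 : k (i, j + 1) = m)
    (h5 : k (i, j) = m - 1) :
    s.x (i, j) * (mutate s (i, j)).x (i, j) =
      coefJ cv i j m * s.x (i - 1, j) * s.x (i + 1, j) +
      coefI cv i j m * s.x (i, j - 1) * s.x (i, j + 1) := by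
  have H := Inv.of_reachable hreach
  have hp : (i + j + m) % 2 = 0 := by have := H.par (i-1) j; rw [h1] at this; omega
  have hyv : ∀ c, s.y (i, j) c = Jc c i j m - Ic c i j m := fun c => by
    rw [H.hy, Y_flat k c i j m 1 hp h1 h2 h3 h4 h5, one_mul]
  have e1 : s.y (i, j) - tropAdd (s.y (i, j)) 0 = pJ i j m := by
    ext c
    rw [Finsupp.sub_apply, tropAdd_apply, hyv, pJ_apply]
    rcases JI c i j m with h | h | h <;> rw [h.1, h.2] <;> norm_num
  have e2 : - tropAdd (s.y (i, j)) 0 = pI i j m := by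
    ext c
    rw [Finsupp.neg_apply, tropAdd_apply, hyv, pI_apply]
    rcases JI c i j m with h | h | h <;> rw [h.1, h.2] <;> norm_num
  have hb := fun u => (H.hb u (i, j)).trans (B_flat k i j m 1 h1 h2 h3 h4 h5 u)
  have p1 : ∏ᶠ u' : ℤ × ℤ, s.x u' ^ (max (s.b u' (i, j)) 0).toNat
      = s.x (i - 1, j) * s.x (i + 1, j) := by
    rw [finprod_eq_prod_of_mulSupport_subset (s := {(i-1,j), (i+1,j)})]
    · rw [Finset.prod_pair (by simp; omega), hb, hb]
      simp
    · intro u hu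
      by_contra hcon
      apply hu
      simp at hcon
      simp only [hb u]
      rw [if_neg (by tauto)]
      split_ifs <;> simp
  have p2 : ∏ᶠ u' : ℤ × ℤ, s.x u' ^ (max (-s.b u' (i, j)) 0).toNat
      = s.x (i, j - 1) * s.x (i, j + 1) := by
    rw [finprod_eq_prod_of_mulSupport_subset (s := {(i,j-1), (i,j+1)})]
    · rw [Finset.prod_pair (by simp; omega), hb, hb]
      simp
    · intro u hu
      by_contra hcon
      apply hu
      simp at hcon
      simp only [hb u]
      split_ifs <;> first | (exfalso; tauto) | simp
  have q1 : embP (pJ i j m) = coefJ cv i j m := embP_sum _ _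
  have q2 : embP (pI i j m) = coefI cv i j m := embP_sum _ _
  simp only [mutate, if_true]
  rw [e1, e2, p1, p2, q1, q2, mul_inv_cancel_left₀ (H.hx _).ne]
  ring

end OctahedronTSystem
end
end

section
/- Perfect-matching solution for the infinite completion (Theorem thm:maininf): Let p = (i₀,j₀,k₀) with i₀+j₀+k₀ odd and k an admissible stepped surface with k₀ ≥ k(i₀,j₀) and k ≥ fund, and let k_p(i,j) = min(k(i,j), k₀ − |i−i₀| − |j−j₀|). Then T(i₀,j₀,k₀) = Σ_{M∞} w_p(M∞)·w_f(M∞), where the sum runs over all acceptable perfect matchings M∞ of the infinite graph G_∞ = G_{k_p}, i.e. perfect matchings of G_∞ such that M∞ \ E(G) equals the set of all diagonal edges of G_∞ not in G = G_{p,k}; here w_f and w_p are extended to G_∞ by the same formulas (faces outside F̊ ∪ ∂F and diagonal edges outside G contribute trivially). -/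
noncomputable section
open Classical

namespace OctahedronTSystem

/-- Edges of the bipartite graph `G_k` (the planar dual of the quiver `Q_k`), indexed by
the arrow of `Q_k` they cross:
* `h i j` : the horizontal edge dual to the vertical lattice edge from `(i,j)` to `(i,j+1)`
  (the face `(i,j)` lies directly below it, the face `(i,j+1)` directly above it);
* `v i j` : the vertical edge dual to the horizontal lattice edge from `(i,j)` to `(i+1,j)`;
* `d i j` : the diagonal edge inside the unit square with lower-left corner `(i,j)`
  (present exactly when that square carries a diagonal arrow). -/
inductive Edge : Type
  | h : ℤ → ℤ → Edge
  | v : ℤ → ℤ → Edge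
  | d : ℤ → ℤ → Edge
  deriving DecidableEq

/-- A vertex of `G_k`: a (square or triangular) face of the quiver `Q_k`, recorded as the
unit square (lower-left corner) containing it together with a Boolean: `false` for the
part containing the bottom side of the square, `true` for the part containing the top
side (used only when the square is split by a diagonal). -/
abbrev Vtx : Type := (ℤ × ℤ) × Bool

namespace Edge

/-- The part of the square `s` touching its west side. -/
def tAD (k : ℤ × ℤ → ℤ) (s : ℤ × ℤ) : Bool := decide (k (s.1 + 1, s.2) ≠ k (s.1, s.2 + 1))

/-- The part of the square `s` touching its east side. -/
def tBC (k : ℤ × ℤ → ℤ) (s : ℤ × ℤ) : Bool := decide (k s ≠ k (s.1 + 1, s.2 + 1))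

/-- Endpoints of an edge: `(left, right)` for horizontal and diagonal edges,
`(bottom, top)` for vertical ones. -/
def ends (k : ℤ × ℤ → ℤ) : Edge → Vtx × Vtx
  | h i j => (((i - 1, j), tBC k (i - 1, j)), ((i, j), tAD k (i, j)))
  | v i j => (((i, j - 1), tAD k (i, j - 1) || tBC k (i, j - 1)), ((i, j), false))
  | d i j => (((i, j), tAD k (i, j)), ((i, j), tBC k (i, j)))

/-- `x` is an endpoint of the edge `e`. -/
def mem (k : ℤ × ℤ → ℤ) (x : Vtx) (e : Edge) : Prop :=
  x = (ends k e).1 ∨ x = (ends k e).2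

/-- The edge is present in the graph `G_k` (diagonal edges exist only in squares split
by a diagonal arrow of the quiver). -/
def valid (k : ℤ × ℤ → ℤ) : Edge → Prop
  | h _ _ => True
  | v _ _ => True
  | d i j => k (i, j) ≠ k (i + 1, j + 1) ∨ k (i + 1, j) ≠ k (i, j + 1)

/-- The edge `e` is a side of the face `f` of `G_k` (faces are indexed by the quiver
vertices `(i,j) ∈ ℤ × ℤ`; an edge is a side of the two faces corresponding to the two
endpoints of the arrow it crosses). -/
def isSide (k : ℤ × ℤ → ℤ) (f : ℤ × ℤ) : Edge → Prop
  | h i j => f = (i, j) ∨ f = (i, j + 1)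
  | v i j => f = (i, j) ∨ f = (i + 1, j)
  | d i j => if tAD k (i, j) then f = (i, j) ∨ f = (i + 1, j + 1)
             else f = (i + 1, j) ∨ f = (i, j + 1)

def isHoriz : Edge → Prop
  | h _ _ => True
  | _ => False

def isVert : Edge → Prop
  | v _ _ => True
  | _ => False

def isDiag : Edge → Prop
  | d _ _ => True
  | _ => False

end Edge

/-- A vertex is white when the arrows around the corresponding face of `Q_k` run
counterclockwise and black when they run clockwise. -/
def isWhite (k : ℤ × ℤ → ℤ) (x : Vtx) : Bool :=
  decide (k (x.1.1 + 1, x.1.2) < k x.1) != x.2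

/-- Source of an oriented edge: horizontal and diagonal edges are oriented from left to
right, vertical edges from their black endpoint to their white endpoint. -/
def Edge.src (k : ℤ × ℤ → ℤ) (e : Edge) : Vtx :=
  match e with
  | Edge.v _ _ =>
      if isWhite k (Edge.ends k e).1 then (Edge.ends k e).2 else (Edge.ends k e).1
  | _ => (Edge.ends k e).1

/-- Target of an oriented edge. -/
def Edge.dst (k : ℤ × ℤ → ℤ) (e : Edge) : Vtx :=
  match e with
  | Edge.v _ _ =>
      if isWhite k (Edge.ends k e).1 then (Edge.ends k e).1 else (Edge.ends k e).2
  | _ => (Edge.ends k e).2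

/-- The set `F̊` of closed faces. -/
def innerF (i₀ j₀ k₀ : ℤ) (k : ℤ × ℤ → ℤ) : Set (ℤ × ℤ) :=
  {f | |f.1 - i₀| + |f.2 - j₀| < k₀ - k f}

/-- The set `∂F` of open faces. -/
def bdryF (i₀ j₀ k₀ : ℤ) (k : ℤ × ℤ → ℤ) : Set (ℤ × ℤ) :=
  if k₀ = k (i₀, j₀) then {(i₀, j₀)}
  else {f | f ∉ innerF i₀ j₀ k₀ k ∧ ∃ g ∈ innerF i₀ j₀ k₀ k, |f.1 - g.1| + |f.2 - g.2| = 1}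

/-- The set `F̊ ∪ ∂F` of all faces of the closure. -/
def allF (i₀ j₀ k₀ : ℤ) (k : ℤ × ℤ → ℤ) : Set (ℤ × ℤ) :=
  innerF i₀ j₀ k₀ k ∪ bdryF i₀ j₀ k₀ k

/-- The edge set of the graph with open faces `G = G_{p,k}`: the finite subgraph of `G_k`
generated by the faces in `F̊`. -/
def EG (i₀ j₀ k₀ : ℤ) (k : ℤ × ℤ → ℤ) : Set Edge :=
  {e | e.valid k ∧ ∃ f ∈ innerF i₀ j₀ k₀ k, e.isSide k f}

/-- The adjusted stepped surface `k_p(i,j) = min (k(i,j), k₀ - |i-i₀| - |j-j₀|)`. -/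
def kAdj (i₀ j₀ k₀ : ℤ) (k : ℤ × ℤ → ℤ) : ℤ × ℤ → ℤ :=
  fun f => min (k f) (k₀ - |f.1 - i₀| - |f.2 - j₀|)

/-- The edge set of the closure `Ḡ` of `G`: the finite subgraph of `G_{k_p}` generated by
the faces in `F̊ ∪ ∂F`. -/
def EGbar (i₀ j₀ k₀ : ℤ) (k : ℤ × ℤ → ℤ) : Set Edge :=
  {e | e.valid (kAdj i₀ j₀ k₀ k) ∧ ∃ f ∈ allF i₀ j₀ k₀ k, e.isSide (kAdj i₀ j₀ k₀ k) f}

/-- The vertex set of the graph with edge set `E`. -/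
def VG (k : ℤ × ℤ → ℤ) (E : Set Edge) : Set Vtx := {x | ∃ e ∈ E, Edge.mem k x e}

/-- A perfect matching of the graph with edge set `E`. -/
def IsPerfectMatching (k : ℤ × ℤ → ℤ) (E M : Set Edge) : Prop :=
  M ⊆ E ∧ ∀ x ∈ VG k E, ∃! e, e ∈ M ∧ Edge.mem k x e

/-- The edge set of the infinite graph `G_∞ = G_{k_p}`. -/
def Einf (i₀ j₀ k₀ : ℤ) (k : ℤ × ℤ → ℤ) : Set Edge := {e | e.valid (kAdj i₀ j₀ k₀ k)}

/-- Acceptable perfect matchings of `G_∞`: perfect matchings `M` of `G_∞` such that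
`M \ E(G)` is exactly the set of all diagonal edges of `E(G_∞) \ E(G)`. -/
def Acceptable (i₀ j₀ k₀ : ℤ) (k : ℤ × ℤ → ℤ) : Set (Set Edge) :=
  {M | IsPerfectMatching (kAdj i₀ j₀ k₀ k) (Einf i₀ j₀ k₀ k) M ∧
       M \ EG i₀ j₀ k₀ k = {e | e ∈ Einf i₀ j₀ k₀ k ∧ e ∉ EG i₀ j₀ k₀ k ∧ e.isDiag}}

/-- The set `Diag(E(Ḡ) \ E(G))` of diagonal edges of the closure not in `G`. -/
def diagExt (i₀ j₀ k₀ : ℤ) (k : ℤ × ℤ → ℤ) : Set Edge :=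
  {e | e ∈ EGbar i₀ j₀ k₀ k ∧ e ∉ EG i₀ j₀ k₀ k ∧ e.isDiag}

/-- `M̄set = { M ∪ Diag(E(Ḡ)\E(G)) : M a perfect matching of G }`. -/
def MbarSet (i₀ j₀ k₀ : ℤ) (k : ℤ × ℤ → ℤ) : Set (Set Edge) :=
  {N | ∃ M, IsPerfectMatching k (EG i₀ j₀ k₀ k) M ∧ N = M ∪ diagExt i₀ j₀ k₀ k}

/-- The set of all white-black horizontal edges (white endpoint on the left) and all
diagonal edges of the graph with edge set `E`; for `E = E(Ḡ)` this is `M̄₀`, for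
`E = E(G)` it is `M₀`. -/
def M0 (k : ℤ × ℤ → ℤ) (E : Set Edge) : Set Edge :=
  {e ∈ E | e.isDiag ∨ (e.isHoriz ∧ isWhite k (Edge.ends k e).1 = true)}

/-- `j ∈ NSet k M i` iff the white-black horizontal edge `N(i,j)` (with face `(i,j)`
directly below it) belongs to `M`. -/
def NSet (k : ℤ × ℤ → ℤ) (M : Set Edge) (i : ℤ) : Set ℤ :=
  {j | Edge.h i j ∈ M ∧ isWhite k (Edge.ends k (Edge.h i j)).1 = true}

/-- `j ∈ SSet k M i` iff the black-white horizontal edge `S(i,j)` (with face `(i,j)`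
directly above it) belongs to `M`. -/
def SSet (k : ℤ × ℤ → ℤ) (M : Set Edge) (i : ℤ) : Set ℤ :=
  {j | Edge.h i (j - 1) ∈ M ∧ isWhite k (Edge.ends k (Edge.h i (j - 1))).1 = false}

/-- A perfect pairing of the horizontal edges of a matching `M`: a set of allowed pairs
`(S(i,j₁), N(i,j₂))`, `j₁ ≤ j₂`, in the same column, using each `S`-edge and each
`N`-edge of `M` exactly once, and noncrossing (this characterises the pairing produced
by the bottom-to-top reading procedure). -/
def IsPerfectPairing (k : ℤ × ℤ → ℤ) (M : Set Edge)
    (P : Set ((ℤ × ℤ) × (ℤ × ℤ))) : Prop :=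
  (∀ q ∈ P, q.1.1 = q.2.1 ∧ q.1.2 ≤ q.2.2 ∧
      q.1.2 ∈ SSet k M q.1.1 ∧ q.2.2 ∈ NSet k M q.2.1) ∧
  (∀ i j : ℤ, j ∈ SSet k M i → ∃! q, q ∈ P ∧ q.1 = (i, j)) ∧
  (∀ i j : ℤ, j ∈ NSet k M i → ∃! q, q ∈ P ∧ q.2 = (i, j)) ∧
  (∀ q ∈ P, ∀ q' ∈ P, q.1.1 = q'.1.1 →
      ¬(q.1.2 < q'.1.2 ∧ q'.1.2 ≤ q.2.2 ∧ q.2.2 < q'.2.2))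

/-- The weight `∏_{a=j₁-k(i,j₁)-1}^{j₂+k(i,j₂)+1} c(i,a)` of an allowed pair
`((i,j₁),(i,j₂))`. -/
def pairWeight (k : ℤ × ℤ → ℤ) (q : (ℤ × ℤ) × (ℤ × ℤ)) : F :=
  ∏ a ∈ Finset.Icc (q.1.2 - k q.1 - 1) (q.2.2 + k q.2 + 1), cv (q.1.1, a)

/-- The pairing-weight: product of the weights of all allowed pairs of a perfect pairing. -/
def wp (k : ℤ × ℤ → ℤ) (P : Set ((ℤ × ℤ) × (ℤ × ℤ))) : F :=
  ∏ᶠ q ∈ P, pairWeight k q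

/-- The sides of the face `f` among the edges `E`. -/
def sides (k : ℤ × ℤ → ℤ) (E : Set Edge) (f : ℤ × ℤ) : Set Edge :=
  {e ∈ E | e.isSide k f}

/-- `⌈(b - a)/2⌉` where `a` (resp. `b`) is the number of sides of the face `f` lying in
(resp. not in) the matching `M`. -/
def faceExp (k : ℤ × ℤ → ℤ) (E M : Set Edge) (f : ℤ × ℤ) : ℤ :=
  ⌈((((sides k E f \ M).ncard : ℚ) - ((sides k E f ∩ M).ncard : ℚ)) / 2 : ℚ)⌉

/-- The face-weight of a matching of the graph with open faces `G`: closed faces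
contribute `t(f)^(⌈(b-a)/2⌉ - 1)` and open faces contribute `t(f)^⌈(b-a)/2⌉`. -/
def wfOpen (i₀ j₀ k₀ : ℤ) (k : ℤ × ℤ → ℤ) (E M : Set Edge) : F :=
  (∏ᶠ f ∈ innerF i₀ j₀ k₀ k, tv f ^ (faceExp k E M f - 1)) *
  (∏ᶠ f ∈ bdryF i₀ j₀ k₀ k, tv f ^ faceExp k E M f)

/-- The face-weight over a set `S` of faces, all of them closed. -/
def wfClosed (k : ℤ × ℤ → ℤ) (E M : Set Edge) (S : Set (ℤ × ℤ)) : F :=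
  ∏ᶠ f ∈ S, tv f ^ (faceExp k E M f - 1)

/-- The `c`-exponent function of an edge (an element of the abelian group of `ℤ`-valued
exponent functions on `ℤ × ℤ`):  a white-black horizontal edge `e = h i j` (face
`b = (i,j)` below it) carries `p̄_b = (∏_{α ≥ j + k(i,j) + 2} c(i,α))⁻¹`; a black-white
horizontal edge `e = h i j` (face `a = (i,j+1)` above it) carries
`p_a = ∏_{α ≥ (j+1) - k(i,j+1) - 1} c(i,α)`; other edges carry no `c`'s.  Colors are read
in the surface `kc`, heights in the surface `kt`. -/
def edgeCExp (kc kt : ℤ × ℤ → ℤ) : Edge → ℤ × ℤ → ℤ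
  | Edge.h i j => fun v =>
      if isWhite kc (Edge.ends kc (Edge.h i j)).1 then
        if v.1 = i ∧ j + kt (i, j) + 2 ≤ v.2 then -1 else 0
      else
        if v.1 = i ∧ j - kt (i, j + 1) ≤ v.2 then 1 else 0
  | _ => fun _ => 0

/-- The `t`-part of the edge-weight: `∏ t(f)⁻¹` over the faces `f ∈ S` incident to `e`. -/
def edgeTPart (k : ℤ × ℤ → ℤ) (S : Set (ℤ × ℤ)) (e : Edge) : F :=
  ∏ᶠ f ∈ {f ∈ S | e.isSide k f}, (tv f)⁻¹

/-- Evaluation of a (finitely supported) exponent function as a Laurent monomial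
in the `c(i,j)`. -/
def evalExp (g : ℤ × ℤ → ℤ) : F := ∏ᶠ v : ℤ × ℤ, cv v ^ g v

/-- Left-most vertices lying south-west of the center face `(i₀,j₀)`. -/
def VleftSW (i₀ j₀ : ℤ) (k : ℤ × ℤ → ℤ) (E : Set Edge) : Set Vtx :=
  {x | x ∈ VG k E ∧ x.1.1 < i₀ ∧ x.1.2 < j₀ ∧
       ¬∃ e ∈ E, (e.isHoriz ∨ e.isDiag) ∧ (Edge.ends k e).2 = x}

/-- Right-most vertices lying south-east of the center face `(i₀,j₀)`. -/
def VrightSE (i₀ j₀ : ℤ) (k : ℤ × ℤ → ℤ) (E : Set Edge) : Set Vtx :=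
  {x | x ∈ VG k E ∧ i₀ ≤ x.1.1 ∧ x.1.2 < j₀ ∧
       ¬∃ e ∈ E, (e.isHoriz ∨ e.isDiag) ∧ (Edge.ends k e).1 = x}

/-- Left-most vertices lying north-west of the center face `(i₀,j₀)`. -/
def VleftNW (i₀ j₀ : ℤ) (k : ℤ × ℤ → ℤ) (E : Set Edge) : Set Vtx :=
  {x | x ∈ VG k E ∧ x.1.1 < i₀ ∧ j₀ ≤ x.1.2 ∧
       ¬∃ e ∈ E, (e.isHoriz ∨ e.isDiag) ∧ (Edge.ends k e).2 = x}

/-- Right-most vertices lying north-east of the center face `(i₀,j₀)`. -/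
def VrightNE (i₀ j₀ : ℤ) (k : ℤ × ℤ → ℤ) (E : Set Edge) : Set Vtx :=
  {x | x ∈ VG k E ∧ i₀ ≤ x.1.1 ∧ j₀ ≤ x.1.2 ∧
       ¬∃ e ∈ E, (e.isHoriz ∨ e.isDiag) ∧ (Edge.ends k e).1 = x}

/-- `P` is the edge set of a family of vertex-disjoint directed paths in the oriented
graph with edge set `E` whose sources are exactly `Src` and whose sinks are exactly
`Snk`. -/
def IsPathFamily (k : ℤ × ℤ → ℤ) (E P : Set Edge) (Src Snk : Set Vtx) : Prop :=
  P ⊆ E ∧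
  (∀ x ∈ Src, ({e ∈ P | Edge.src k e = x}).ncard = 1 ∧ {e ∈ P | Edge.dst k e = x} = ∅) ∧
  (∀ x ∈ Snk, ({e ∈ P | Edge.dst k e = x}).ncard = 1 ∧ {e ∈ P | Edge.src k e = x} = ∅) ∧
  (∀ x : Vtx, x ∉ Src → x ∉ Snk →
      ({e ∈ P | Edge.src k e = x}).ncard = ({e ∈ P | Edge.dst k e = x}).ncard ∧
      ({e ∈ P | Edge.src k e = x}).ncard ≤ 1) ∧
  ∀ x : Vtx, ¬ Relation.TransGen (fun a b => ∃ e ∈ P, Edge.src k e = a ∧ Edge.dst k e = b) x x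

/-- Local constraint of a matching at the unit square `(i,j)`. -/
def Sq (h : ℤ × ℤ → ℤ) (x : Edge → ℤ) (i j : ℤ) : Prop :=
  (h (i, j) = h (i + 1, j + 1) → h (i + 1, j) = h (i, j + 1) →
    x (Edge.v i j) + x (Edge.v i (j + 1)) + x (Edge.h i j) + x (Edge.h (i + 1) j) = 1) ∧
  (h (i + 1, j) ≠ h (i, j + 1) →
    x (Edge.v i j) + x (Edge.h (i + 1) j) = x (Edge.v i (j + 1)) + x (Edge.h i j) ∧
    x (Edge.v i j) + x (Edge.h (i + 1) j) ≤ 1) ∧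
  (h (i, j) ≠ h (i + 1, j + 1) →
    x (Edge.v i j) + x (Edge.h i j) = x (Edge.v i (j + 1)) + x (Edge.h (i + 1) j) ∧
    x (Edge.v i j) + x (Edge.h i j) ≤ 1)

/-- Diagonal joining the lower-left and upper-right corners of the square. -/
def sp1 (h : ℤ × ℤ → ℤ) (i j : ℤ) : ℤ := if h (i + 1, j) = h (i, j + 1) then 0 else 1

/-- Diagonal joining the other two corners. -/
def sp2 (h : ℤ × ℤ → ℤ) (i j : ℤ) : ℤ := if h (i, j) = h (i + 1, j + 1) then 0 else 1

def md1 (h : ℤ × ℤ → ℤ) (x : Edge → ℤ) (i j : ℤ) : ℤ :=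
  if h (i + 1, j) = h (i, j + 1) then 0 else 1 - x (Edge.v i j) - x (Edge.h (i + 1) j)

def md2 (h : ℤ × ℤ → ℤ) (x : Edge → ℤ) (i j : ℤ) : ℤ :=
  if h (i, j) = h (i + 1, j + 1) then 0 else 1 - x (Edge.v i j) - x (Edge.h i j)

/-- The exponent of the face `(i,j)`. -/
def Ex (h : ℤ × ℤ → ℤ) (x : Edge → ℤ) (i j : ℤ) : ℤ :=
  1 + (sp1 h i j + sp1 h (i - 1) (j - 1) + sp2 h (i - 1) j + sp2 h i (j - 1)) / 2
  - (x (Edge.h i j) + x (Edge.h i (j - 1)) + x (Edge.v i j) + x (Edge.v (i - 1) j))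
  - (md1 h x i j + md1 h x (i - 1) (j - 1) + md2 h x (i - 1) j + md2 h x i (j - 1))

/-- Edge weights. -/
def cw (P : ℤ → ℤ → F) (h : ℤ × ℤ → ℤ) : Edge → F
  | Edge.h i j => if h (i, j) < h (i, j + 1) then P i (j + h (i, j) + 2)
      else (P i (j - h (i, j + 1)))⁻¹
  | _ => 1

def ind (X : Finset Edge) (e : Edge) : ℤ := if e ∈ X then 1 else 0

lemma ind_cases (X : Finset Edge) (e : Edge) : ind X e = 0 ∨ ind X e = 1 := by
  unfold ind; split_ifs <;> simp

/-- The weight of a configuration. -/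
def Wt (P : ℤ → ℤ → F) (Φ : Finset (ℤ × ℤ)) (t : ℤ × ℤ → F) (h : ℤ × ℤ → ℤ)
    (X : Finset Edge) : F :=
  (∏ g ∈ Φ, t g ^ Ex h (ind X) g.1 g.2) * ∏ e ∈ X, cw P h e

lemma self_ne_sub_one (a : ℤ) : ¬ a = a - 1 := by omega

def addb (a : Edge) (b : Bool) (X : Finset Edge) : Finset Edge := if b then insert a X else X

def bz (b : Bool) : ℤ := if b then 1 else 0

lemma ind_addb_self (a : Edge) (b : Bool) (X : Finset Edge) (ha : a ∉ X) :
    ind (addb a b X) a = bz b := by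
  cases b <;> simp [ind, addb, bz, ha]

lemma ind_addb_ne (a : Edge) (b : Bool) (X : Finset Edge) (e : Edge) (hne : e ≠ a) :
    ind (addb a b X) e = ind X e := by
  cases b <;> simp [ind, addb, hne]

lemma prod_addb (a : Edge) (b : Bool) (X : Finset Edge) (ha : a ∉ X) (w : Edge → F) :
    ∏ e ∈ addb a b X, w e = (if b then w a else 1) * ∏ e ∈ X, w e := by
  cases b <;> simp [addb, ha]

lemma sum_ins (a : Edge) (B : Finset Edge) (ha : a ∉ B) (f : Finset Edge → F) :
    ∑ X ∈ (insert a B).powerset, f X = ∑ X ∈ B.powerset, ∑ b : Bool, f (addb a b X) := by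
  rw [Finset.sum_powerset_insert ha]
  simp [addb, Finset.sum_add_distrib, add_comm]

/-- The configuration with the four edges around the face `(i,j)` set to given values. -/
def mk4 (i j : ℤ) (Y : Finset Edge) (n s e w : Bool) : Finset Edge :=
  addb (Edge.h i j) n (addb (Edge.h i (j - 1)) s (addb (Edge.v i j) e (addb (Edge.v (i - 1) j) w Y)))

lemma sum_mk4 (i j : ℤ) (B : Finset Edge) (hN : Edge.h i j ∈ B) (hS : Edge.h i (j - 1) ∈ B)
    (hE : Edge.v i j ∈ B) (hW : Edge.v (i - 1) j ∈ B) (f : Finset Edge → F) :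
    ∑ X ∈ B.powerset, f X =
      ∑ Y ∈ (B \ {Edge.h i j, Edge.h i (j - 1), Edge.v i j, Edge.v (i - 1) j}).powerset,
        ∑ w : Bool, ∑ e : Bool, ∑ s : Bool, ∑ n : Bool, f (mk4 i j Y n s e w) := by
  set B' := B \ {Edge.h i j, Edge.h i (j - 1), Edge.v i j, Edge.v (i - 1) j} with hB'
  have hB : B = insert (Edge.h i j) (insert (Edge.h i (j - 1))
      (insert (Edge.v i j) (insert (Edge.v (i - 1) j) B'))) := by
    ext x
    simp only [hB', Finset.mem_insert, Finset.mem_sdiff, Finset.mem_singleton]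
    grind
  rw [hB, sum_ins, sum_ins, sum_ins, sum_ins]
  · rfl
  all_goals simp [hB', self_ne_sub_one]

section four
variable (i j : ℤ) (Y : Finset Edge) (hN : Edge.h i j ∉ Y) (hS : Edge.h i (j - 1) ∉ Y)
    (hE : Edge.v i j ∉ Y) (hW : Edge.v (i - 1) j ∉ Y) (n s e w : Bool)

lemma mem_addb (a : Edge) (b : Bool) (X : Finset Edge) (x : Edge) :
    x ∈ addb a b X ↔ (b = true ∧ x = a) ∨ x ∈ X := by
  cases b <;> simp [addb]

lemma ind4_N (hN : Edge.h i j ∉ Y) : ind (mk4 i j Y n s e w) (Edge.h i j) = bz n := by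
  unfold mk4; rw [ind_addb_self]; simp [mem_addb, hN, self_ne_sub_one]

lemma ind4_S (hS : Edge.h i (j - 1) ∉ Y) :
    ind (mk4 i j Y n s e w) (Edge.h i (j - 1)) = bz s := by
  unfold mk4; rw [ind_addb_ne, ind_addb_self] <;> simp [mem_addb, hS]

lemma ind4_E (hE : Edge.v i j ∉ Y) : ind (mk4 i j Y n s e w) (Edge.v i j) = bz e := by
  unfold mk4; rw [ind_addb_ne, ind_addb_ne, ind_addb_self] <;> simp [mem_addb, hE, self_ne_sub_one]

lemma ind4_W (hW : Edge.v (i - 1) j ∉ Y) :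
    ind (mk4 i j Y n s e w) (Edge.v (i - 1) j) = bz w := by
  unfold mk4; rw [ind_addb_ne, ind_addb_ne, ind_addb_ne, ind_addb_self] <;> simp [hW]

lemma ind4_h (a b : ℤ) (h1 : ¬ (a = i ∧ b = j)) (h2 : ¬ (a = i ∧ b = j - 1)) :
    ind (mk4 i j Y n s e w) (Edge.h a b) = ind Y (Edge.h a b) := by
  unfold mk4; rw [ind_addb_ne, ind_addb_ne, ind_addb_ne, ind_addb_ne] <;> simp <;> grind

lemma ind4_v (a b : ℤ) (h1 : ¬ (a = i ∧ b = j)) (h2 : ¬ (a = i - 1 ∧ b = j)) :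
    ind (mk4 i j Y n s e w) (Edge.v a b) = ind Y (Edge.v a b) := by
  unfold mk4; rw [ind_addb_ne, ind_addb_ne, ind_addb_ne, ind_addb_ne] <;> simp <;> grind

lemma prod_mk4 (hN : Edge.h i j ∉ Y) (hS : Edge.h i (j - 1) ∉ Y)
    (hE : Edge.v i j ∉ Y) (hW : Edge.v (i - 1) j ∉ Y) (P : ℤ → ℤ → F) (h : ℤ × ℤ → ℤ) :
    ∏ x ∈ mk4 i j Y n s e w, cw P h x =
      (if n then cw P h (Edge.h i j) else 1) * (if s then cw P h (Edge.h i (j - 1)) else 1) *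
        ∏ x ∈ Y, cw P h x := by
  unfold mk4
  rw [prod_addb, prod_addb, prod_addb, prod_addb]
  · simp [cw, mul_assoc]
  all_goals simp [mem_addb, hN, hS, hE, hW, self_ne_sub_one]
end four

/-- `(i,j)` is a local minimum of `h` at height `m`, and `h'` is `h` raised by `2` there. -/
structure Loc (h h' : ℤ × ℤ → ℤ) (i j m : ℤ) : Prop where
  c : h (i, j) = m
  c' : h' (i, j) = m + 2
  n : h (i, j + 1) = m + 1
  s : h (i, j - 1) = m + 1
  e : h (i + 1, j) = m + 1
  w : h (i - 1, j) = m + 1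
  ne : h (i + 1, j + 1) = m ∨ h (i + 1, j + 1) = m + 2
  nw : h (i - 1, j + 1) = m ∨ h (i - 1, j + 1) = m + 2
  se : h (i + 1, j - 1) = m ∨ h (i + 1, j - 1) = m + 2
  sw : h (i - 1, j - 1) = m ∨ h (i - 1, j - 1) = m + 2
  nn : h (i, j + 1 + 1) = m ∨ h (i, j + 1 + 1) = m + 2
  ss : h (i, j - 1 - 1) = m ∨ h (i, j - 1 - 1) = m + 2
  ee : h (i + 1 + 1, j) = m ∨ h (i + 1 + 1, j) = m + 2
  ww : h (i - 1 - 1, j) = m ∨ h (i - 1 - 1, j) = m + 2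
  off : ∀ a b : ℤ, ¬ (a = i ∧ b = j) → h' (a, b) = h (a, b)

/-- `x` agrees with `y` away from the four edges around `(i,j)`. -/
structure Agr (x y : Edge → ℤ) (i j : ℤ) : Prop where
  hh : ∀ a b : ℤ, ¬ (a = i ∧ b = j) → ¬ (a = i ∧ b = j - 1) → x (Edge.h a b) = y (Edge.h a b)
  hv : ∀ a b : ℤ, ¬ (a = i ∧ b = j) → ¬ (a = i - 1 ∧ b = j) → x (Edge.v a b) = y (Edge.v a b)

def uNE (y : Edge → ℤ) (i j : ℤ) : ℤ := y (Edge.h (i + 1) j) + y (Edge.v i (j + 1))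
def uNW (y : Edge → ℤ) (i j : ℤ) : ℤ := y (Edge.h (i - 1) j) + y (Edge.v (i - 1) (j + 1))
def uSE (y : Edge → ℤ) (i j : ℤ) : ℤ := y (Edge.h (i + 1) (j - 1)) + y (Edge.v i (j - 1))
def uSW (y : Edge → ℤ) (i j : ℤ) : ℤ := y (Edge.h (i - 1) (j - 1)) + y (Edge.v (i - 1) (j - 1))

def rq (o m u : ℤ) : ℤ := if o = m then 1 - u else u
def mq (o m u : ℤ) : ℤ := if o = m then 0 else 1 - u

lemma ne2 (m : ℤ) : (m + 2 = m) = False := by simp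
lemma ne2' (m : ℤ) : (m = m + 2) = False := by simp

section
variable {h h' : ℤ × ℤ → ℤ} {i j m : ℤ} {x y : Edge → ℤ}

lemma sqNE (L : Loc h h' i j m) (A : Agr x y i j) (hx : ∀ e, 0 ≤ x e) (hy : ∀ e, 0 ≤ y e) :
    (Sq h x i j ↔ x (Edge.h i j) + x (Edge.v i j) = rq (h (i + 1, j + 1)) m (uNE y i j) ∧
      uNE y i j ≤ 1) ∧
    (Sq h' x i j ↔ x (Edge.h i j) + x (Edge.v i j) = 1 - rq (h (i + 1, j + 1)) m (uNE y i j) ∧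
      uNE y i j ≤ 1) := by
  have a1 := A.hh (i + 1) j (by omega) (by omega)
  have a2 := A.hv i (j + 1) (by omega) (by omega)
  have o1 := L.off (i + 1) (j + 1) (by omega)
  have o2 := L.off (i + 1) j (by omega)
  have o3 := L.off i (j + 1) (by omega)
  have := L.c; have := L.c'; have := L.n; have := L.e; have := L.ne
  have := hx (Edge.h i j); have := hx (Edge.v i j)
  have := hy (Edge.h (i + 1) j); have := hy (Edge.v i (j + 1))
  unfold Sq rq uNE
  rw [a1, a2, o1, o2, o3]
  constructor <;> constructor <;> intro H <;> split_ifs at * <;> omega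

lemma sqNW (L : Loc h h' i j m) (A : Agr x y i j) (hx : ∀ e, 0 ≤ x e) (hy : ∀ e, 0 ≤ y e) :
    (Sq h x (i - 1) j ↔ x (Edge.h i j) + x (Edge.v (i - 1) j) = rq (h (i - 1, j + 1)) m (uNW y i j) ∧
      uNW y i j ≤ 1) ∧
    (Sq h' x (i - 1) j ↔ x (Edge.h i j) + x (Edge.v (i - 1) j) =
        1 - rq (h (i - 1, j + 1)) m (uNW y i j) ∧ uNW y i j ≤ 1) := by
  have a1 := A.hh (i - 1) j (by omega) (by omega)
  have a2 := A.hv (i - 1) (j + 1) (by omega) (by omega)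
  have o1 := L.off (i - 1) (j + 1) (by omega)
  have o2 := L.off (i - 1) j (by omega)
  have o3 := L.off i (j + 1) (by omega)
  have := L.c; have := L.c'; have := L.n; have := L.w; have := L.nw
  have := hx (Edge.h i j); have := hx (Edge.v (i - 1) j)
  have := hy (Edge.h (i - 1) j); have := hy (Edge.v (i - 1) (j + 1))
  unfold Sq rq uNW
  simp only [sub_add_cancel]
  rw [a1, a2, o1, o2, o3]
  constructor <;> constructor <;> intro H <;> split_ifs at * <;> omega

lemma sqSE (L : Loc h h' i j m) (A : Agr x y i j) (hx : ∀ e, 0 ≤ x e) (hy : ∀ e, 0 ≤ y e) :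
    (Sq h x i (j - 1) ↔ x (Edge.h i (j - 1)) + x (Edge.v i j) =
      rq (h (i + 1, j - 1)) m (uSE y i j) ∧ uSE y i j ≤ 1) ∧
    (Sq h' x i (j - 1) ↔ x (Edge.h i (j - 1)) + x (Edge.v i j) =
        1 - rq (h (i + 1, j - 1)) m (uSE y i j) ∧ uSE y i j ≤ 1) := by
  have a1 := A.hh (i + 1) (j - 1) (by omega) (by omega)
  have a2 := A.hv i (j - 1) (by omega) (by omega)
  have o1 := L.off (i + 1) (j - 1) (by omega)
  have o2 := L.off (i + 1) j (by omega)
  have o3 := L.off i (j - 1) (by omega)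
  have := L.c; have := L.c'; have := L.s; have := L.e; have := L.se
  have := hx (Edge.h i (j - 1)); have := hx (Edge.v i j)
  have := hy (Edge.h (i + 1) (j - 1)); have := hy (Edge.v i (j - 1))
  unfold Sq rq uSE
  simp only [sub_add_cancel]
  rw [a1, a2, o1, o2, o3]
  constructor <;> constructor <;> intro H <;> split_ifs at * <;> omega

lemma sqSW (L : Loc h h' i j m) (A : Agr x y i j) (hx : ∀ e, 0 ≤ x e) (hy : ∀ e, 0 ≤ y e) :
    (Sq h x (i - 1) (j - 1) ↔ x (Edge.h i (j - 1)) + x (Edge.v (i - 1) j) =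
      rq (h (i - 1, j - 1)) m (uSW y i j) ∧ uSW y i j ≤ 1) ∧
    (Sq h' x (i - 1) (j - 1) ↔ x (Edge.h i (j - 1)) + x (Edge.v (i - 1) j) =
        1 - rq (h (i - 1, j - 1)) m (uSW y i j) ∧ uSW y i j ≤ 1) := by
  have a1 := A.hh (i - 1) (j - 1) (by omega) (by omega)
  have a2 := A.hv (i - 1) (j - 1) (by omega) (by omega)
  have o1 := L.off (i - 1) (j - 1) (by omega)
  have o2 := L.off (i - 1) j (by omega)
  have o3 := L.off i (j - 1) (by omega)
  have := L.c; have := L.c'; have := L.s; have := L.w; have := L.sw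
  have := hx (Edge.h i (j - 1)); have := hx (Edge.v (i - 1) j)
  have := hy (Edge.h (i - 1) (j - 1)); have := hy (Edge.v (i - 1) (j - 1))
  unfold Sq rq uSW
  simp only [sub_add_cancel]
  rw [a1, a2, o1, o2, o3]
  constructor <;> constructor <;> intro H <;> split_ifs at * <;> omega

lemma sqOut (L : Loc h h' i j m) (A : Agr x y i j) (a b : ℤ)
    (hab : ¬ ((a = i ∨ a = i - 1) ∧ (b = j ∨ b = j - 1))) :
    (Sq h x a b ↔ Sq h y a b) ∧ (Sq h' x a b ↔ Sq h y a b) := by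
  have a1 := A.hh a b (by omega) (by omega)
  have a2 := A.hh (a + 1) b (by omega) (by omega)
  have a3 := A.hv a b (by omega) (by omega)
  have a4 := A.hv a (b + 1) (by omega) (by omega)
  have o1 := L.off a b (by omega)
  have o2 := L.off (a + 1) b (by omega)
  have o3 := L.off a (b + 1) (by omega)
  have o4 := L.off (a + 1) (b + 1) (by omega)
  unfold Sq
  rw [a1, a2, a3, a4, o1, o2, o3, o4]
  simp

lemma exC (L : Loc h h' i j m) :
    Ex h x i j = 1 - (x (Edge.h i j) + x (Edge.h i (j - 1)) + x (Edge.v i j) + x (Edge.v (i - 1) j)) ∧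
    Ex h' x i j = 1 - (x (Edge.h i j) + x (Edge.h i (j - 1)) + x (Edge.v i j) + x (Edge.v (i - 1) j)) := by
  have o1 := L.off (i + 1) j (by omega)
  have o2 := L.off (i - 1) j (by omega)
  have o3 := L.off i (j + 1) (by omega)
  have o4 := L.off i (j - 1) (by omega)
  have := L.n; have := L.s; have := L.e; have := L.w
  unfold Ex sp1 sp2 md1 md2
  simp only [sub_add_cancel, o1, o2, o3, o4, L.n, L.s, L.e, L.w, if_true]
  omega

def bN (h : ℤ × ℤ → ℤ) (y : Edge → ℤ) (i j : ℤ) : ℤ :=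
  1 + (sp1 h i (j + 1) + sp1 h (i - 1) j + sp2 h (i - 1) (j + 1) + sp2 h i j) / 2
  - (y (Edge.h i (j + 1)) + y (Edge.v i (j + 1)) + y (Edge.v (i - 1) (j + 1)))
  - (md1 h y i (j + 1) + md2 h y (i - 1) (j + 1))
  - mq (h (i + 1, j + 1)) (h (i, j)) (uNE y i j) - mq (h (i - 1, j + 1)) (h (i, j)) (uNW y i j)

lemma exN (L : Loc h h' i j m) (A : Agr x y i j) :
    (x (Edge.h i j) + x (Edge.v i j) = rq (h (i + 1, j + 1)) m (uNE y i j) →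
     x (Edge.h i j) + x (Edge.v (i - 1) j) = rq (h (i - 1, j + 1)) m (uNW y i j) →
      Ex h x i (j + 1) = bN h y i j - x (Edge.h i j)) ∧
    (x (Edge.h i j) + x (Edge.v i j) = 1 - rq (h (i + 1, j + 1)) m (uNE y i j) →
     x (Edge.h i j) + x (Edge.v (i - 1) j) = 1 - rq (h (i - 1, j + 1)) m (uNW y i j) →
      Ex h' x i (j + 1) = bN h y i j - (rq (h (i + 1, j + 1)) m (uNE y i j) +
        rq (h (i - 1, j + 1)) m (uNW y i j) - 1) - x (Edge.h i j)) := by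
  have a1 := A.hh (i - 1) j (by omega) (by omega)
  have a2 := A.hh (i - 1) (j + 1) (by omega) (by omega)
  have a3 := A.hh i (j + 1) (by omega) (by omega)
  have a4 := A.hh (i + 1) j (by omega) (by omega)
  have a5 := A.hh (i + 1) (j + 1) (by omega) (by omega)
  have a6 := A.hv (i - 1) (j + 1) (by omega) (by omega)
  have a7 := A.hv (i - 1) (j + 1 + 1) (by omega) (by omega)
  have a8 := A.hv i (j + 1) (by omega) (by omega)
  have a9 := A.hv i (j + 1 + 1) (by omega) (by omega)
  have o1 := L.off (i + 1) (j + 1) (by omega)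
  have o2 := L.off (i - 1) (j + 1) (by omega)
  have o3 := L.off i (j + 1 + 1) (by omega)
  unfold Ex bN sp1 sp2 md1 md2 mq rq uNE uNW
  simp only [sub_add_cancel, add_sub_cancel_right, a1, a2, a3, a4, a5, a6, a7, a8, a9, o1, o2, o3, L.c, L.c']
  rcases L.ne with p1 | p1 <;> rcases L.nw with p2 | p2 <;>
    rcases L.nn with p3 | p3 <;>
    simp only [p1, p2, p3, ne2, ne2', if_true, if_false] <;>
    constructor <;> intro H1 H2 <;> omega

def bS (h : ℤ × ℤ → ℤ) (y : Edge → ℤ) (i j : ℤ) : ℤ :=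
  1 + (sp1 h i (j - 1) + sp1 h (i - 1) (j - 1 - 1) + sp2 h (i - 1) (j - 1) + sp2 h i (j - 1 - 1)) / 2
  - (y (Edge.h i (j - 1 - 1)) + y (Edge.v i (j - 1)) + y (Edge.v (i - 1) (j - 1)))
  - (md1 h y (i - 1) (j - 1 - 1) + md2 h y i (j - 1 - 1))
  - mq (h (i + 1, j - 1)) (h (i, j)) (uSE y i j) - mq (h (i - 1, j - 1)) (h (i, j)) (uSW y i j)

lemma exS (L : Loc h h' i j m) (A : Agr x y i j) :
    (x (Edge.h i (j - 1)) + x (Edge.v i j) = rq (h (i + 1, j - 1)) m (uSE y i j) →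
     x (Edge.h i (j - 1)) + x (Edge.v (i - 1) j) = rq (h (i - 1, j - 1)) m (uSW y i j) →
      Ex h x i (j - 1) = bS h y i j - x (Edge.h i (j - 1))) ∧
    (x (Edge.h i (j - 1)) + x (Edge.v i j) = 1 - rq (h (i + 1, j - 1)) m (uSE y i j) →
     x (Edge.h i (j - 1)) + x (Edge.v (i - 1) j) = 1 - rq (h (i - 1, j - 1)) m (uSW y i j) →
      Ex h' x i (j - 1) = bS h y i j - (rq (h (i + 1, j - 1)) m (uSE y i j) +
        rq (h (i - 1, j - 1)) m (uSW y i j) - 1) - x (Edge.h i (j - 1))) := by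
  have a1 := A.hh (i - 1) (j - 1 - 1) (by omega) (by omega)
  have a2 := A.hh (i - 1) (j - 1) (by omega) (by omega)
  have a3 := A.hh i (j - 1 - 1) (by omega) (by omega)
  have a4 := A.hh (i + 1) (j - 1 - 1) (by omega) (by omega)
  have a5 := A.hh (i + 1) (j - 1) (by omega) (by omega)
  have a6 := A.hv (i - 1) (j - 1 - 1) (by omega) (by omega)
  have a7 := A.hv (i - 1) (j - 1) (by omega) (by omega)
  have a8 := A.hv i (j - 1 - 1) (by omega) (by omega)
  have a9 := A.hv i (j - 1) (by omega) (by omega)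
  have o1 := L.off (i + 1) (j - 1) (by omega)
  have o2 := L.off (i - 1) (j - 1) (by omega)
  have o3 := L.off i (j - 1 - 1) (by omega)
  unfold Ex bS sp1 sp2 md1 md2 mq rq uSE uSW
  simp only [sub_add_cancel, add_sub_cancel_right, a1, a2, a3, a4, a5, a6, a7, a8, a9, o1, o2, o3, L.c, L.c']
  rcases L.se with p1 | p1 <;> rcases L.sw with p2 | p2 <;>
    rcases L.ss with p3 | p3 <;>
    simp only [p1, p2, p3, ne2, ne2', if_true, if_false] <;>
    constructor <;> intro H1 H2 <;> omega

def bE (h : ℤ × ℤ → ℤ) (y : Edge → ℤ) (i j : ℤ) : ℤ :=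
  1 + (sp1 h (i + 1) j + sp1 h i (j - 1) + sp2 h i j + sp2 h (i + 1) (j - 1)) / 2
  - (y (Edge.h (i + 1) j) + y (Edge.h (i + 1) (j - 1)) + y (Edge.v (i + 1) j))
  - (md1 h y (i + 1) j + md2 h y (i + 1) (j - 1))
  - mq (h (i + 1, j + 1)) (h (i, j)) (uNE y i j) - mq (h (i + 1, j - 1)) (h (i, j)) (uSE y i j)

lemma exE (L : Loc h h' i j m) (A : Agr x y i j) :
    (x (Edge.v i j) + x (Edge.h i j) = rq (h (i + 1, j + 1)) m (uNE y i j) →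
     x (Edge.v i j) + x (Edge.h i (j - 1)) = rq (h (i + 1, j - 1)) m (uSE y i j) →
      Ex h x (i + 1) j = bE h y i j - x (Edge.v i j)) ∧
    (x (Edge.v i j) + x (Edge.h i j) = 1 - rq (h (i + 1, j + 1)) m (uNE y i j) →
     x (Edge.v i j) + x (Edge.h i (j - 1)) = 1 - rq (h (i + 1, j - 1)) m (uSE y i j) →
      Ex h' x (i + 1) j = bE h y i j - (rq (h (i + 1, j + 1)) m (uNE y i j) +
        rq (h (i + 1, j - 1)) m (uSE y i j) - 1) - x (Edge.v i j)) := by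
  have a1 := A.hh (i + 1) (j - 1) (by omega) (by omega)
  have a2 := A.hh (i + 1) j (by omega) (by omega)
  have a3 := A.hh (i + 1 + 1) (j - 1) (by omega) (by omega)
  have a4 := A.hh (i + 1 + 1) j (by omega) (by omega)
  have a5 := A.hv i (j - 1) (by omega) (by omega)
  have a6 := A.hv i (j + 1) (by omega) (by omega)
  have a7 := A.hv (i + 1) (j - 1) (by omega) (by omega)
  have a8 := A.hv (i + 1) j (by omega) (by omega)
  have a9 := A.hv (i + 1) (j + 1) (by omega) (by omega)
  have o1 := L.off (i + 1) (j + 1) (by omega)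
  have o2 := L.off (i + 1) (j - 1) (by omega)
  have o3 := L.off (i + 1 + 1) j (by omega)
  unfold Ex bE sp1 sp2 md1 md2 mq rq uNE uSE
  simp only [sub_add_cancel, add_sub_cancel_right, a1, a2, a3, a4, a5, a6, a7, a8, a9, o1, o2, o3, L.c, L.c']
  rcases L.ne with p1 | p1 <;> rcases L.se with p2 | p2 <;>
    rcases L.ee with p3 | p3 <;>
    simp only [p1, p2, p3, ne2, ne2', if_true, if_false] <;>
    constructor <;> intro H1 H2 <;> omega

def bW (h : ℤ × ℤ → ℤ) (y : Edge → ℤ) (i j : ℤ) : ℤ :=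
  1 + (sp1 h (i - 1) j + sp1 h (i - 1 - 1) (j - 1) + sp2 h (i - 1 - 1) j + sp2 h (i - 1) (j - 1)) / 2
  - (y (Edge.h (i - 1) j) + y (Edge.h (i - 1) (j - 1)) + y (Edge.v (i - 1 - 1) j))
  - (md1 h y (i - 1 - 1) (j - 1) + md2 h y (i - 1 - 1) j)
  - mq (h (i - 1, j + 1)) (h (i, j)) (uNW y i j) - mq (h (i - 1, j - 1)) (h (i, j)) (uSW y i j)

lemma exW (L : Loc h h' i j m) (A : Agr x y i j) :
    (x (Edge.v (i - 1) j) + x (Edge.h i j) = rq (h (i - 1, j + 1)) m (uNW y i j) →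
     x (Edge.v (i - 1) j) + x (Edge.h i (j - 1)) = rq (h (i - 1, j - 1)) m (uSW y i j) →
      Ex h x (i - 1) j = bW h y i j - x (Edge.v (i - 1) j)) ∧
    (x (Edge.v (i - 1) j) + x (Edge.h i j) = 1 - rq (h (i - 1, j + 1)) m (uNW y i j) →
     x (Edge.v (i - 1) j) + x (Edge.h i (j - 1)) = 1 - rq (h (i - 1, j - 1)) m (uSW y i j) →
      Ex h' x (i - 1) j = bW h y i j - (rq (h (i - 1, j + 1)) m (uNW y i j) +
        rq (h (i - 1, j - 1)) m (uSW y i j) - 1) - x (Edge.v (i - 1) j)) := by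
  have a1 := A.hh (i - 1 - 1) (j - 1) (by omega) (by omega)
  have a2 := A.hh (i - 1 - 1) j (by omega) (by omega)
  have a3 := A.hh (i - 1) (j - 1) (by omega) (by omega)
  have a4 := A.hh (i - 1) j (by omega) (by omega)
  have a5 := A.hv (i - 1 - 1) (j - 1) (by omega) (by omega)
  have a6 := A.hv (i - 1 - 1) j (by omega) (by omega)
  have a7 := A.hv (i - 1 - 1) (j + 1) (by omega) (by omega)
  have a8 := A.hv (i - 1) (j - 1) (by omega) (by omega)
  have a9 := A.hv (i - 1) (j + 1) (by omega) (by omega)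
  have o1 := L.off (i - 1) (j + 1) (by omega)
  have o2 := L.off (i - 1) (j - 1) (by omega)
  have o3 := L.off (i - 1 - 1) j (by omega)
  unfold Ex bW sp1 sp2 md1 md2 mq rq uNW uSW
  simp only [sub_add_cancel, add_sub_cancel_right, a1, a2, a3, a4, a5, a6, a7, a8, a9, o1, o2, o3, L.c, L.c']
  rcases L.nw with p1 | p1 <;> rcases L.sw with p2 | p2 <;>
    rcases L.ww with p3 | p3 <;>
    simp only [p1, p2, p3, ne2, ne2', if_true, if_false] <;>
    constructor <;> intro H1 H2 <;> omega

end

section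
variable {h h' : ℤ × ℤ → ℤ} {i j m : ℤ} {x y : Edge → ℤ}

lemma exOut (L : Loc h h' i j m) (A : Agr x y i j) (a b : ℤ)
    (h0 : ¬ (a = i ∧ b = j)) (h1 : ¬ (a = i ∧ b = j + 1)) (h2 : ¬ (a = i ∧ b = j - 1))
    (h3 : ¬ (a = i + 1 ∧ b = j)) (h4 : ¬ (a = i - 1 ∧ b = j)) :
    Ex h x a b = Ex h y a b ∧ Ex h' x a b = Ex h y a b := by
  have a1 := A.hh a b (by omega) (by omega)
  have a2 := A.hh a (b - 1) (by omega) (by omega)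
  have a3 := A.hv a b (by omega) (by omega)
  have a4 := A.hv (a - 1) b (by omega) (by omega)
  have o1 := L.off (a + 1) b (by omega)
  have o2 := L.off (a - 1) b (by omega)
  have o3 := L.off a (b + 1) (by omega)
  have o4 := L.off a (b - 1) (by omega)
  have m1 : md1 h x a b = md1 h y a b := by
    unfold md1
    by_cases q : a = i - 1 ∧ (b = j - 1)
    · obtain ⟨rfl, rfl⟩ := q
      simp [L.w, L.s]
    · rw [a3, A.hh (a + 1) b (by omega) (by omega)]
  have m2 : md1 h x (a - 1) (b - 1) = md1 h y (a - 1) (b - 1) := by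
    unfold md1
    by_cases q : a = i + 1 ∧ b = j + 1
    · obtain ⟨rfl, rfl⟩ := q
      simp [L.e, L.n]
    · rw [sub_add_cancel, sub_add_cancel, a2, A.hv (a - 1) (b - 1) (by omega) (by omega)]
  have m3 : md2 h x (a - 1) b = md2 h y (a - 1) b := by
    unfold md2
    by_cases q : a = i + 1 ∧ b = j - 1
    · obtain ⟨rfl, rfl⟩ := q
      simp [L.e, L.s]
    · rw [a4, A.hh (a - 1) b (by omega) (by omega)]
  have m4 : md2 h x a (b - 1) = md2 h y a (b - 1) := by
    unfold md2
    by_cases q : a = i - 1 ∧ b = j + 1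
    · obtain ⟨rfl, rfl⟩ := q
      simp [L.w, L.n]
    · rw [a2, A.hv a (b - 1) (by omega) (by omega)]
  have k1 : md1 h' x a b = md1 h x a b := by unfold md1; rw [o1, o3]
  have k2 : md1 h' x (a - 1) (b - 1) = md1 h x (a - 1) (b - 1) := by
    unfold md1; simp only [sub_add_cancel]; rw [o2, o4]
  have k3 : md2 h' x (a - 1) b = md2 h x (a - 1) b := by
    unfold md2; simp only [sub_add_cancel]; rw [o2, o3]
  have k4 : md2 h' x a (b - 1) = md2 h x a (b - 1) := by
    unfold md2; simp only [sub_add_cancel]; rw [o1, o4]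
  unfold Ex
  rw [k1, k2, k3, k4, m1, m2, m3, m4, a1, a2, a3, a4]
  unfold sp1 sp2
  simp only [sub_add_cancel, o1, o2, o3, o4, and_self]

end

/-- Compatibility of a configuration with a surface. -/
def Cmp (h : ℤ × ℤ → ℤ) (X : Finset Edge) : Prop := ∀ a b : ℤ, Sq h (ind X) a b

lemma agr4 (i j : ℤ) (Y : Finset Edge) (n s e w : Bool) :
    Agr (ind (mk4 i j Y n s e w)) (ind Y) i j :=
  ⟨fun a b h1 h2 => ind4_h i j Y n s e w a b h1 h2, fun a b h1 h2 => ind4_v i j Y n s e w a b h1 h2⟩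

lemma ind_nonneg (X : Finset Edge) (e : Edge) : 0 ≤ ind X e := by
  unfold ind; split_ifs <;> simp

lemma rq_cases (o m u : ℤ) (h0 : 0 ≤ u) (h1 : u ≤ 1) : rq o m u = 0 ∨ rq o m u = 1 := by
  unfold rq; split_ifs <;> omega

/-- The pure algebra of the local move (urban renewal). -/
lemma algebra_move (r1 r2 r3 r4 : ℤ) (h1 : r1 = 0 ∨ r1 = 1) (h2 : r2 = 0 ∨ r2 = 1)
    (h3 : r3 = 0 ∨ r3 = 1) (h4 : r4 = 0 ∨ r4 = 1) (β1 β2 β3 β4 : ℤ)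
    (f f' tn ts te tw p q : F) (hf : f ≠ 0) (hf' : f' ≠ 0) (hn : tn ≠ 0) (hs : ts ≠ 0)
    (he : te ≠ 0) (hw : tw ≠ 0) (hrec : f * f' = p * q * tw * te + ts * tn) :
    (∑ w : Bool, ∑ e : Bool, ∑ s : Bool, ∑ n : Bool,
      if bz n + bz e = r1 ∧ bz n + bz w = r2 ∧ bz s + bz e = r3 ∧ bz s + bz w = r4 then
        f ^ (1 - (bz n + bz s + bz e + bz w)) * tn ^ (β1 - bz n) * ts ^ (β2 - bz s) *
          te ^ (β3 - bz e) * tw ^ (β4 - bz w) * ((if n then p else 1) * (if s then q else 1))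
      else 0) =
    (∑ w : Bool, ∑ e : Bool, ∑ s : Bool, ∑ n : Bool,
      if bz n + bz e = 1 - r1 ∧ bz n + bz w = 1 - r2 ∧ bz s + bz e = 1 - r3 ∧
          bz s + bz w = 1 - r4 then
        f' ^ (1 - (bz n + bz s + bz e + bz w)) * tn ^ (β1 - (r1 + r2 - 1) - bz n) *
          ts ^ (β2 - (r3 + r4 - 1) - bz s) *
          te ^ (β3 - (r1 + r3 - 1) - bz e) * tw ^ (β4 - (r2 + r4 - 1) - bz w) *
          ((if n then q else 1) * (if s then p else 1))
      else 0) := by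
  rcases h1 with rfl | rfl <;> rcases h2 with rfl | rfl <;> rcases h3 with rfl | rfl <;>
    rcases h4 with rfl | rfl <;> simp [bz, Fintype.sum_bool]
  · simp only [zpow_add₀ hn, zpow_add₀ hs, zpow_add₀ he, zpow_add₀ hw, zpow_one, zpow_neg,
      zpow_sub_one₀ hn, zpow_sub_one₀ hs, zpow_sub_one₀ he, zpow_sub_one₀ hw]
    field_simp
    linear_combination hrec
  · simp only [zpow_sub_one₀ hn, zpow_sub_one₀ hs, zpow_sub_one₀ he, zpow_sub_one₀ hw]
    field_simp
    linear_combination -hrec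

lemma cmp_iff {h h' : ℤ × ℤ → ℤ} {i j m : ℤ} (L : Loc h h' i j m) (Y : Finset Edge)
    (hN : Edge.h i j ∉ Y) (hS : Edge.h i (j - 1) ∉ Y)
    (hE : Edge.v i j ∉ Y) (hW : Edge.v (i - 1) j ∉ Y) (n s e w : Bool) :
    (Cmp h (mk4 i j Y n s e w) ↔
      ((∀ a b : ℤ, ¬ ((a = i ∨ a = i - 1) ∧ (b = j ∨ b = j - 1)) → Sq h (ind Y) a b) ∧
        uNE (ind Y) i j ≤ 1 ∧ uNW (ind Y) i j ≤ 1 ∧ uSE (ind Y) i j ≤ 1 ∧ uSW (ind Y) i j ≤ 1) ∧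
      (bz n + bz e = rq (h (i + 1, j + 1)) m (uNE (ind Y) i j) ∧
       bz n + bz w = rq (h (i - 1, j + 1)) m (uNW (ind Y) i j) ∧
       bz s + bz e = rq (h (i + 1, j - 1)) m (uSE (ind Y) i j) ∧
       bz s + bz w = rq (h (i - 1, j - 1)) m (uSW (ind Y) i j))) ∧
    (Cmp h' (mk4 i j Y n s e w) ↔
      ((∀ a b : ℤ, ¬ ((a = i ∨ a = i - 1) ∧ (b = j ∨ b = j - 1)) → Sq h (ind Y) a b) ∧
        uNE (ind Y) i j ≤ 1 ∧ uNW (ind Y) i j ≤ 1 ∧ uSE (ind Y) i j ≤ 1 ∧ uSW (ind Y) i j ≤ 1) ∧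
      (bz n + bz e = 1 - rq (h (i + 1, j + 1)) m (uNE (ind Y) i j) ∧
       bz n + bz w = 1 - rq (h (i - 1, j + 1)) m (uNW (ind Y) i j) ∧
       bz s + bz e = 1 - rq (h (i + 1, j - 1)) m (uSE (ind Y) i j) ∧
       bz s + bz w = 1 - rq (h (i - 1, j - 1)) m (uSW (ind Y) i j))) := by
  have A := agr4 i j Y n s e w
  have q1 := sqNE L A (ind_nonneg _) (ind_nonneg _)
  have q2 := sqNW L A (ind_nonneg _) (ind_nonneg _)
  have q3 := sqSE L A (ind_nonneg _) (ind_nonneg _)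
  have q4 := sqSW L A (ind_nonneg _) (ind_nonneg _)
  simp only [ind4_N i j Y n s e w hN, ind4_S i j Y n s e w hS, ind4_E i j Y n s e w hE,
    ind4_W i j Y n s e w hW] at q1 q2 q3 q4
  constructor
  · constructor
    · intro H
      have r1 := q1.1.1 (H _ _); have r2 := q2.1.1 (H _ _)
      have r3 := q3.1.1 (H _ _); have r4 := q4.1.1 (H _ _)
      exact ⟨⟨fun a b hab => (sqOut L A a b hab).1.1 (H a b), r1.2, r2.2, r3.2, r4.2⟩,
        r1.1, r2.1, r3.1, r4.1⟩
    · rintro ⟨⟨H, u1, u2, u3, u4⟩, v1, v2, v3, v4⟩ a b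
      by_cases hab : ((a = i ∨ a = i - 1) ∧ (b = j ∨ b = j - 1))
      · rcases hab with ⟨rfl | rfl, rfl | rfl⟩
        · exact q1.1.2 ⟨v1, u1⟩
        · exact q3.1.2 ⟨v3, u3⟩
        · exact q2.1.2 ⟨v2, u2⟩
        · exact q4.1.2 ⟨v4, u4⟩
      · exact (sqOut L A a b hab).1.2 (H a b hab)
  · constructor
    · intro H
      have r1 := q1.2.1 (H _ _); have r2 := q2.2.1 (H _ _)
      have r3 := q3.2.1 (H _ _); have r4 := q4.2.1 (H _ _)
      exact ⟨⟨fun a b hab => (sqOut L A a b hab).2.1 (H a b), r1.2, r2.2, r3.2, r4.2⟩,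
        r1.1, r2.1, r3.1, r4.1⟩
    · rintro ⟨⟨H, u1, u2, u3, u4⟩, v1, v2, v3, v4⟩ a b
      by_cases hab : ((a = i ∨ a = i - 1) ∧ (b = j ∨ b = j - 1))
      · rcases hab with ⟨rfl | rfl, rfl | rfl⟩
        · exact q1.2.2 ⟨v1, u1⟩
        · exact q3.2.2 ⟨v3, u3⟩
        · exact q2.2.2 ⟨v2, u2⟩
        · exact q4.2.2 ⟨v4, u4⟩
      · exact (sqOut L A a b hab).2.2 (H a b hab)

lemma prod_five (i j : ℤ) (Φ : Finset (ℤ × ℤ)) (h0 : (i, j) ∈ Φ) (h1 : (i, j + 1) ∈ Φ)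
    (h2 : (i, j - 1) ∈ Φ) (h3 : (i + 1, j) ∈ Φ) (h4 : (i - 1, j) ∈ Φ) (w : ℤ × ℤ → F) :
    ∏ g ∈ Φ, w g = (∏ g ∈ Φ \ {(i, j), (i, j + 1), (i, j - 1), (i + 1, j), (i - 1, j)}, w g) *
      (w (i, j) * w (i, j + 1) * w (i, j - 1) * w (i + 1, j) * w (i - 1, j)) := by
  rw [← Finset.prod_sdiff (s₁ := {(i, j), (i, j + 1), (i, j - 1), (i + 1, j), (i - 1, j)}) (s₂ := Φ)]
  · congr 1
    rw [Finset.prod_insert, Finset.prod_insert, Finset.prod_insert, Finset.prod_insert,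
      Finset.prod_singleton]
    · ring
    all_goals simp <;> omega
  · intro g hg
    simp only [Finset.mem_insert, Finset.mem_singleton] at hg
    rcases hg with rfl | rfl | rfl | rfl | rfl <;> assumption

lemma move (P : ℤ → ℤ → F) (Φ : Finset (ℤ × ℤ)) (t t' : ℤ × ℤ → F) (h h' : ℤ × ℤ → ℤ)
    (i j m : ℤ) (L : Loc h h' i j m) (B : Finset Edge)
    (hN : Edge.h i j ∈ B) (hS : Edge.h i (j - 1) ∈ B)
    (hE : Edge.v i j ∈ B) (hW : Edge.v (i - 1) j ∈ B)
    (f0 : (i, j) ∈ Φ) (f1 : (i, j + 1) ∈ Φ)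
    (f2 : (i, j - 1) ∈ Φ) (f3 : (i + 1, j) ∈ Φ) (f4 : (i - 1, j) ∈ Φ)
    (ht : ∀ g, t g ≠ 0) (ht' : t' (i, j) ≠ 0) (htoff : ∀ g, g ≠ (i, j) → t' g = t g)
    (hrec : t (i, j) * t' (i, j) = P i (j + m + 2) * (P i (j - 1 - m))⁻¹ * t (i - 1, j) * t (i + 1, j)
      + t (i, j - 1) * t (i, j + 1)) :
    ∑ X ∈ B.powerset, (if Cmp h X then Wt P Φ t h X else 0) =
      ∑ X ∈ B.powerset, (if Cmp h' X then Wt P Φ t' h' X else 0) := by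
  rw [sum_mk4 i j B hN hS hE hW, sum_mk4 i j B hN hS hE hW]
  refine Finset.sum_congr rfl fun Y hY => ?_
  have hYB := Finset.mem_powerset.1 hY
  have yN : Edge.h i j ∉ Y := fun H => by simpa using hYB H
  have yS : Edge.h i (j - 1) ∉ Y := fun H => by simpa using hYB H
  have yE : Edge.v i j ∉ Y := fun H => by simpa using hYB H
  have yW : Edge.v (i - 1) j ∉ Y := fun H => by simpa using hYB H
  set y := ind Y with hy
  by_cases C0 : ((∀ a b : ℤ, ¬ ((a = i ∨ a = i - 1) ∧ (b = j ∨ b = j - 1)) → Sq h y a b) ∧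
        uNE y i j ≤ 1 ∧ uNW y i j ≤ 1 ∧ uSE y i j ≤ 1 ∧ uSW y i j ≤ 1)
  swap
  · have z1 : ∀ n s e w, ¬ Cmp h (mk4 i j Y n s e w) := fun n s e w H =>
      C0 ((cmp_iff L Y yN yS yE yW n s e w).1.1 H).1
    have z2 : ∀ n s e w, ¬ Cmp h' (mk4 i j Y n s e w) := fun n s e w H =>
      C0 ((cmp_iff L Y yN yS yE yW n s e w).2.1 H).1
    simp only [z1, z2, if_false]
  set r1 := rq (h (i + 1, j + 1)) m (uNE y i j) with hr1
  set r2 := rq (h (i - 1, j + 1)) m (uNW y i j) with hr2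
  set r3 := rq (h (i + 1, j - 1)) m (uSE y i j) with hr3
  set r4 := rq (h (i - 1, j - 1)) m (uSW y i j) with hr4
  have yy : ∀ e, 0 ≤ y e := ind_nonneg Y
  have c1 : r1 = 0 ∨ r1 = 1 := rq_cases _ _ _ (add_nonneg (yy _) (yy _)) C0.2.1
  have c2 : r2 = 0 ∨ r2 = 1 := rq_cases _ _ _ (add_nonneg (yy _) (yy _)) C0.2.2.1
  have c3 : r3 = 0 ∨ r3 = 1 := rq_cases _ _ _ (add_nonneg (yy _) (yy _)) C0.2.2.2.1
  have c4 : r4 = 0 ∨ r4 = 1 := rq_cases _ _ _ (add_nonneg (yy _) (yy _)) C0.2.2.2.2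
  have alg := algebra_move r1 r2 r3 r4 c1 c2 c3 c4 (bN h y i j) (bS h y i j) (bE h y i j)
    (bW h y i j) (t (i, j)) (t' (i, j)) (t (i, j + 1)) (t (i, j - 1)) (t (i + 1, j)) (t (i - 1, j))
    (P i (j + m + 2)) (P i (j - 1 - m))⁻¹ (ht _) ht' (ht _) (ht _) (ht _) (ht _) hrec
  set Φ' := Φ \ {(i, j), (i, j + 1), (i, j - 1), (i + 1, j), (i - 1, j)} with hΦ'
  have hout : ∀ g ∈ Φ', ¬ (g.1 = i ∧ g.2 = j) ∧ ¬ (g.1 = i ∧ g.2 = j + 1) ∧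
      ¬ (g.1 = i ∧ g.2 = j - 1) ∧ ¬ (g.1 = i + 1 ∧ g.2 = j) ∧ ¬ (g.1 = i - 1 ∧ g.2 = j) := by
    rintro ⟨a, b⟩ hg
    simpa [hΦ', not_or] using (Finset.mem_sdiff.1 hg).2
  set c0 := (∏ g ∈ Φ', t g ^ Ex h y g.1 g.2) * ∏ e ∈ Y, cw P h e with hc0
  have wN : cw P h (Edge.h i j) = P i (j + m + 2) := by
    simp [cw, L.c, L.n]
  have wS : cw P h (Edge.h i (j - 1)) = (P i (j - 1 - m))⁻¹ := by
    simp [cw, L.c, L.s]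
  have wN' : cw P h' (Edge.h i j) = (P i (j - 1 - m))⁻¹ := by
    simp [cw, L.c', L.off i (j + 1) (by omega), L.n]
    congr 1; ring
  have wS' : cw P h' (Edge.h i (j - 1)) = P i (j + m + 2) := by
    simp [cw, L.c', L.off i (j - 1) (by omega), L.s]
  have wY : ∏ e ∈ Y, cw P h' e = ∏ e ∈ Y, cw P h e := by
    refine Finset.prod_congr rfl fun e he => ?_
    rcases e with ⟨a, b⟩ | ⟨a, b⟩ | ⟨a, b⟩
    · have n1 : ¬ (a = i ∧ b = j) := by rintro ⟨rfl, rfl⟩; exact yN he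
      have n2 : ¬ (a = i ∧ b + 1 = j) := by
        rintro ⟨rfl, rfl⟩; apply yS; simpa using he
      simp only [cw, L.off a b n1, L.off a (b + 1) n2]
    · rfl
    · rfl
  have E1 : ∀ n s e w : Bool, (if Cmp h (mk4 i j Y n s e w) then Wt P Φ t h (mk4 i j Y n s e w) else 0)
      = c0 * (if bz n + bz e = r1 ∧ bz n + bz w = r2 ∧ bz s + bz e = r3 ∧ bz s + bz w = r4 then
        t (i, j) ^ (1 - (bz n + bz s + bz e + bz w)) * t (i, j + 1) ^ (bN h y i j - bz n) *
          t (i, j - 1) ^ (bS h y i j - bz s) *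
          t (i + 1, j) ^ (bE h y i j - bz e) * t (i - 1, j) ^ (bW h y i j - bz w) *
          ((if n then P i (j + m + 2) else 1) * (if s then (P i (j - 1 - m))⁻¹ else 1))
      else 0) := by
    intro n s e w
    have hc := (cmp_iff L Y yN yS yE yW n s e w).1
    rw [← hy, ← hr1, ← hr2, ← hr3, ← hr4] at hc
    by_cases hq : bz n + bz e = r1 ∧ bz n + bz w = r2 ∧ bz s + bz e = r3 ∧ bz s + bz w = r4
    · rw [if_pos (hc.2 ⟨C0, hq⟩), if_pos hq]
      have A := agr4 i j Y n s e w
      rw [← hy] at A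
      have xc := (exC (x := ind (mk4 i j Y n s e w)) L).1
      have xn := (exN L A).1
      have xs := (exS L A).1
      have xe := (exE L A).1
      have xw := (exW L A).1
      simp only [ind4_N i j Y n s e w yN, ind4_S i j Y n s e w yS, ind4_E i j Y n s e w yE,
        ind4_W i j Y n s e w yW, ← hr1, ← hr2, ← hr3, ← hr4] at xc xn xs xe xw
      obtain ⟨v1, v2, v3, v4⟩ := hq
      have xn := xn v1 v2
      have xs := xs v3 v4
      have xe := xe (by omega) (by omega)
      have xw := xw (by omega) (by omega)
      unfold Wt
      rw [prod_five i j Φ f0 f1 f2 f3 f4, prod_mk4 i j Y n s e w yN yS yE yW, wN, wS,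
        xc, xn, xs, xe, xw, hc0]
      have : ∏ g ∈ Φ', t g ^ Ex h (ind (mk4 i j Y n s e w)) g.1 g.2 =
          ∏ g ∈ Φ', t g ^ Ex h y g.1 g.2 := by
        refine Finset.prod_congr rfl fun g hg => ?_
        obtain ⟨g0, g1, g2, g3, g4⟩ := hout g hg
        rw [(exOut L A g.1 g.2 g0 g1 g2 g3 g4).1]
      rw [this]
      ring
    · rw [if_neg (fun H => hq (hc.1 H).2), if_neg hq, mul_zero]
  have E2 : ∀ n s e w : Bool,
      (if Cmp h' (mk4 i j Y n s e w) then Wt P Φ t' h' (mk4 i j Y n s e w) else 0)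
      = c0 * (if bz n + bz e = 1 - r1 ∧ bz n + bz w = 1 - r2 ∧ bz s + bz e = 1 - r3 ∧
          bz s + bz w = 1 - r4 then
        t' (i, j) ^ (1 - (bz n + bz s + bz e + bz w)) *
          t (i, j + 1) ^ (bN h y i j - (r1 + r2 - 1) - bz n) *
          t (i, j - 1) ^ (bS h y i j - (r3 + r4 - 1) - bz s) *
          t (i + 1, j) ^ (bE h y i j - (r1 + r3 - 1) - bz e) *
          t (i - 1, j) ^ (bW h y i j - (r2 + r4 - 1) - bz w) *
          ((if n then (P i (j - 1 - m))⁻¹ else 1) * (if s then P i (j + m + 2) else 1))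
      else 0) := by
    intro n s e w
    have hc := (cmp_iff L Y yN yS yE yW n s e w).2
    rw [← hy, ← hr1, ← hr2, ← hr3, ← hr4] at hc
    by_cases hq : bz n + bz e = 1 - r1 ∧ bz n + bz w = 1 - r2 ∧ bz s + bz e = 1 - r3 ∧
        bz s + bz w = 1 - r4
    · rw [if_pos (hc.2 ⟨C0, hq⟩), if_pos hq]
      have A := agr4 i j Y n s e w
      rw [← hy] at A
      have xc := (exC (x := ind (mk4 i j Y n s e w)) L).2
      have xn := (exN L A).2
      have xs := (exS L A).2
      have xe := (exE L A).2
      have xw := (exW L A).2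
      simp only [ind4_N i j Y n s e w yN, ind4_S i j Y n s e w yS, ind4_E i j Y n s e w yE,
        ind4_W i j Y n s e w yW, ← hr1, ← hr2, ← hr3, ← hr4] at xc xn xs xe xw
      obtain ⟨v1, v2, v3, v4⟩ := hq
      have xn := xn v1 v2
      have xs := xs v3 v4
      have xe := xe (by omega) (by omega)
      have xw := xw (by omega) (by omega)
      unfold Wt
      rw [prod_five i j Φ f0 f1 f2 f3 f4, prod_mk4 i j Y n s e w yN yS yE yW, wN', wS',
        xc, xn, xs, xe, xw, hc0, wY, htoff (i, j + 1) (by simp), htoff (i, j - 1) (by simp),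
        htoff (i + 1, j) (by simp), htoff (i - 1, j) (by simp)]
      have : ∏ g ∈ Φ', t' g ^ Ex h' (ind (mk4 i j Y n s e w)) g.1 g.2 =
          ∏ g ∈ Φ', t g ^ Ex h y g.1 g.2 := by
        refine Finset.prod_congr rfl fun g hg => ?_
        obtain ⟨g0, g1, g2, g3, g4⟩ := hout g hg
        rw [(exOut L A g.1 g.2 g0 g1 g2 g3 g4).2, htoff g (fun H => g0 (by simp [H]))]
      rw [this]
      ring
    · rw [if_neg (fun H => hq (hc.1 H).2), if_neg hq, mul_zero]
  simp only [E1, E2, ← Finset.mul_sum]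
  rw [alg]

/-- The pyramid surface. -/
def Kp (i₀ j₀ k₀ : ℤ) : ℤ × ℤ → ℤ := fun f => k₀ - |f.1 - i₀| - |f.2 - j₀|

/-- Distance of an edge from the center. -/
def phi (i₀ j₀ : ℤ) : Edge → ℤ
  | Edge.h i j => |2 * i - 2 * i₀| + |2 * j + 1 - 2 * j₀|
  | Edge.v i j => |2 * i + 1 - 2 * i₀| + |2 * j - 2 * j₀|
  | Edge.d _ _ => 0

lemma ind_mem {X : Finset Edge} {e : Edge} (h : e ∈ X) : ind X e = 1 := by simp [ind, h]

lemma mem_of_ind {X : Finset Edge} {e e' : Edge} (h : 1 ≤ ind X e + ind X e') :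
    e ∈ X ∨ e' ∈ X := by
  unfold ind at h
  by_contra hc
  push Not at hc
  simp [hc.1, hc.2] at h

lemma base_next {i₀ j₀ k₀ : ℤ} {X : Finset Edge} (hX : Cmp (Kp i₀ j₀ k₀) X)
    (hd : ∀ a b, Edge.d a b ∉ X) (e : Edge) (he : e ∈ X) :
    ∃ e' ∈ X, phi i₀ j₀ e < phi i₀ j₀ e' := by
  rcases e with ⟨a, b⟩ | ⟨a, b⟩ | ⟨a, b⟩
  · have hi := ind_mem he
    rcases le_total i₀ a with ha | ha <;> rcases le_or_gt j₀ b with hb | hb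
    · have H := (hX a b).2.2 (by simp only [Kp, abs_eq_max_neg]; omega)
      have := ind_nonneg X (Edge.v a b)
      rcases mem_of_ind (X := X) (e := Edge.v a (b + 1)) (e' := Edge.h (a + 1) b) (by omega) with q | q
      · exact ⟨_, q, by simp only [phi, abs_eq_max_neg]; omega⟩
      · exact ⟨_, q, by simp only [phi, abs_eq_max_neg]; omega⟩
    · have H := (hX a b).2.1 (by simp only [Kp, abs_eq_max_neg]; omega)
      have := ind_nonneg X (Edge.v a (b + 1))
      rcases mem_of_ind (X := X) (e := Edge.v a b) (e' := Edge.h (a + 1) b) (by omega) with q | q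
      · exact ⟨_, q, by simp only [phi, abs_eq_max_neg]; omega⟩
      · exact ⟨_, q, by simp only [phi, abs_eq_max_neg]; omega⟩
    · have H := (hX (a - 1) b).2.1 (by simp only [Kp, abs_eq_max_neg]; omega)
      simp only [sub_add_cancel] at H
      have := ind_nonneg X (Edge.v (a - 1) b)
      rcases mem_of_ind (X := X) (e := Edge.v (a - 1) (b + 1)) (e' := Edge.h (a - 1) b)
        (by omega) with q | q
      · exact ⟨_, q, by simp only [phi, abs_eq_max_neg]; omega⟩
      · exact ⟨_, q, by simp only [phi, abs_eq_max_neg]; omega⟩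
    · have H := (hX (a - 1) b).2.2 (by simp only [Kp, abs_eq_max_neg]; omega)
      simp only [sub_add_cancel] at H
      have := ind_nonneg X (Edge.v (a - 1) (b + 1))
      rcases mem_of_ind (X := X) (e := Edge.v (a - 1) b) (e' := Edge.h (a - 1) b)
        (by omega) with q | q
      · exact ⟨_, q, by simp only [phi, abs_eq_max_neg]; omega⟩
      · exact ⟨_, q, by simp only [phi, abs_eq_max_neg]; omega⟩
  · have hi := ind_mem he
    rcases le_or_gt i₀ a with ha | ha <;> rcases le_total j₀ b with hb | hb
    · have H := (hX a b).2.2 (by simp only [Kp, abs_eq_max_neg]; omega)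
      have := ind_nonneg X (Edge.h a b)
      rcases mem_of_ind (X := X) (e := Edge.v a (b + 1)) (e' := Edge.h (a + 1) b) (by omega) with q | q
      · exact ⟨_, q, by simp only [phi, abs_eq_max_neg]; omega⟩
      · exact ⟨_, q, by simp only [phi, abs_eq_max_neg]; omega⟩
    · have H := (hX a (b - 1)).2.1 (by simp only [Kp, abs_eq_max_neg]; omega)
      simp only [sub_add_cancel] at H
      have := ind_nonneg X (Edge.h a (b - 1))
      rcases mem_of_ind (X := X) (e := Edge.v a (b - 1)) (e' := Edge.h (a + 1) (b - 1))
        (by omega) with q | q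
      · exact ⟨_, q, by simp only [phi, abs_eq_max_neg]; omega⟩
      · exact ⟨_, q, by simp only [phi, abs_eq_max_neg]; omega⟩
    · have H := (hX a b).2.1 (by simp only [Kp, abs_eq_max_neg]; omega)
      have := ind_nonneg X (Edge.h (a + 1) b)
      rcases mem_of_ind (X := X) (e := Edge.v a (b + 1)) (e' := Edge.h a b) (by omega) with q | q
      · exact ⟨_, q, by simp only [phi, abs_eq_max_neg]; omega⟩
      · exact ⟨_, q, by simp only [phi, abs_eq_max_neg]; omega⟩
    · have H := (hX a (b - 1)).2.2 (by simp only [Kp, abs_eq_max_neg]; omega)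
      simp only [sub_add_cancel] at H
      have := ind_nonneg X (Edge.h (a + 1) (b - 1))
      rcases mem_of_ind (X := X) (e := Edge.v a (b - 1)) (e' := Edge.h a (b - 1))
        (by omega) with q | q
      · exact ⟨_, q, by simp only [phi, abs_eq_max_neg]; omega⟩
      · exact ⟨_, q, by simp only [phi, abs_eq_max_neg]; omega⟩
  · exact absurd he (hd a b)

lemma base_empty {i₀ j₀ k₀ : ℤ} {X : Finset Edge} (hX : Cmp (Kp i₀ j₀ k₀) X)
    (hd : ∀ a b, Edge.d a b ∉ X) : X = ∅ := by
  by_contra hne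
  obtain ⟨e, he, hmax⟩ := Finset.exists_max_image X (phi i₀ j₀) (Finset.nonempty_iff_ne_empty.2 hne)
  obtain ⟨e', he', hlt⟩ := base_next hX hd e he
  exact absurd (hmax e' he') (by omega)

lemma base_cmp (i₀ j₀ k₀ : ℤ) : Cmp (Kp i₀ j₀ k₀) ∅ := by
  intro a b
  have z : ∀ e, ind ∅ e = 0 := fun e => by simp [ind]
  unfold Sq
  simp only [z, Kp]
  refine ⟨fun h1 h2 => ?_, by simp, by simp⟩
  simp only [abs_eq_max_neg] at h1 h2
  omega

lemma base_ex {i₀ j₀ k₀ : ℤ} (h : ℤ × ℤ → ℤ) (x : Edge → ℤ) (a b : ℤ)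
    (h1 : h (a + 1, b) = Kp i₀ j₀ k₀ (a + 1, b)) (h2 : h (a - 1, b) = Kp i₀ j₀ k₀ (a - 1, b))
    (h3 : h (a, b + 1) = Kp i₀ j₀ k₀ (a, b + 1)) (h4 : h (a, b - 1) = Kp i₀ j₀ k₀ (a, b - 1))
    (hh : ∀ c d, |c - a| ≤ 1 → |d - b| ≤ 1 → x (Edge.h c d) = 0)
    (hv : ∀ c d, |c - a| ≤ 1 → |d - b| ≤ 1 → x (Edge.v c d) = 0) :
    Ex h x a b = if a = i₀ ∧ b = j₀ then 1 else 0 := by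
  have e1 := hh a b (by simp) (by simp)
  have e2 := hh a (b - 1) (by simp) (by simp)
  have e3 := hh (a + 1) b (by simp) (by simp)
  have e4 := hh (a - 1) b (by simp) (by simp)
  have e5 := hv a b (by simp) (by simp)
  have e6 := hv (a - 1) b (by simp) (by simp)
  have e7 := hv a (b - 1) (by simp) (by simp)
  have e8 := hv (a - 1) (b - 1) (by simp) (by simp)
  obtain ⟨κ, hκ⟩ : ∃ κ, κ = Kp i₀ j₀ k₀ (a, b) := ⟨_, rfl⟩
  simp only [Kp, abs_eq_max_neg] at h1 h2 h3 h4 hκ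
  have H1 : (h (a + 1, b) = κ + 1 ∧ a < i₀) ∨ (h (a + 1, b) = κ - 1 ∧ i₀ ≤ a) := by omega
  have H2 : (h (a - 1, b) = κ + 1 ∧ i₀ < a) ∨ (h (a - 1, b) = κ - 1 ∧ a ≤ i₀) := by omega
  have H3 : (h (a, b + 1) = κ + 1 ∧ b < j₀) ∨ (h (a, b + 1) = κ - 1 ∧ j₀ ≤ b) := by omega
  have H4 : (h (a, b - 1) = κ + 1 ∧ j₀ < b) ∨ (h (a, b - 1) = κ - 1 ∧ b ≤ j₀) := by omega
  have n1 : (κ + 1 = κ - 1) = False := by simp; omega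
  have n2 : (κ - 1 = κ + 1) = False := by simp; omega
  clear h1 h2 h3 h4 hκ
  unfold Ex sp1 sp2 md1 md2
  simp only [sub_add_cancel, e1, e2, e3, e4, e5, e6, e7, e8]
  rcases H1 with ⟨p1, q1⟩ | ⟨p1, q1⟩ <;> rcases H2 with ⟨p2, q2⟩ | ⟨p2, q2⟩ <;>
    rcases H3 with ⟨p3, q3⟩ | ⟨p3, q3⟩ <;> rcases H4 with ⟨p4, q4⟩ | ⟨p4, q4⟩ <;>
    simp only [p1, p2, p3, p4, n1, n2, if_true, if_false] <;> split_ifs <;> omega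

/-- Unit steps. -/
def Stp (h : ℤ × ℤ → ℤ) : Prop :=
  (∀ a b : ℤ, h (a + 1, b) = h (a, b) + 1 ∨ h (a + 1, b) = h (a, b) - 1) ∧
  (∀ a b : ℤ, h (a, b + 1) = h (a, b) + 1 ∨ h (a, b + 1) = h (a, b) - 1)

lemma Stp.e {h : ℤ × ℤ → ℤ} (H : Stp h) (a b : ℤ) :
    h (a + 1, b) = h (a, b) + 1 ∨ h (a + 1, b) = h (a, b) - 1 := H.1 a b
lemma Stp.n {h : ℤ × ℤ → ℤ} (H : Stp h) (a b : ℤ) :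
    h (a, b + 1) = h (a, b) + 1 ∨ h (a, b + 1) = h (a, b) - 1 := H.2 a b
lemma Stp.w {h : ℤ × ℤ → ℤ} (H : Stp h) (a b : ℤ) :
    h (a - 1, b) = h (a, b) + 1 ∨ h (a - 1, b) = h (a, b) - 1 := by
  have := H.1 (a - 1) b
  simp only [sub_add_cancel] at this
  omega
lemma Stp.s {h : ℤ × ℤ → ℤ} (H : Stp h) (a b : ℤ) :
    h (a, b - 1) = h (a, b) + 1 ∨ h (a, b - 1) = h (a, b) - 1 := by
  have := H.2 a (b - 1)
  simp only [sub_add_cancel] at this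
  omega

lemma stp_update {h : ℤ × ℤ → ℤ} (H : Stp h) (i j m : ℤ) (c : h (i, j) = m)
    (n : h (i, j + 1) = m + 1) (s : h (i, j - 1) = m + 1) (e : h (i + 1, j) = m + 1)
    (w : h (i - 1, j) = m + 1) : Stp (Function.update h (i, j) (m + 2)) := by
  constructor
  · intro a b
    have := H.e a b
    simp only [Function.update_apply, Prod.mk.injEq]
    split_ifs with h1 h2 h2
    · omega
    · obtain ⟨h1, rfl⟩ := h1
      have : a = i - 1 := by omega
      subst this
      omega
    · obtain ⟨rfl, rfl⟩ := h2
      omega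
    · exact this
  · intro a b
    have := H.n a b
    simp only [Function.update_apply, Prod.mk.injEq]
    split_ifs with h1 h2 h2
    · omega
    · obtain ⟨rfl, h1⟩ := h1
      have : b = j - 1 := by omega
      subst this
      omega
    · obtain ⟨rfl, rfl⟩ := h2
      omega
    · exact this

lemma loc_of {h : ℤ × ℤ → ℤ} (H : Stp h) (i j m : ℤ) (c : h (i, j) = m)
    (n : h (i, j + 1) = m + 1) (s : h (i, j - 1) = m + 1) (e : h (i + 1, j) = m + 1)
    (w : h (i - 1, j) = m + 1) : Loc h (Function.update h (i, j) (m + 2)) i j m where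
  c := c
  c' := by simp
  n := n
  s := s
  e := e
  w := w
  ne := by have := H.n (i + 1) j; omega
  nw := by have := H.n (i - 1) j; omega
  se := by have := H.s (i + 1) j; omega
  sw := by have := H.s (i - 1) j; omega
  nn := by have := H.n i (j + 1); omega
  ss := by have := H.s i (j - 1); omega
  ee := by have := H.e (i + 1) j; omega
  ww := by have := H.w (i - 1) j; omega
  off := by
    intro a b hab
    rw [Function.update_of_ne]
    simpa using hab

lemma base_sum (i₀ j₀ k₀ : ℤ) (P : ℤ → ℤ → F) (Φ : Finset (ℤ × ℤ)) (B : Finset Edge)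
    (hp : (i₀, j₀) ∈ Φ) (hd : ∀ a b, Edge.d a b ∉ B) (t : ℤ × ℤ → F) :
    ∑ X ∈ B.powerset, (if Cmp (Kp i₀ j₀ k₀) X then Wt P Φ t (Kp i₀ j₀ k₀) X else 0) =
      t (i₀, j₀) := by
  rw [Finset.sum_eq_single ∅]
  · rw [if_pos (base_cmp _ _ _)]
    unfold Wt
    simp only [Finset.prod_empty, mul_one]
    rw [Finset.prod_eq_single (i₀, j₀)]
    · rw [base_ex (i₀ := i₀) (j₀ := j₀) (k₀ := k₀) _ _ _ _ rfl rfl rfl rfl] <;> simp [ind]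
    · rintro ⟨a, b⟩ _ hne
      rw [base_ex (i₀ := i₀) (j₀ := j₀) (k₀ := k₀) _ _ _ _ rfl rfl rfl rfl]
      · rw [if_neg (by simpa using hne)]; simp
      · simp [ind]
      · simp [ind]
    · intro h; exact absurd hp h
  · intro X hX hne
    rw [if_neg]
    intro hc
    apply hne
    apply base_empty hc
    intro a b hab
    exact hd a b (Finset.mem_powerset.1 hX hab)
  · simp

theorem main_ind (i₀ j₀ k₀ : ℤ) (P : ℤ → ℤ → F) (U : ℤ × ℤ → ℤ → F) (hU : ∀ g m, U g m ≠ 0)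
    (k : ℤ × ℤ → ℤ)
    (S0 Φ : Finset (ℤ × ℤ)) (B : Finset Edge)
    (hB : ∀ i j : ℤ, (i, j) ∈ S0 → Edge.h i j ∈ B ∧ Edge.h i (j - 1) ∈ B ∧ Edge.v i j ∈ B ∧
      Edge.v (i - 1) j ∈ B)
    (hd : ∀ a b, Edge.d a b ∉ B)
    (hΦ : ∀ i j : ℤ, (i, j) ∈ S0 → (i, j) ∈ Φ ∧ (i, j + 1) ∈ Φ ∧ (i, j - 1) ∈ Φ ∧
      (i + 1, j) ∈ Φ ∧ (i - 1, j) ∈ Φ)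
    (hp : (i₀, j₀) ∈ Φ)
    (hrec : ∀ i j m : ℤ, k (i, j) ≤ m → (Kp i₀ j₀ k₀ (i, j) - m) % 2 = 0 → -1 ≤ m →
      U (i, j) m * U (i, j) (m + 2) = P i (j + m + 2) * (P i (j - 1 - m))⁻¹ *
        U (i - 1, j) (m + 1) * U (i + 1, j) (m + 1) + U (i, j - 1) (m + 1) * U (i, j + 1) (m + 1)) :
    ∀ (n : ℕ) (h : ℤ × ℤ → ℤ), (∑ g ∈ S0, (Kp i₀ j₀ k₀ g - h g).toNat = n) → Stp h →
      (∀ g, (Kp i₀ j₀ k₀ g - h g) % 2 = 0) → (∀ g, h g ≤ Kp i₀ j₀ k₀ g) →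
      (∀ g, h g < Kp i₀ j₀ k₀ g → g ∈ S0) → (∀ g ∈ S0, -1 ≤ h g ∧ k g ≤ h g) →
      ∑ X ∈ B.powerset, (if Cmp h X then Wt P Φ (fun g => U g (h g)) h X else 0) =
        U (i₀, j₀) k₀ := by
  intro n
  induction n using Nat.strong_induction_on with
  | _ n ih =>
  intro h hn hs hpar hle hin hlow
  by_cases hemp : ∃ g ∈ S0, h g < Kp i₀ j₀ k₀ g
  · have hne : (S0.filter (fun g => h g < Kp i₀ j₀ k₀ g)).Nonempty := by
      obtain ⟨g, hg, hg'⟩ := hemp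
      exact ⟨g, Finset.mem_filter.2 ⟨hg, hg'⟩⟩
    obtain ⟨⟨i, j⟩, hf, hmin⟩ := Finset.exists_min_image _ h hne
    obtain ⟨hfS, hfK⟩ := Finset.mem_filter.1 hf
    have hmin' : ∀ g, h g < Kp i₀ j₀ k₀ g → h (i, j) ≤ h g := fun g hg =>
      hmin g (Finset.mem_filter.2 ⟨hin g hg, hg⟩)
    have par := hpar (i, j)
    set m := h (i, j) with hm
    have key : ∀ a b : ℤ, Kp i₀ j₀ k₀ (i, j) - 1 ≤ Kp i₀ j₀ k₀ (a, b) →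
        (h (a, b) = m + 1 ∨ h (a, b) = m - 1) → h (a, b) = m + 1 := by
      intro a b h1 h2
      by_cases h3 : h (a, b) < Kp i₀ j₀ k₀ (a, b)
      · have := hmin' _ h3; omega
      · have := hle (a, b); omega
    have hN : h (i, j + 1) = m + 1 := by
      apply key
      · simp only [Kp, abs_eq_max_neg]; omega
      · have := hs.n i j; omega
    have hS : h (i, j - 1) = m + 1 := by
      apply key
      · simp only [Kp, abs_eq_max_neg]; omega
      · have := hs.s i j; omega
    have hE : h (i + 1, j) = m + 1 := by
      apply key
      · simp only [Kp, abs_eq_max_neg]; omega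
      · have := hs.e i j; omega
    have hW : h (i - 1, j) = m + 1 := by
      apply key
      · simp only [Kp, abs_eq_max_neg]; omega
      · have := hs.w i j; omega
    have L := loc_of hs i j m rfl hN hS hE hW
    have hs' := stp_update hs i j m rfl hN hS hE hW
    set h' := Function.update h (i, j) (m + 2) with hh'
    have h'c : h' (i, j) = m + 2 := L.c'
    have h'o : ∀ g, g ≠ (i, j) → h' g = h g := fun g hg => by
      rw [hh', Function.update_of_ne hg]
    obtain ⟨b1, b2, b3, b4⟩ := hB i j hfS
    obtain ⟨f0, f1, f2, f3, f4⟩ := hΦ i j hfS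
    obtain ⟨l1, l2⟩ := hlow (i, j) hfS
    rw [move P Φ (fun g => U g (h g)) (fun g => U g (h' g)) h h' i j m L B b1 b2 b3 b4 f0 f1 f2 f3
      f4 (fun g => hU _ _) (hU _ _) (fun g hg => by simp only [h'o g hg])
      (by
        simp only [h'c, hN, hS, hE, hW, ← hm]
        exact hrec i j m l2 par l1)]
    refine ih _ ?_ h' rfl hs' ?_ ?_ ?_ ?_
    · rw [← hn]
      apply Finset.sum_lt_sum
      · intro g hg
        by_cases hgc : g = (i, j)
        · subst hgc; rw [h'c]; omega
        · rw [h'o g hgc]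
      · exact ⟨(i, j), hfS, by rw [h'c]; omega⟩
    · intro g
      by_cases hgc : g = (i, j)
      · subst hgc; rw [h'c]; omega
      · rw [h'o g hgc]; exact hpar g
    · intro g
      by_cases hgc : g = (i, j)
      · subst hgc; rw [h'c]; omega
      · rw [h'o g hgc]; exact hle g
    · intro g hg
      by_cases hgc : g = (i, j)
      · subst hgc; exact hfS
      · rw [h'o g hgc] at hg; exact hin g hg
    · intro g hg
      by_cases hgc : g = (i, j)
      · subst hgc; rw [h'c]; omega
      · rw [h'o g hgc]; exact hlow g hg
  · have : h = Kp i₀ j₀ k₀ := by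
      funext g
      have h1 := hle g
      by_contra hc
      have h2 : h g < Kp i₀ j₀ k₀ g := by omega
      exact hemp ⟨g, hin g h2, h2⟩
    subst this
    rw [base_sum i₀ j₀ k₀ P Φ B hp hd]
    simp [Kp]

def mi (M : Set Edge) (e : Edge) : ℤ := if e ∈ M then 1 else 0

lemma mi_cases (M : Set Edge) (e : Edge) : (mi M e = 0 ∧ e ∉ M) ∨ (mi M e = 1 ∧ e ∈ M) := by
  unfold mi; split_ifs with h <;> simp [h]

lemma eu3 (M : Set Edge) (a b c : Edge) (h1 : a ≠ b) (h2 : a ≠ c) (h3 : b ≠ c) :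
    (∃! e, e ∈ M ∧ (e = a ∨ e = b ∨ e = c)) ↔ mi M a + mi M b + mi M c = 1 := by
  have e : (∃! e, e ∈ M ∧ (e = a ∨ e = b ∨ e = c)) ↔
      ((a ∈ M ∧ b ∉ M ∧ c ∉ M) ∨ (a ∉ M ∧ b ∈ M ∧ c ∉ M) ∨ (a ∉ M ∧ b ∉ M ∧ c ∈ M)) := by
    constructor
    · rintro ⟨e, ⟨he, h⟩, hu⟩
      have q1 := hu a
      have q2 := hu b
      have q3 := hu c
      simp only [true_or, or_true, and_true] at q1 q2 q3
      grind
    · rintro (⟨p, q, r⟩ | ⟨p, q, r⟩ | ⟨p, q, r⟩)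
      · exact ⟨a, by simp [p], by grind⟩
      · exact ⟨b, by simp [q], by grind⟩
      · exact ⟨c, by simp [r], by grind⟩
  rw [e]
  rcases mi_cases M a with ⟨p, p'⟩ | ⟨p, p'⟩ <;> rcases mi_cases M b with ⟨q, q'⟩ | ⟨q, q'⟩ <;>
  rcases mi_cases M c with ⟨r, r'⟩ | ⟨r, r'⟩ <;> simp [p, p', q, q', r, r']

lemma eu4 (M : Set Edge) (a b c d : Edge) (h1 : a ≠ b) (h2 : a ≠ c) (h3 : b ≠ c)
    (h4 : a ≠ d) (h5 : b ≠ d) (h6 : c ≠ d) :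
    (∃! e, e ∈ M ∧ (e = a ∨ e = b ∨ e = c ∨ e = d)) ↔
      mi M a + mi M b + mi M c + mi M d = 1 := by
  have e : (∃! e, e ∈ M ∧ (e = a ∨ e = b ∨ e = c ∨ e = d)) ↔
      ((a ∈ M ∧ b ∉ M ∧ c ∉ M ∧ d ∉ M) ∨ (a ∉ M ∧ b ∈ M ∧ c ∉ M ∧ d ∉ M) ∨
       (a ∉ M ∧ b ∉ M ∧ c ∈ M ∧ d ∉ M) ∨ (a ∉ M ∧ b ∉ M ∧ c ∉ M ∧ d ∈ M)) := by
    constructor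
    · rintro ⟨e, ⟨he, h⟩, hu⟩
      have q1 := hu a
      have q2 := hu b
      have q3 := hu c
      have q4 := hu d
      simp only [true_or, or_true, and_true] at q1 q2 q3 q4
      grind
    · rintro (⟨p, q, r, s⟩ | ⟨p, q, r, s⟩ | ⟨p, q, r, s⟩ | ⟨p, q, r, s⟩)
      · exact ⟨a, by simp [p], by grind⟩
      · exact ⟨b, by simp [q], by grind⟩
      · exact ⟨c, by simp [r], by grind⟩
      · exact ⟨d, by simp [s], by grind⟩
  rw [e]
  rcases mi_cases M a with ⟨p, p'⟩ | ⟨p, p'⟩ <;> rcases mi_cases M b with ⟨q, q'⟩ | ⟨q, q'⟩ <;>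
  rcases mi_cases M c with ⟨r, r'⟩ | ⟨r, r'⟩ <;> rcases mi_cases M d with ⟨s, s'⟩ | ⟨s, s'⟩ <;>
  simp [p, p', q, q', r, r', s, s']

lemma mem_iff (h : ℤ × ℤ → ℤ) (i j : ℤ) (β : Bool) (e : Edge) :
    Edge.mem h ((i, j), β) e ↔ (e = Edge.h (i + 1) j ∧ β = Edge.tBC h (i, j)) ∨
      (e = Edge.h i j ∧ β = Edge.tAD h (i, j)) ∨
      (e = Edge.v i (j + 1) ∧ β = (Edge.tAD h (i, j) || Edge.tBC h (i, j))) ∨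
      (e = Edge.v i j ∧ β = false) ∨
      (e = Edge.d i j ∧ (β = Edge.tAD h (i, j) ∨ β = Edge.tBC h (i, j))) := by
  rcases e with ⟨a, b⟩ | ⟨a, b⟩ | ⟨a, b⟩
  · simp only [Edge.mem, Edge.ends, Prod.mk.injEq, Edge.h.injEq, reduceCtorEq, false_and, or_false]
    constructor
    · rintro (⟨⟨rfl, rfl⟩, h3⟩ | ⟨⟨rfl, rfl⟩, h3⟩)
      · left; exact ⟨by simp, h3⟩
      · right; exact ⟨by simp, h3⟩
    · rintro (⟨⟨rfl, rfl⟩, h3⟩ | ⟨⟨rfl, rfl⟩, h3⟩)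
      · left; simpa using h3
      · right; exact ⟨by simp, h3⟩
  · simp only [Edge.mem, Edge.ends, Prod.mk.injEq, Edge.v.injEq, reduceCtorEq, false_and, or_false,
      false_or]
    constructor
    · rintro (⟨⟨rfl, rfl⟩, h3⟩ | ⟨⟨rfl, rfl⟩, h3⟩)
      · left; exact ⟨by simp, h3⟩
      · right; exact ⟨by simp, h3⟩
    · rintro (⟨⟨rfl, rfl⟩, h3⟩ | ⟨⟨rfl, rfl⟩, h3⟩)
      · left; simpa using h3
      · right; exact ⟨by simp, h3⟩
  · simp only [Edge.mem, Edge.ends, Prod.mk.injEq, Edge.d.injEq, reduceCtorEq, false_and, or_false,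
      false_or]
    constructor
    · rintro (⟨⟨rfl, rfl⟩, h3⟩ | ⟨⟨rfl, rfl⟩, h3⟩)
      · exact ⟨by simp, Or.inl h3⟩
      · exact ⟨by simp, Or.inr h3⟩
    · rintro ⟨⟨rfl, rfl⟩, h3 | h3⟩
      · left; simpa using h3
      · right; simpa using h3

/-- Local perfect matching conditions. -/
structure PS (h : ℤ × ℤ → ℤ) (M : Set Edge) (i j : ℤ) : Prop where
  ns : h (i, j) = h (i + 1, j + 1) → h (i + 1, j) = h (i, j + 1) →
    mi M (Edge.v i j) + mi M (Edge.v i (j + 1)) + mi M (Edge.h i j) + mi M (Edge.h (i + 1) j) = 1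
  ad : h (i + 1, j) ≠ h (i, j + 1) →
    mi M (Edge.v i j) + mi M (Edge.h (i + 1) j) + mi M (Edge.d i j) = 1 ∧
    mi M (Edge.v i (j + 1)) + mi M (Edge.h i j) + mi M (Edge.d i j) = 1
  bc : h (i, j) ≠ h (i + 1, j + 1) →
    mi M (Edge.v i j) + mi M (Edge.h i j) + mi M (Edge.d i j) = 1 ∧
    mi M (Edge.v i (j + 1)) + mi M (Edge.h (i + 1) j) + mi M (Edge.d i j) = 1

lemma eu_congr {p q : Edge → Prop} (h : ∀ e, p e ↔ q e) : (∃! e, p e) ↔ (∃! e, q e) := by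
  have : p = q := funext fun e => propext (h e)
  rw [this]

lemma pm_iff (h : ℤ × ℤ → ℤ) (hs : Stp h) (M : Set Edge) :
    IsPerfectMatching h {e | e.valid h} M ↔
      (∀ e ∈ M, e.valid h) ∧ ∀ i j, PS h M i j := by
  unfold IsPerfectMatching
  have hv : ∀ i j, Edge.v i j ∈ {e : Edge | e.valid h} := fun i j => by simp [Edge.valid]
  have hh : ∀ i j, Edge.h i j ∈ {e : Edge | e.valid h} := fun i j => by simp [Edge.valid]
  have key : ∀ i j : ℤ, (∀ e ∈ M, e.valid h) → ((∀ β, ((i, j), β) ∈ VG h {e | e.valid h} →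
      ∃! e, e ∈ M ∧ Edge.mem h ((i, j), β) e) ↔ PS h M i j) := by
    intro i j hM
    have s1 := hs.e i j
    have s2 := hs.n i j
    have s3 := hs.n (i + 1) j
    have s4 := hs.e i (j + 1)
    by_cases c1 : h (i + 1, j) = h (i, j + 1)
    · have t1 : Edge.tAD h (i, j) = false := by simp [Edge.tAD, c1]
      by_cases c2 : h (i, j) = h (i + 1, j + 1)
      · have t2 : Edge.tBC h (i, j) = false := by simp [Edge.tBC, c2]
        have hd : Edge.d i j ∉ M := fun hd => by
          have := hM _ hd
          simp [Edge.valid, c1, c2] at this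
        have e1 : (∃! e, e ∈ M ∧ Edge.mem h ((i, j), false) e) ↔ mi M (Edge.v i j) +
            mi M (Edge.v i (j + 1)) + mi M (Edge.h i j) + mi M (Edge.h (i + 1) j) = 1 := by
          rw [← eu4]
          · apply eu_congr
            intro e
            rw [mem_iff]
            simp only [t1, t2]
            grind
          all_goals simp
        constructor
        · intro H
          have := H false ⟨Edge.v i j, hv _ _, by rw [mem_iff]; simp⟩
          rw [e1] at this
          exact ⟨fun _ _ => this, fun q => absurd c1 q, fun q => absurd c2 q⟩
        · intro H β hβ
          cases β
          · rw [e1]; exact H.ns c2 c1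
          · obtain ⟨e, _, he⟩ := hβ
            rw [mem_iff] at he
            simp [t1, t2] at he
      · have t2 : Edge.tBC h (i, j) = true := by simp [Edge.tBC, c2]
        have e1 : (∃! e, e ∈ M ∧ Edge.mem h ((i, j), false) e) ↔ mi M (Edge.v i j) +
            mi M (Edge.h i j) + mi M (Edge.d i j) = 1 := by
          rw [← eu3]
          · apply eu_congr
            intro e
            rw [mem_iff]
            simp only [t1, t2]
            grind
          all_goals simp
        have e2 : (∃! e, e ∈ M ∧ Edge.mem h ((i, j), true) e) ↔ mi M (Edge.v i (j + 1)) +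
            mi M (Edge.h (i + 1) j) + mi M (Edge.d i j) = 1 := by
          rw [← eu3]
          · apply eu_congr
            intro e
            rw [mem_iff]
            simp only [t1, t2]
            grind
          all_goals simp
        constructor
        · intro H
          have := H false ⟨Edge.v i j, hv _ _, by rw [mem_iff]; simp⟩
          have h2 := H true ⟨Edge.v i (j + 1), hv _ _, by rw [mem_iff]; simp [t1, t2]⟩
          rw [e1] at this
          rw [e2] at h2
          exact ⟨fun q => absurd q c2, fun q => absurd c1 q, fun _ => ⟨this, h2⟩⟩
        · intro H β hβ
          cases β
          · rw [e1]; exact (H.bc c2).1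
          · rw [e2]; exact (H.bc c2).2
    · have t1 : Edge.tAD h (i, j) = true := by simp [Edge.tAD, c1]
      have c2 : h (i, j) = h (i + 1, j + 1) := by omega
      have t2 : Edge.tBC h (i, j) = false := by simp [Edge.tBC, c2]
      have e1 : (∃! e, e ∈ M ∧ Edge.mem h ((i, j), false) e) ↔ mi M (Edge.v i j) +
          mi M (Edge.h (i + 1) j) + mi M (Edge.d i j) = 1 := by
        rw [← eu3]
        · apply eu_congr
          intro e
          rw [mem_iff]
          simp only [t1, t2]
          grind
        all_goals simp
      have e2 : (∃! e, e ∈ M ∧ Edge.mem h ((i, j), true) e) ↔ mi M (Edge.v i (j + 1)) +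
          mi M (Edge.h i j) + mi M (Edge.d i j) = 1 := by
        rw [← eu3]
        · apply eu_congr
          intro e
          rw [mem_iff]
          simp only [t1, t2]
          grind
        all_goals simp
      constructor
      · intro H
        have := H false ⟨Edge.v i j, hv _ _, by rw [mem_iff]; simp⟩
        have h2 := H true ⟨Edge.v i (j + 1), hv _ _, by rw [mem_iff]; simp [t1, t2]⟩
        rw [e1] at this
        rw [e2] at h2
        exact ⟨fun _ q => absurd q c1, fun _ => ⟨this, h2⟩, fun q => absurd c2 q⟩
      · intro H β hβ
        cases β
        · rw [e1]; exact (H.ad c1).1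
        · rw [e2]; exact (H.ad c1).2
  constructor
  · rintro ⟨hM, H⟩
    exact ⟨hM, fun i j => (key i j hM).1 (fun β hβ => H _ hβ)⟩
  · rintro ⟨hM, H⟩
    refine ⟨hM, ?_⟩
    rintro ⟨⟨i, j⟩, β⟩ hβ
    exact (key i j hM).2 (H i j) β hβ

/-- The matching determined by its horizontal and vertical edges. -/
def Mof (h : ℤ × ℤ → ℤ) (X : Finset Edge) : Set Edge := fun e =>
  match e with
  | Edge.d i j => md1 h (ind X) i j = 1 ∨ md2 h (ind X) i j = 1
  | Edge.h i j => Edge.h i j ∈ X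
  | Edge.v i j => Edge.v i j ∈ X

lemma mof_h (h : ℤ × ℤ → ℤ) (X : Finset Edge) (i j : ℤ) :
    Edge.h i j ∈ Mof h X ↔ Edge.h i j ∈ X := Iff.rfl
lemma mof_v (h : ℤ × ℤ → ℤ) (X : Finset Edge) (i j : ℤ) :
    Edge.v i j ∈ Mof h X ↔ Edge.v i j ∈ X := Iff.rfl
lemma mof_d (h : ℤ × ℤ → ℤ) (X : Finset Edge) (i j : ℤ) :
    Edge.d i j ∈ Mof h X ↔ (md1 h (ind X) i j = 1 ∨ md2 h (ind X) i j = 1) := Iff.rfl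
lemma mi_mof_h (h : ℤ × ℤ → ℤ) (X : Finset Edge) (i j : ℤ) :
    mi (Mof h X) (Edge.h i j) = ind X (Edge.h i j) := by
  unfold mi ind; simp only [mof_h]
lemma mi_mof_v (h : ℤ × ℤ → ℤ) (X : Finset Edge) (i j : ℤ) :
    mi (Mof h X) (Edge.v i j) = ind X (Edge.v i j) := by
  unfold mi ind; simp only [mof_v]

lemma mi_mof_d (h : ℤ × ℤ → ℤ) (hs : Stp h) (X : Finset Edge) (hX : Cmp h X) (i j : ℤ) :
    mi (Mof h X) (Edge.d i j) = md1 h (ind X) i j + md2 h (ind X) i j := by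
  have s1 := hs.e i j
  have s2 := hs.n i j
  have s3 := hs.n (i + 1) j
  have s4 := hs.e i (j + 1)
  have q1 := ind_nonneg X (Edge.v i j)
  have q2 := ind_nonneg X (Edge.h i j)
  have q3 := ind_nonneg X (Edge.h (i + 1) j)
  obtain ⟨a1, a2, a3⟩ := hX i j
  unfold mi
  simp only [mof_d]
  unfold md1 md2
  split_ifs <;> omega

lemma mof_ps (h : ℤ × ℤ → ℤ) (hs : Stp h) (X : Finset Edge) (hX : Cmp h X) :
    (∀ e ∈ Mof h X, e.valid h) ∧ ∀ i j, PS h (Mof h X) i j := by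
  constructor
  · rintro (⟨i, j⟩ | ⟨i, j⟩ | ⟨i, j⟩) he
    · trivial
    · trivial
    · rw [mof_d] at he
      unfold md1 md2 at he
      unfold Edge.valid
      split_ifs at he <;> first | omega | tauto
  · intro i j
    have s1 := hs.e i j
    have s2 := hs.n i j
    have s3 := hs.n (i + 1) j
    have s4 := hs.e i (j + 1)
    obtain ⟨a1, a2, a3⟩ := hX i j
    constructor <;> simp only [mi_mof_h, mi_mof_v, mi_mof_d h hs X hX] <;> try unfold md1 md2
    · exact a1
    · intro c1
      have := a2 c1
      rw [if_neg c1, if_pos (by omega)]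
      omega
    · intro c1
      have := a3 c1
      rw [if_neg c1, if_pos (by omega)]
      omega

lemma ps_mof (h : ℤ × ℤ → ℤ) (hs : Stp h) (M : Set Edge) (hM : ∀ e ∈ M, e.valid h)
    (hP : ∀ i j, PS h M i j) (X : Finset Edge)
    (hh : ∀ i j, Edge.h i j ∈ X ↔ Edge.h i j ∈ M)
    (hv : ∀ i j, Edge.v i j ∈ X ↔ Edge.v i j ∈ M) : Cmp h X ∧ M = Mof h X := by
  have ih : ∀ i j, mi M (Edge.h i j) = ind X (Edge.h i j) := fun i j => by
    unfold mi ind; simp only [hh]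
  have iv : ∀ i j, mi M (Edge.v i j) = ind X (Edge.v i j) := fun i j => by
    unfold mi ind; simp only [hv]
  constructor
  · intro i j
    obtain ⟨a1, a2, a3⟩ := hP i j
    simp only [ih, iv] at a1 a2 a3
    refine ⟨a1, fun c => ?_, fun c => ?_⟩
    · have := a2 c
      rcases mi_cases M (Edge.d i j) with q | q <;> omega
    · have := a3 c
      rcases mi_cases M (Edge.d i j) with q | q <;> omega
  · ext e
    rcases e with ⟨i, j⟩ | ⟨i, j⟩ | ⟨i, j⟩
    · rw [mof_h, hh]
    · rw [mof_v, hv]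
    · rw [mof_d]
      have s1 := hs.e i j
      have s2 := hs.n i j
      have s3 := hs.n (i + 1) j
      have s4 := hs.e i (j + 1)
      obtain ⟨a1, a2, a3⟩ := hP i j
      simp only [ih, iv] at a1 a2 a3
      have hv := hM (Edge.d i j)
      unfold Edge.valid at hv
      unfold md1 md2
      rcases mi_cases M (Edge.d i j) with ⟨q, q'⟩ | ⟨q, q'⟩ <;> simp only [q', true_imp_iff] at * <;>
        split_ifs <;> simp <;> omega

lemma pm_mof (h : ℤ × ℤ → ℤ) (hs : Stp h) (B : Finset Edge) (hd : ∀ a b, Edge.d a b ∉ B)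
    (M : Set Edge) :
    (IsPerfectMatching h {e | e.valid h} M ∧ (∀ i j, Edge.h i j ∈ M → Edge.h i j ∈ B) ∧
      (∀ i j, Edge.v i j ∈ M → Edge.v i j ∈ B)) ↔ ∃ X ∈ B.powerset, Cmp h X ∧ M = Mof h X := by
  constructor
  · rintro ⟨h1, h2, h3⟩
    rw [pm_iff h hs] at h1
    refine ⟨B.filter (· ∈ M), by simp, ?_⟩
    apply ps_mof h hs M h1.1 h1.2
    · intro i j; simp; exact h2 i j
    · intro i j; simp; exact h3 i j
  · rintro ⟨X, hX, hc, rfl⟩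
    rw [pm_iff h hs]
    exact ⟨mof_ps h hs X hc, fun i j q => Finset.mem_powerset.1 hX q,
      fun i j q => Finset.mem_powerset.1 hX q⟩

lemma mof_inj (h : ℤ × ℤ → ℤ) (B : Finset Edge) (hd : ∀ a b, Edge.d a b ∉ B) (X Y : Finset Edge)
    (hX : X ∈ B.powerset) (hY : Y ∈ B.powerset) (e : Mof h X = Mof h Y) : X = Y := by
  ext x
  rcases x with ⟨i, j⟩ | ⟨i, j⟩ | ⟨i, j⟩
  · rw [← mof_h h X, e, mof_h]
  · rw [← mof_v h X, e, mof_v]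
  · constructor
    · intro q; exact absurd (Finset.mem_powerset.1 hX q) (hd i j)
    · intro q; exact absurd (Finset.mem_powerset.1 hY q) (hd i j)

def star (i j : ℤ) : Finset Edge :=
  {Edge.h i j, Edge.h i (j - 1), Edge.v i j, Edge.v (i - 1) j,
    Edge.d i j, Edge.d (i - 1) (j - 1), Edge.d (i - 1) j, Edge.d i (j - 1)}

lemma side_star (h : ℤ × ℤ → ℤ) (i j : ℤ) (e : Edge) (he : e.isSide h (i, j)) : e ∈ star i j := by
  unfold star
  rcases e with ⟨a, b⟩ | ⟨a, b⟩ | ⟨a, b⟩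
  · simp only [Edge.isSide, Prod.mk.injEq] at he
    simp; omega
  · simp only [Edge.isSide, Prod.mk.injEq] at he
    simp; omega
  · simp only [Edge.isSide, Prod.mk.injEq] at he
    split_ifs at he <;> simp <;> omega

lemma ncard_diff (A M : Set Edge) (L : Finset Edge) (hA : ∀ e ∈ A, e ∈ L) :
    (((A \ M).ncard : ℤ) - ((A ∩ M).ncard : ℤ)) = ∑ e ∈ L, (if e ∈ A then 1 - 2 * mi M e else 0) := by
  have e1 : A \ M = ((L.filter (fun e => e ∈ A ∧ e ∉ M) : Finset Edge) : Set Edge) := by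
    ext e; simp; tauto
  have e2 : A ∩ M = ((L.filter (fun e => e ∈ A ∧ e ∈ M) : Finset Edge) : Set Edge) := by
    ext e; simp; tauto
  rw [e1, e2, Set.ncard_coe_finset, Set.ncard_coe_finset, Finset.card_filter, Finset.card_filter]
  push_cast
  rw [← Finset.sum_sub_distrib]
  apply Finset.sum_congr rfl
  intro e _
  unfold mi
  by_cases p : e ∈ A <;> by_cases q : e ∈ M <;> simp [p, q]

lemma sum_star (i j : ℤ) (f : Edge → ℤ) : ∑ e ∈ star i j, f e =
    f (Edge.h i j) + f (Edge.h i (j - 1)) + f (Edge.v i j) + f (Edge.v (i - 1) j) +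
    f (Edge.d i j) + f (Edge.d (i - 1) (j - 1)) + f (Edge.d (i - 1) j) + f (Edge.d i (j - 1)) := by
  unfold star
  repeat rw [Finset.sum_insert (by simp [self_ne_sub_one])]
  simp
  ring

lemma ceil_half (n : ℤ) (q : ℚ) (h : q = 2 * n) : ⌈q / 2⌉ = n := by
  subst h; simp

lemma faceExp_eq (h : ℤ × ℤ → ℤ) (hs : Stp h) (X : Finset Edge) (hX : Cmp h X) (i j : ℤ) :
    faceExp h {e | e.valid h} (Mof h X) (i, j) - 1 = Ex h (ind X) i j := by
  have key := ncard_diff (sides h {e | e.valid h} (i, j)) (Mof h X) (star i j)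
    (fun e he => side_star h i j e he.2)
  rw [sum_star] at key
  have m1 : Edge.h i j ∈ sides h {e | e.valid h} (i, j) := by
    simp [sides, Edge.valid, Edge.isSide]
  have m2 : Edge.h i (j - 1) ∈ sides h {e | e.valid h} (i, j) := by
    simp [sides, Edge.valid, Edge.isSide]
  have m3 : Edge.v i j ∈ sides h {e | e.valid h} (i, j) := by
    simp [sides, Edge.valid, Edge.isSide]
  have m4 : Edge.v (i - 1) j ∈ sides h {e | e.valid h} (i, j) := by
    simp [sides, Edge.valid, Edge.isSide]
  have dd : ∀ a b : ℤ, (Edge.d a b ∈ sides h {e | e.valid h} (i, j) ↔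
      (h (a + 1, b) ≠ h (a, b + 1) ∧ (i = a ∧ j = b ∨ i = a + 1 ∧ j = b + 1)) ∨
      (h (a, b) ≠ h (a + 1, b + 1) ∧ (i = a + 1 ∧ j = b ∨ i = a ∧ j = b + 1))) := by
    intro a b
    have s1 := hs.e a b
    have s2 := hs.n a b
    have s3 := hs.n (a + 1) b
    have s4 := hs.e a (b + 1)
    simp only [sides, Edge.valid, Edge.isSide, Edge.tAD, Set.mem_ofPred_eq, Prod.mk.injEq,
      decide_eq_true_eq]
    by_cases c1 : h (a + 1, b) = h (a, b + 1)
    · simp [c1]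
    · have c2 : h (a, b) = h (a + 1, b + 1) := by omega
      simp [c1, c2]
  have m5 : (if Edge.d i j ∈ sides h {e | e.valid h} (i, j) then
      1 - 2 * mi (Mof h X) (Edge.d i j) else 0) = sp1 h i j - 2 * md1 h (ind X) i j := by
    have s1 := hs.e i j
    have s2 := hs.n i j
    have s3 := hs.n (i + 1) j
    have s4 := hs.e i (j + 1)
    rw [mi_mof_d h hs X hX]
    simp only [dd, and_self, true_or, or_true, true_and, and_true]
    unfold sp1 md1 md2
    split_ifs <;> omega
  have m6 : (if Edge.d (i - 1) (j - 1) ∈ sides h {e | e.valid h} (i, j) then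
      1 - 2 * mi (Mof h X) (Edge.d (i - 1) (j - 1)) else 0) =
        sp1 h (i - 1) (j - 1) - 2 * md1 h (ind X) (i - 1) (j - 1) := by
    have s1 := hs.e (i - 1) (j - 1)
    have s2 := hs.n (i - 1) (j - 1)
    have s3 := hs.n (i - 1 + 1) (j - 1)
    have s4 := hs.e (i - 1) (j - 1 + 1)
    rw [mi_mof_d h hs X hX]
    simp only [dd, and_self, true_or, or_true, true_and, and_true]
    unfold sp1 md1 md2
    split_ifs <;> omega
  have m7 : (if Edge.d (i - 1) j ∈ sides h {e | e.valid h} (i, j) then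
      1 - 2 * mi (Mof h X) (Edge.d (i - 1) j) else 0) =
        sp2 h (i - 1) j - 2 * md2 h (ind X) (i - 1) j := by
    have s1 := hs.e (i - 1) j
    have s2 := hs.n (i - 1) j
    have s3 := hs.n (i - 1 + 1) j
    have s4 := hs.e (i - 1) (j + 1)
    rw [mi_mof_d h hs X hX]
    simp only [dd, and_self, true_or, or_true, true_and, and_true]
    unfold sp2 md1 md2
    split_ifs <;> omega
  have m8 : (if Edge.d i (j - 1) ∈ sides h {e | e.valid h} (i, j) then
      1 - 2 * mi (Mof h X) (Edge.d i (j - 1)) else 0) =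
        sp2 h i (j - 1) - 2 * md2 h (ind X) i (j - 1) := by
    have s1 := hs.e i (j - 1)
    have s2 := hs.n i (j - 1)
    have s3 := hs.n (i + 1) (j - 1)
    have s4 := hs.e i (j - 1 + 1)
    rw [mi_mof_d h hs X hX]
    simp only [dd, and_self, true_or, or_true, true_and, and_true]
    unfold sp2 md1 md2
    split_ifs <;> omega
  rw [if_pos m1, if_pos m2, if_pos m3, if_pos m4, m5, m6, m7, m8] at key
  simp only [mi_mof_h, mi_mof_v] at key
  have ev : (sp1 h i j + sp1 h (i - 1) (j - 1) + sp2 h (i - 1) j + sp2 h i (j - 1)) % 2 = 0 := by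
    have s1 := hs.e i j
    have s2 := hs.n i j
    have s3 := hs.w i j
    have s4 := hs.s i j
    unfold sp1 sp2
    simp only [sub_add_cancel]
    split_ifs <;> omega
  unfold faceExp Ex
  set s := sp1 h i j + sp1 h (i - 1) (j - 1) + sp2 h (i - 1) j + sp2 h i (j - 1) with hsd
  set a := ind X (Edge.h i j) + ind X (Edge.h i (j - 1)) + ind X (Edge.v i j) +
    ind X (Edge.v (i - 1) j) with ha
  set b := md1 h (ind X) i j + md1 h (ind X) (i - 1) (j - 1) + md2 h (ind X) (i - 1) j +
    md2 h (ind X) i (j - 1) with hb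
  rw [ceil_half (2 + s / 2 - a - b)]
  · ring
  · have k2 : ((sides h {e | e.valid h} (i, j) \ Mof h X).ncard : ℤ) -
        ((sides h {e | e.valid h} (i, j) ∩ Mof h X).ncard : ℤ) = 2 * (2 + s / 2 - a - b) := by
      rw [key]; omega
    exact_mod_cast k2

lemma white_iff (h : ℤ × ℤ → ℤ) (hs : Stp h) (i j : ℤ) :
    isWhite h (Edge.ends h (Edge.h i j)).1 = true ↔ h (i, j) < h (i, j + 1) := by
  have s1 := hs.e (i - 1) j
  have s2 := hs.n (i - 1) j
  have s3 := hs.n (i - 1 + 1) j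
  have s4 := hs.e (i - 1) (j + 1)
  simp only [sub_add_cancel] at s1 s2 s3 s4
  simp only [isWhite, Edge.ends, Edge.tBC, sub_add_cancel]
  by_cases c1 : h (i, j) < h (i - 1, j) <;> by_cases c2 : h (i - 1, j) = h (i, j + 1) <;>
    simp [c1, c2] <;> omega

lemma tele (P : ℤ → ℤ → F) (hP0 : ∀ i n, P i n ≠ 0) (hPs : ∀ i n, P i (n + 1) = P i n * cv (i, n))
    (i lo hi : ℤ) (hle : lo ≤ hi + 1) :
    ∏ a ∈ Finset.Icc lo hi, cv (i, a) = P i (hi + 1) * (P i lo)⁻¹ := by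
  obtain ⟨n, hn⟩ := Int.eq_ofNat_of_zero_le (show 0 ≤ hi + 1 - lo by omega)
  induction n generalizing hi with
  | zero =>
    have : hi + 1 = lo := by omega
    rw [this, mul_inv_cancel₀ (hP0 _ _), Finset.Icc_eq_empty (by omega)]
    simp
  | succ n ih =>
    have e : Finset.Icc lo hi = insert hi (Finset.Icc lo (hi - 1)) := by
      ext x; simp only [Finset.mem_Icc, Finset.mem_insert]; omega
    rw [e, Finset.prod_insert (by simp), ih (hi - 1) (by omega) (by omega), hPs i hi]
    simp only [sub_add_cancel]
    ring

def cwN (P : ℤ → ℤ → F) (h : ℤ × ℤ → ℤ) : Edge → F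
  | Edge.h i j => if h (i, j) < h (i, j + 1) then P i (j + h (i, j) + 2) else 1
  | _ => 1

def cwS (P : ℤ → ℤ → F) (h : ℤ × ℤ → ℤ) : Edge → F
  | Edge.h i j => if h (i, j) < h (i, j + 1) then 1 else (P i (j - h (i, j + 1)))⁻¹
  | _ => 1

lemma cw_split (P : ℤ → ℤ → F) (h : ℤ × ℤ → ℤ) (e : Edge) : cw P h e = cwN P h e * cwS P h e := by
  rcases e with ⟨i, j⟩ | ⟨i, j⟩ | ⟨i, j⟩
  · simp only [cw, cwN, cwS]; split_ifs <;> simp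
  · simp [cw, cwN, cwS]
  · simp [cw, cwN, cwS]

lemma wp_eq (h : ℤ × ℤ → ℤ) (hs : Stp h) (P : ℤ → ℤ → F) (hP0 : ∀ i n, P i n ≠ 0)
    (hPs : ∀ i n, P i (n + 1) = P i n * cv (i, n)) (X : Finset Edge)
    (hlow : ∀ i j, Edge.h i j ∈ X → -1 ≤ h (i, j) ∧ -1 ≤ h (i, j + 1))
    (Q : Set ((ℤ × ℤ) × (ℤ × ℤ))) (hQ : IsPerfectPairing h (Mof h X) Q) :
    wp h Q = ∏ e ∈ X, cw P h e := by
  obtain ⟨q1, q2, q3, _⟩ := hQ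
  have wh := white_iff h hs
  set fN : (ℤ × ℤ) × (ℤ × ℤ) → Edge := fun q => Edge.h q.2.1 q.2.2 with hfN
  set fS : (ℤ × ℤ) × (ℤ × ℤ) → Edge := fun q => Edge.h q.1.1 (q.1.2 - 1) with hfS
  have iN : Set.InjOn fN Q := by
    intro q hq q' hq' e
    simp only [hfN, Edge.h.injEq] at e
    obtain ⟨_, _, _, hn⟩ := q1 q hq
    exact (q3 _ _ hn).unique ⟨hq, rfl⟩ ⟨hq', Prod.ext e.1.symm e.2.symm⟩
  have iS : Set.InjOn fS Q := by
    intro q hq q' hq' e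
    simp only [hfS, Edge.h.injEq] at e
    obtain ⟨_, _, hn, _⟩ := q1 q hq
    exact (q2 _ _ hn).unique ⟨hq, rfl⟩ ⟨hq', Prod.ext e.1.symm (by have := e.2; omega)⟩
  have mN : ∀ q ∈ Q, fN q ∈ X := by
    intro q hq
    obtain ⟨_, _, _, hn⟩ := q1 q hq
    exact hn.1
  have mS : ∀ q ∈ Q, fS q ∈ X := by
    intro q hq
    obtain ⟨_, _, hn, _⟩ := q1 q hq
    exact hn.1
  have fin : Q.Finite := Set.Finite.of_injOn (t := (X : Set Edge)) (fun q hq => mS q hq) iS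
    X.finite_toSet
  have pw : ∀ q ∈ Q, pairWeight h q = cwN P h (fN q) * cwS P h (fS q) := by
    intro q hq
    obtain ⟨hc, hle, hS, hN⟩ := q1 q hq
    have l1 := (hlow _ _ (mN q hq)).1
    have l2 := (hlow _ _ (mS q hq)).2
    have w1 := (wh _ _).1 hN.2
    have w2 : ¬ _ := fun c => by
      have := (wh q.1.1 (q.1.2 - 1)).2 c
      rw [hS.2] at this
      exact absurd this (by simp)
    obtain ⟨⟨a, b⟩, ⟨c, d⟩⟩ := q
    simp only at hc hle l1 l2 w1 w2
    subst hc
    simp only [sub_add_cancel] at l2 w2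
    simp only [pairWeight, cwN, cwS, hfN, hfS, sub_add_cancel]
    rw [tele P hP0 hPs _ _ _ (by omega), if_pos w1, if_neg w2]
    congr 2
    · ring
    · congr 1; ring
  unfold wp
  rw [finprod_mem_eq_finite_toFinset_prod _ fin,
    Finset.prod_congr rfl (fun q hq => pw q (fin.mem_toFinset.1 hq)), Finset.prod_mul_distrib]
  rw [Finset.prod_congr rfl (fun e _ => cw_split P h e), Finset.prod_mul_distrib]
  congr 1
  · rw [← Finset.prod_image (f := cwN P h) (g := fN)]
    · apply Finset.prod_subset
      · intro e he
        obtain ⟨q, hq, rfl⟩ := Finset.mem_image.1 he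
        exact mN q (fin.mem_toFinset.1 hq)
      · intro e he hne
        rcases e with ⟨i, j⟩ | ⟨i, j⟩ | ⟨i, j⟩
        · simp only [cwN]
          rw [if_neg]
          intro hc
          obtain ⟨q, ⟨hq, hq'⟩, _⟩ := q3 i j ⟨he, (wh i j).2 hc⟩
          apply hne
          refine Finset.mem_image.2 ⟨q, fin.mem_toFinset.2 hq, ?_⟩
          simp only [hfN, hq']
        · simp [cwN]
        · simp [cwN]
    · intro q hq q' hq' e
      exact iN (fin.mem_toFinset.1 hq) (fin.mem_toFinset.1 hq') e
  · rw [← Finset.prod_image (f := cwS P h) (g := fS)]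
    · apply Finset.prod_subset
      · intro e he
        obtain ⟨q, hq, rfl⟩ := Finset.mem_image.1 he
        exact mS q (fin.mem_toFinset.1 hq)
      · intro e he hne
        rcases e with ⟨i, j⟩ | ⟨i, j⟩ | ⟨i, j⟩
        · simp only [cwS]
          rw [if_pos]
          by_contra hc
          obtain ⟨q, ⟨hq, hq'⟩, _⟩ := q2 i (j + 1) (by
            refine ⟨?_, ?_⟩
            · change Edge.h i (j + 1 - 1) ∈ X
              simpa using he
            · simp only [add_sub_cancel_right]
              rw [← wh] at hc
              simpa using hc)
          apply hne
          refine Finset.mem_image.2 ⟨q, fin.mem_toFinset.2 hq, ?_⟩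
          simp only [hfS, hq', add_sub_cancel_right]
        · simp [cwS]
        · simp [cwS]
    · intro q hq q' hq' e
      exact iS (fin.mem_toFinset.1 hq) (fin.mem_toFinset.1 hq') e

/-- Partial products of the coefficients. -/
def Pc (i n : ℤ) : F := (∏ a ∈ Finset.Ico 0 n, cv (i, a)) * (∏ a ∈ Finset.Ico n 0, cv (i, a))⁻¹

lemma cv_ne (v : ℤ × ℤ) : cv v ≠ 0 := by
  unfold cv
  simp
lemma tv_ne (v : ℤ × ℤ) : tv v ≠ 0 := by
  unfold tv
  simp

lemma Pc_ne (i n : ℤ) : Pc i n ≠ 0 := by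
  unfold Pc
  apply mul_ne_zero
  · exact Finset.prod_ne_zero_iff.2 fun a _ => cv_ne _
  · exact inv_ne_zero (Finset.prod_ne_zero_iff.2 fun a _ => cv_ne _)

lemma Pc_succ (i n : ℤ) : Pc i (n + 1) = Pc i n * cv (i, n) := by
  unfold Pc
  rcases le_or_gt 0 n with hn | hn
  · have e : Finset.Ico 0 (n + 1) = insert n (Finset.Ico 0 n) := by
      ext x; simp only [Finset.mem_Ico, Finset.mem_insert]; omega
    rw [e, Finset.prod_insert (by simp), Finset.Ico_eq_empty (a := n + 1) (by omega),
      Finset.Ico_eq_empty (a := n) (by omega)]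
    simp
    ring
  · have e : Finset.Ico n 0 = insert n (Finset.Ico (n + 1) 0) := by
      ext x; simp only [Finset.mem_Ico, Finset.mem_insert]; omega
    rw [e, Finset.prod_insert (by simp), Finset.Ico_eq_empty (b := n + 1) (by omega),
      Finset.Ico_eq_empty (b := n) (by omega)]
    have := cv_ne (i, n)
    field_simp

lemma coefJ_eq (i j m : ℤ) (hm : 0 ≤ m) :
    coefJ cv i j m = Pc i (j + m + 1) * (Pc i (j - m))⁻¹ := by
  unfold coefJ
  rw [← tele Pc Pc_ne Pc_succ i (j - m) (j + m) (by omega)]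
  refine Finset.prod_bij (fun a _ => j + a) ?_ ?_ ?_ ?_
  · intro a ha; simp only [Finset.mem_Icc] at *; omega
  · intro a _ b _ e; omega
  · intro b hb; simp only [Finset.mem_Icc] at hb
    exact ⟨b - j, by simp only [Finset.mem_Icc]; omega, by omega⟩
  · intros; rfl

lemma stp_of (k : ℤ × ℤ → ℤ) (hk : SteppedSurface k) : Stp k := by
  constructor
  · intro a b
    have := hk (a + 1, b) (a, b) (by simp)
    rw [abs_eq_max_neg] at this; omega
  · intro a b
    have := hk (a, b + 1) (a, b) (by simp)
    rw [abs_eq_max_neg] at this; omega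

lemma kAdj_eq (i₀ j₀ k₀ : ℤ) (k : ℤ × ℤ → ℤ) (g : ℤ × ℤ) :
    kAdj i₀ j₀ k₀ k g = min (k g) (Kp i₀ j₀ k₀ g) := rfl

lemma stp_Kp (i₀ j₀ k₀ : ℤ) : Stp (Kp i₀ j₀ k₀) := by
  constructor
  · intro a b
    simp only [Kp, abs_eq_max_neg]; omega
  · intro a b
    simp only [Kp, abs_eq_max_neg]; omega

lemma stp_kAdj (i₀ j₀ k₀ : ℤ) (k : ℤ × ℤ → ℤ) (hk : Stp k)
    (par : ∀ g, (Kp i₀ j₀ k₀ g - k g) % 2 = 0) : Stp (kAdj i₀ j₀ k₀ k) := by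
  have hK := stp_Kp i₀ j₀ k₀
  constructor
  · intro a b
    have := hk.e a b; have := hK.e a b; have := par (a, b)
    simp only [kAdj_eq]; omega
  · intro a b
    have := hk.n a b; have := hK.n a b; have := par (a, b)
    simp only [kAdj_eq]; omega

def fourE (g : ℤ × ℤ) : Finset Edge :=
  {Edge.h g.1 g.2, Edge.h g.1 (g.2 - 1), Edge.v g.1 g.2, Edge.v (g.1 - 1) g.2}

def Bs (S0 : Finset (ℤ × ℤ)) : Finset Edge := S0.biUnion fourE

lemma Bs_h (S0 : Finset (ℤ × ℤ)) (a b : ℤ) :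
    Edge.h a b ∈ Bs S0 ↔ (a, b) ∈ S0 ∨ (a, b + 1) ∈ S0 := by
  simp only [Bs, fourE, Finset.mem_biUnion, Finset.mem_insert, Finset.mem_singleton, Edge.h.injEq,
    reduceCtorEq, or_false]
  constructor
  · rintro ⟨⟨x, y⟩, hg, ⟨rfl, rfl⟩ | ⟨rfl, rfl⟩⟩
    · left; exact hg
    · right; simpa using hg
  · rintro (hg | hg)
    · exact ⟨_, hg, by simp⟩
    · exact ⟨_, hg, by simp⟩

lemma Bs_v (S0 : Finset (ℤ × ℤ)) (a b : ℤ) :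
    Edge.v a b ∈ Bs S0 ↔ (a, b) ∈ S0 ∨ (a + 1, b) ∈ S0 := by
  simp only [Bs, fourE, Finset.mem_biUnion, Finset.mem_insert, Finset.mem_singleton, Edge.v.injEq,
    reduceCtorEq, or_false, false_or]
  constructor
  · rintro ⟨⟨x, y⟩, hg, ⟨rfl, rfl⟩ | ⟨rfl, rfl⟩⟩
    · left; exact hg
    · right; simpa using hg
  · rintro (hg | hg)
    · exact ⟨_, hg, by simp⟩
    · exact ⟨_, hg, by simp⟩

lemma Bs_d (S0 : Finset (ℤ × ℤ)) (a b : ℤ) : Edge.d a b ∉ Bs S0 := by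
  simp [Bs, fourE]

lemma flp {x y : ℤ} (h : x = y + 1 ∨ x = y - 1) : y = x + 1 ∨ y = x - 1 := by omega

lemma ar (A B C D A' B' C' D' : ℤ) (s1 : B = A + 1 ∨ B = A - 1) (s2 : D = A + 1 ∨ D = A - 1)
    (s3 : C = B + 1 ∨ C = B - 1) (s4 : C = D + 1 ∨ C = D - 1)
    (t1 : B' = A' + 1 ∨ B' = A' - 1) (t2 : D' = A' + 1 ∨ D' = A' - 1)
    (t3 : C' = B' + 1 ∨ C' = B' - 1) (t4 : C' = D' + 1 ∨ C' = D' - 1)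
    (p : (A' - A) % 2 = 0) (hm : min B B' ≠ min D D') (n : B ≠ D → ¬ A < A' ∧ ¬ C < C') :
    ¬ A < A' ∧ ¬ C < C' ∧ (¬ B < B' ∨ ¬ D < D') := by
  have a : ¬ A < A' := by
    intro c
    have : A + 2 ≤ A' := by omega
    have e1 : min B B' = B := min_eq_left (by omega)
    have e2 : min D D' = D := min_eq_left (by omega)
    rw [e1, e2] at hm
    exact (n hm).1 c
  have b : ¬ C < C' := by
    intro c
    have : C + 2 ≤ C' := by omega
    have e1 : min B B' = B := min_eq_left (by omega)
    have e2 : min D D' = D := min_eq_left (by omega)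
    rw [e1, e2] at hm
    exact (n hm).2 c
  refine ⟨a, b, ?_⟩
  clear n
  by_contra hc
  have h1 : B < B' := by omega
  have h2 : D < D' := by omega
  rw [min_eq_left h1.le, min_eq_left h2.le] at hm
  omega

lemma accept_iff (i₀ j₀ k₀ : ℤ) (k : ℤ × ℤ → ℤ) (hk : Stp k)
    (par : ∀ g, (Kp i₀ j₀ k₀ g - k g) % 2 = 0) (S0 : Finset (ℤ × ℤ))
    (hS0 : ∀ g, g ∈ S0 ↔ k g < Kp i₀ j₀ k₀ g) (M : Set Edge) :
    M ∈ Acceptable i₀ j₀ k₀ k ↔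
      IsPerfectMatching (kAdj i₀ j₀ k₀ k) {e | e.valid (kAdj i₀ j₀ k₀ k)} M ∧
      (∀ i j, Edge.h i j ∈ M → Edge.h i j ∈ Bs S0) ∧
      (∀ i j, Edge.v i j ∈ M → Edge.v i j ∈ Bs S0) := by
  have hs := stp_kAdj i₀ j₀ k₀ k hk par
  have hK := stp_Kp i₀ j₀ k₀
  have inn : ∀ g, g ∈ innerF i₀ j₀ k₀ k ↔ k g < Kp i₀ j₀ k₀ g := by
    intro g
    change |g.1 - i₀| + |g.2 - j₀| < k₀ - k g ↔ _
    simp only [Kp]; omega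
  have EGh : ∀ a b, Edge.h a b ∈ EG i₀ j₀ k₀ k ↔ Edge.h a b ∈ Bs S0 := by
    intro a b
    rw [Bs_h, hS0, hS0]
    simp only [EG, Edge.valid, Edge.isSide, inn, Set.mem_ofPred_eq, true_and]
    constructor
    · rintro ⟨f, h1, rfl | rfl⟩
      · left; exact h1
      · right; exact h1
    · rintro (h | h)
      · exact ⟨_, h, Or.inl rfl⟩
      · exact ⟨_, h, Or.inr rfl⟩
  have EGv : ∀ a b, Edge.v a b ∈ EG i₀ j₀ k₀ k ↔ Edge.v a b ∈ Bs S0 := by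
    intro a b
    rw [Bs_v, hS0, hS0]
    simp only [EG, Edge.valid, Edge.isSide, inn, Set.mem_ofPred_eq, true_and]
    constructor
    · rintro ⟨f, h1, rfl | rfl⟩
      · left; exact h1
      · right; exact h1
    · rintro (h | h)
      · exact ⟨_, h, Or.inl rfl⟩
      · exact ⟨_, h, Or.inr rfl⟩
  constructor
  · rintro ⟨h1, h2⟩
    refine ⟨h1, ?_, ?_⟩
    · intro i j hm
      by_contra hc
      rw [← EGh] at hc
      have : Edge.h i j ∈ M \ EG i₀ j₀ k₀ k := ⟨hm, hc⟩
      rw [h2] at this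
      exact this.2.2
    · intro i j hm
      by_contra hc
      rw [← EGv] at hc
      have : Edge.v i j ∈ M \ EG i₀ j₀ k₀ k := ⟨hm, hc⟩
      rw [h2] at this
      exact this.2.2
  · rintro ⟨h1, h2, h3⟩
    refine ⟨h1, ?_⟩
    rw [pm_iff _ hs] at h1
    obtain ⟨hv, hP⟩ := h1
    apply Set.Subset.antisymm
    · rintro (⟨a, b⟩ | ⟨a, b⟩ | ⟨a, b⟩) ⟨hm, hn⟩
      · exact absurd ((EGh _ _).2 (h2 _ _ hm)) hn
      · exact absurd ((EGv _ _).2 (h3 _ _ hm)) hn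
      · exact ⟨hv _ hm, hn, trivial⟩
    · rintro (⟨a, b⟩ | ⟨a, b⟩ | ⟨a, b⟩) ⟨hva, hn, hdg⟩
      · exact absurd hdg (by simp [Edge.isDiag])
      · exact absurd hdg (by simp [Edge.isDiag])
      · refine ⟨?_, hn⟩
        have zh : ∀ i j, ¬ k (i, j) < Kp i₀ j₀ k₀ (i, j) →
            ¬ k (i, j + 1) < Kp i₀ j₀ k₀ (i, j + 1) → mi M (Edge.h i j) = 0 := by
          intro i j n1 n2
          unfold mi
          rw [if_neg]
          intro hm
          have := h2 _ _ hm
          rw [Bs_h, hS0, hS0] at this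
          tauto
        have zv : ∀ i j, ¬ k (i, j) < Kp i₀ j₀ k₀ (i, j) →
            ¬ k (i + 1, j) < Kp i₀ j₀ k₀ (i + 1, j) → mi M (Edge.v i j) = 0 := by
          intro i j n1 n2
          unfold mi
          rw [if_neg]
          intro hm
          have := h3 _ _ hm
          rw [Bs_v, hS0, hS0] at this
          tauto
        have z1 := zh a b
        have z2 := zh (a + 1) b
        have z3 := zv a b
        have z4 := zv a (b + 1)
        have s1 := hk.e a b
        have s2 := hk.n a b
        have s3 := hk.n (a + 1) b
        have s4 := hk.e a (b + 1)
        have t1 := hK.e a b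
        have t2 := hK.n a b
        have t3 := hK.n (a + 1) b
        have t4 := hK.e a (b + 1)
        have p1 := par (a, b)
        have hn' : ¬ (Edge.valid k (Edge.d a b) ∧ ∃ f, k f < Kp i₀ j₀ k₀ f ∧
            (Edge.d a b).isSide k f) := by
          rintro ⟨h1, f, h2, h3⟩
          exact hn ⟨h1, f, (inn f).2 h2, h3⟩
        have n1 : k (a + 1, b) ≠ k (a, b + 1) → ¬ k (a, b) < Kp i₀ j₀ k₀ (a, b) ∧
            ¬ k (a + 1, b + 1) < Kp i₀ j₀ k₀ (a + 1, b + 1) := by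
          intro hne
          have ht : Edge.tAD k (a, b) = true := by simp [Edge.tAD, hne]
          constructor
          · intro hlt
            exact hn' ⟨Or.inr hne, _, hlt, by simp [Edge.isSide, ht]⟩
          · intro hlt
            exact hn' ⟨Or.inr hne, _, hlt, by simp [Edge.isSide, ht]⟩
        have n2 : k (a, b) ≠ k (a + 1, b + 1) → ¬ k (a + 1, b) < Kp i₀ j₀ k₀ (a + 1, b) ∧
            ¬ k (a, b + 1) < Kp i₀ j₀ k₀ (a, b + 1) := by
          intro hne
          have ht : Edge.tAD k (a, b) = false := by simp [Edge.tAD]; omega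
          constructor
          · intro hlt
            exact hn' ⟨Or.inl hne, _, hlt, by simp [Edge.isSide, ht]⟩
          · intro hlt
            exact hn' ⟨Or.inl hne, _, hlt, by simp [Edge.isSide, ht]⟩
        have hd : mi M (Edge.d a b) = 1 := by
          obtain ⟨_, q1, q2⟩ := hP a b
          have hva' : kAdj i₀ j₀ k₀ k (a, b) ≠ kAdj i₀ j₀ k₀ k (a + 1, b + 1) ∨
            kAdj i₀ j₀ k₀ k (a + 1, b) ≠ kAdj i₀ j₀ k₀ k (a, b + 1) := hva
          simp only [kAdj_eq] at q1 q2 hva'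
          rcases hva' with hva' | hva'
          · obtain ⟨q3, q4⟩ := q2 hva'
            clear q2 q1
            have := ar (k (a + 1, b)) (k (a, b)) (k (a, b + 1)) (k (a + 1, b + 1))
              (Kp i₀ j₀ k₀ (a + 1, b)) (Kp i₀ j₀ k₀ (a, b)) (Kp i₀ j₀ k₀ (a, b + 1))
              (Kp i₀ j₀ k₀ (a + 1, b + 1)) (flp s1) s3 s2 (flp s4) (flp t1) t3 t2 (flp t4)
              (par (a + 1, b)) hva' n2
            obtain ⟨w2, w3, w1 | w1⟩ := this
            · have := z1 w1 w3; have := z3 w1 w2; linarith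
            · have := z2 w2 w1; have := z4 w3 w1; linarith
          · obtain ⟨q3, q4⟩ := q1 hva'
            clear q2 q1
            have := ar _ _ _ _ _ _ _ _ s1 s2 s3 s4 t1 t2 t3 t4 p1 hva' n1
            obtain ⟨w2, w3, w1 | w1⟩ := this
            · have := z2 w1 w3; have := z3 w2 w1; linarith
            · have := z1 w2 w1; have := z4 w1 w3; linarith
        rcases mi_cases M (Edge.d a b) with q | q
        · exact absurd (q.1.symm.trans hd) (by norm_num)
        · exact q.2

/-- **Perfect-matching solution for the infinite completion** (Theorem `thm:maininf`):
`T(i₀,j₀,k₀) = Σ_{M∞} w_p(M∞)·w_f(M∞)`, the sum running over all acceptable perfect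
matchings of `G_∞ = G_{k_p}` (all faces of `G_∞` are closed and faces outside
`F̊ ∪ ∂F` contribute trivially to the finitely supported product). -/
theorem perfect_matching_solution_infinite_completion
    (i₀ j₀ k₀ : ℤ) (k : ℤ × ℤ → ℤ)
    (hstep : SteppedSurface k)
    (hodd : Odd (i₀ + j₀ + k₀))
    (hoddk : ∀ f : ℤ × ℤ, Odd (f.1 + f.2 + k f))
    (hk0 : k (i₀, j₀) ≤ k₀)
    (hfund : ∀ f : ℤ × ℤ, fund f ≤ k f)
    (T : ℤ → ℤ → ℤ → F)
    (hT0 : ∀ i j : ℤ, T i j (k (i, j)) = tv (i, j))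
    (hTne : ∀ i j m : ℤ, k (i, j) ≤ m → Odd (i + j + m) → T i j m ≠ 0)
    (hTrec : ∀ i j m : ℤ, k (i, j) < m → Even (i + j + m) →
        T i j (m - 1) * T i j (m + 1) =
          coefJ cv i j m * T (i - 1) j m * T (i + 1) j m +
          coefI cv i j m * T i (j - 1) m * T i (j + 1) m)
    (pr : Set Edge → Set ((ℤ × ℤ) × (ℤ × ℤ)))
    (hpr : ∀ M ∈ Acceptable i₀ j₀ k₀ k, IsPerfectPairing (kAdj i₀ j₀ k₀ k) M (pr M)) :
    T i₀ j₀ k₀ =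
      ∑ᶠ M ∈ Acceptable i₀ j₀ k₀ k,
        wp (kAdj i₀ j₀ k₀ k) (pr M) *
          ∏ᶠ f : ℤ × ℤ, tv f ^ (faceExp (kAdj i₀ j₀ k₀ k) (Einf i₀ j₀ k₀ k) M f - 1) := by
  have hk := stp_of k hstep
  have hK := stp_Kp i₀ j₀ k₀
  have hge : ∀ g, -1 ≤ k g := by
    intro g
    have := hfund g
    unfold fund at this
    omega
  have par : ∀ g, (Kp i₀ j₀ k₀ g - k g) % 2 = 0 := by
    intro g
    have h1 := hoddk g
    rw [Int.odd_iff] at h1 hodd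
    simp only [Kp, abs_eq_max_neg]
    omega
  have hs := stp_kAdj i₀ j₀ k₀ k hk par
  set S0 : Finset (ℤ × ℤ) := ((Finset.Icc (i₀ - (k₀ + 1)) (i₀ + (k₀ + 1))) ×ˢ
    (Finset.Icc (j₀ - (k₀ + 1)) (j₀ + (k₀ + 1)))).filter (fun g => k g < Kp i₀ j₀ k₀ g) with hS0d
  have hbox : ∀ a b, k (a, b) < Kp i₀ j₀ k₀ (a, b) →
      (i₀ - (k₀ + 1) ≤ a ∧ a ≤ i₀ + (k₀ + 1)) ∧ (j₀ - (k₀ + 1) ≤ b ∧ b ≤ j₀ + (k₀ + 1)) := by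
    intro a b hab
    have := hge (a, b)
    simp only [Kp, abs_eq_max_neg] at hab
    omega
  have hS0 : ∀ g, g ∈ S0 ↔ k g < Kp i₀ j₀ k₀ g := by
    rintro ⟨a, b⟩
    simp only [hS0d, Finset.mem_filter, Finset.mem_product, Finset.mem_Icc]
    exact ⟨fun q => q.2, fun q => ⟨hbox a b q, q⟩⟩
  set Φ : Finset (ℤ × ℤ) := ((Finset.Icc (i₀ - (k₀ + 5)) (i₀ + (k₀ + 5))) ×ˢ
    (Finset.Icc (j₀ - (k₀ + 5)) (j₀ + (k₀ + 5)))) with hΦd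
  have hΦ : ∀ a b, (a, b) ∈ Φ ↔ (i₀ - (k₀ + 5) ≤ a ∧ a ≤ i₀ + (k₀ + 5)) ∧
      (j₀ - (k₀ + 5) ≤ b ∧ b ≤ j₀ + (k₀ + 5)) := by
    intro a b
    simp only [hΦd, Finset.mem_product, Finset.mem_Icc]
  have hk1 : -1 ≤ k₀ := le_trans (hge _) hk0
  have hpΦ : (i₀, j₀) ∈ Φ := by rw [hΦ]; omega
  set h := kAdj i₀ j₀ k₀ k with hh
  have hEq : ∀ g, h g = min (k g) (Kp i₀ j₀ k₀ g) := fun g => rfl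
  set U : ℤ × ℤ → ℤ → F := fun g m =>
    if k g ≤ m ∧ Odd (g.1 + g.2 + m) then T g.1 g.2 m else tv g with hUd
  have hUne : ∀ g m, U g m ≠ 0 := by
    intro g m
    simp only [hUd]
    split_ifs with hc
    · exact hTne _ _ _ hc.1 hc.2
    · exact tv_ne g
  have hUpos : ∀ i j m, k (i, j) ≤ m → Odd (i + j + m) → U (i, j) m = T i j m := by
    intro i j m h1 h2
    simp only [hUd]
    rw [if_pos ⟨h1, h2⟩]
  have hUh : ∀ g, U g (h g) = tv g := by
    intro g
    simp only [hUd]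
    split_ifs with hc
    · have : h g = k g := le_antisymm (min_le_left _ _) hc.1
      rw [this, hT0]
    · rfl
  have hUrec : ∀ i j m : ℤ, k (i, j) ≤ m → (Kp i₀ j₀ k₀ (i, j) - m) % 2 = 0 → -1 ≤ m →
      U (i, j) m * U (i, j) (m + 2) = Pc i (j + m + 2) * (Pc i (j - 1 - m))⁻¹ *
        U (i - 1, j) (m + 1) * U (i + 1, j) (m + 1) +
        U (i, j - 1) (m + 1) * U (i, j + 1) (m + 1) := by
    intro i j m h1 h2 h3
    have o1 := hoddk (i, j)
    have p1 := par (i, j)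
    have q1 := hk.e i j
    have q2 := hk.n i j
    have q3 := hk.w i j
    have q4 := hk.s i j
    rw [Int.odd_iff] at o1
    simp only at o1
    have o : (i + j + m) % 2 = 1 := by omega
    rw [hUpos i j m h1 (by rw [Int.odd_iff]; exact o),
      hUpos i j (m + 2) (by omega) (by rw [Int.odd_iff]; omega),
      hUpos (i - 1) j (m + 1) (by omega) (by rw [Int.odd_iff]; omega),
      hUpos (i + 1) j (m + 1) (by omega) (by rw [Int.odd_iff]; omega),
      hUpos i (j - 1) (m + 1) (by omega) (by rw [Int.odd_iff]; omega),
      hUpos i (j + 1) (m + 1) (by omega) (by rw [Int.odd_iff]; omega)]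
    have R := hTrec i j (m + 1) (by omega) (by rw [Int.even_iff]; omega)
    have cI : coefI cv i j (m + 1) = 1 := by
      unfold coefI
      rw [Finset.Icc_eq_empty (by omega), Finset.prod_empty]
    rw [cI, coefJ_eq i j (m + 1) (by omega), one_mul] at R
    have e1 : m + 1 - 1 = m := by ring
    have e2 : m + 1 + 1 = m + 2 := by ring
    have e3 : j + (m + 1) + 1 = j + m + 2 := by ring
    have e4 : j - (m + 1) = j - 1 - m := by ring
    rw [e1, e2, e3, e4] at R
    exact R
  have main := main_ind i₀ j₀ k₀ Pc U hUne k S0 Φ (Bs S0)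
    (by
      intro i j hij
      refine ⟨(Bs_h _ _ _).2 (Or.inl hij), (Bs_h _ _ _).2 (Or.inr (by simpa using hij)),
        (Bs_v _ _ _).2 (Or.inl hij), (Bs_v _ _ _).2 (Or.inr (by simpa using hij))⟩)
    (Bs_d S0)
    (by
      intro i j hij
      have := hbox i j ((hS0 _).1 hij)
      simp only [hΦ]
      omega)
    hpΦ hUrec _ h rfl hs
    (by intro g; have := par g; rw [hEq]; omega)
    (fun g => min_le_right _ _)
    (by intro g hg; rw [hS0]; rw [hEq] at hg; omega)
    (by
      intro g hg
      rw [hS0] at hg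
      rw [hEq, min_eq_left hg.le]
      exact ⟨hge g, le_refl _⟩)
  simp only [hUh] at main
  have hacc : Acceptable i₀ j₀ k₀ k =
      (Mof h) '' (((Bs S0).powerset.filter (fun X => Cmp h X) : Finset (Finset Edge)) :
        Set (Finset Edge)) := by
    ext M
    rw [accept_iff i₀ j₀ k₀ k hk par S0 hS0, pm_mof _ hs _ (Bs_d S0)]
    simp only [Set.mem_image, Finset.mem_coe, Finset.mem_filter]
    constructor
    · rintro ⟨X, h1, h2, rfl⟩; exact ⟨X, ⟨h1, h2⟩, rfl⟩
    · rintro ⟨X, ⟨h1, h2⟩, rfl⟩; exact ⟨X, h1, h2, rfl⟩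
  have hterm : ∀ X ∈ (Bs S0).powerset.filter (fun X => Cmp h X),
      wp h (pr (Mof h X)) * ∏ᶠ f : ℤ × ℤ,
        tv f ^ (faceExp h (Einf i₀ j₀ k₀ k) (Mof h X) f - 1) = Wt Pc Φ tv h X := by
    intro X hX
    have hA : Mof h X ∈ Acceptable i₀ j₀ k₀ k := by
      rw [hacc]; exact ⟨X, hX, rfl⟩
    obtain ⟨hXB, hXc⟩ := Finset.mem_filter.1 hX
    have hXB' := Finset.mem_powerset.1 hXB
    rw [wp_eq h hs Pc Pc_ne Pc_succ X _ (pr (Mof h X)) (hpr _ hA)]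
    · unfold Wt
      rw [mul_comm]
      congr 1
      have hf : ∀ f : ℤ × ℤ, faceExp h (Einf i₀ j₀ k₀ k) (Mof h X) f - 1 =
          Ex h (ind X) f.1 f.2 := fun f => faceExp_eq h hs X hXc f.1 f.2
      simp only [hf]
      apply finprod_eq_prod_of_mulSupport_subset
      rintro ⟨a, b⟩ hab
      by_contra hc
      apply hab
      have hc' : (a, b) ∉ Φ := hc
      rw [hΦ] at hc'
      have far : ∀ c d, |c - a| ≤ 2 → |d - b| ≤ 2 → ¬ k (c, d) < Kp i₀ j₀ k₀ (c, d) := by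
        intro c d h1 h2 h3
        have := hbox c d h3
        rw [abs_le] at h1 h2
        omega
      have far' : ∀ c d, |c - a| ≤ 2 → |d - b| ≤ 2 → h (c, d) = Kp i₀ j₀ k₀ (c, d) := by
        intro c d h1 h2
        have := far c d h1 h2
        rw [hEq]; omega
      have E0 : Ex h (ind X) a b = 0 := by
        rw [base_ex (i₀ := i₀) (j₀ := j₀) (k₀ := k₀) h (ind X) a b
          (far' _ _ (by simp) (by simp)) (far' _ _ (by simp) (by simp))
          (far' _ _ (by simp) (by simp)) (far' _ _ (by simp) (by simp))]
        · rw [if_neg]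
          rintro ⟨rfl, rfl⟩
          omega
        · intro c d h1 h2
          unfold ind
          rw [if_neg]
          intro hm
          have := hXB' hm
          rw [Bs_h, hS0, hS0] at this
          rw [abs_le] at h1 h2
          rcases this with q | q
          · exact far _ _ (by rw [abs_le]; omega) (by rw [abs_le]; omega) q
          · exact far _ _ (by rw [abs_le]; omega) (by rw [abs_le]; omega) q
        · intro c d h1 h2
          unfold ind
          rw [if_neg]
          intro hm
          have := hXB' hm
          rw [Bs_v, hS0, hS0] at this
          rw [abs_le] at h1 h2
          rcases this with q | q
          · exact far _ _ (by rw [abs_le]; omega) (by rw [abs_le]; omega) q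
          · exact far _ _ (by rw [abs_le]; omega) (by rw [abs_le]; omega) q
      simp only [E0, zpow_zero]
    · intro i j hm
      have := hXB' hm
      rw [Bs_h, hS0, hS0] at this
      have l1 := hge (i, j)
      have l2 := hge (i, j + 1)
      have t := hK.n i j
      simp only [hEq]
      omega
  rw [hacc, finsum_mem_image, finsum_mem_coe_finset, Finset.sum_congr rfl hterm, Finset.sum_filter,
    main, hUpos i₀ j₀ k₀ hk0 hodd]
  intro X hX Y hY e
  exact mof_inj h (Bs S0) (Bs_d S0) X Y (Finset.mem_filter.1 hX).1 (Finset.mem_filter.1 hY).1 e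

end OctahedronTSystem
end
end
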